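/- arXiv:2506.07089 — 2 statements merged into one kernel-verified Lean document; each statement's English description precedes it below -/
import Mathlib

section
/- For every ε > 0 there exists a constant K_ε such that for all real X ≥ 2 and all real Q ≥ 5, the number of pairs (A,B) ∈ ℤ^2 satisfying: (i) 4A^3 + 27B^2 ≠ 0; (ii) for every prime p, if p^4 divides A then p^6 does not divide B; (iii) max(|A|,|B|) < X; and (iv) there exists a prime p > Q with p^2 dividing −16(4A^3 + 27B^2); is at most K_ε · (X^{2+ε}/Q + X^{7/4+ε}). -/
lemma dt_reduce (p t M : ℤ) :
    ∃ w1 v1 w2 v2 : ℤ, p ∣ w1 - t * v1 ∧ p ∣ w2 - t * v2 ∧ w1 * v2 - w2 * v1 = p ∧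
      w1 ^ 2 + M ^ 2 * v1 ^ 2 ≤ w2 ^ 2 + M ^ 2 * v2 ^ 2 ∧
      3 * ((w1 ^ 2 + M ^ 2 * v1 ^ 2) * (w2 ^ 2 + M ^ 2 * v2 ^ 2)) ≤ 4 * (M * p) ^ 2 := by
  classical
  let good : ℤ × ℤ × ℤ × ℤ → Prop := fun x =>
    p ∣ x.1 - t * x.2.1 ∧ p ∣ x.2.2.1 - t * x.2.2.2 ∧ x.1 * x.2.2.2 - x.2.2.1 * x.2.1 = p
  let f : ℤ × ℤ × ℤ × ℤ → ℕ := fun x =>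
    (x.1 ^ 2 + M ^ 2 * x.2.1 ^ 2 + (x.2.2.1 ^ 2 + M ^ 2 * x.2.2.2 ^ 2)).toNat
  have hf : ∀ x, ((f x : ℕ) : ℤ) =
      (x.1 ^ 2 + M ^ 2 * x.2.1 ^ 2 + (x.2.2.1 ^ 2 + M ^ 2 * x.2.2.2 ^ 2)) := by
    intro x
    exact Int.toNat_of_nonneg (by positivity)
  have hex : ∃ n, ∃ x, good x ∧ f x = n := ⟨_, (p, 0, t, 1), ⟨by simp, by simp, by simp⟩, rfl⟩
  obtain ⟨⟨w1, v1, w2, v2⟩, ⟨h1, h2, h3⟩, hn⟩ := Nat.find_spec hex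
  have hmin : ∀ y, good y → f (w1, v1, w2, v2) ≤ f y := by
    intro y hy
    rw [hn]
    exact Nat.find_min' hex ⟨y, hy, rfl⟩
  simp only at h1 h2 h3
  have key : ∀ y, good y → w1 ^ 2 + M ^ 2 * v1 ^ 2 + (w2 ^ 2 + M ^ 2 * v2 ^ 2) ≤
      (y.1 ^ 2 + M ^ 2 * y.2.1 ^ 2 + (y.2.2.1 ^ 2 + M ^ 2 * y.2.2.2 ^ 2)) := by
    intro y hy
    have := hmin y hy
    zify at this
    rw [hf, hf] at this
    exact this
  have g : ∀ s : ℤ, good (w1, v1, w2 + s * w1, v2 + s * v1) := by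
    intro s
    refine ⟨h1, ?_, ?_⟩
    · obtain ⟨k1, hk1⟩ := h1
      obtain ⟨k2, hk2⟩ := h2
      exact ⟨k2 + s * k1, by linear_combination hk2 + s * hk1⟩
    · simp only; linear_combination h3
  have g' : ∀ s : ℤ, good (w1 + s * w2, v1 + s * v2, w2, v2) := by
    intro s
    refine ⟨?_, h2, ?_⟩
    · obtain ⟨k1, hk1⟩ := h1
      obtain ⟨k2, hk2⟩ := h2
      exact ⟨k1 + s * k2, by linear_combination hk1 + s * hk2⟩
    · simp only; linear_combination h3
  have k1 := key _ (g 1)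
  have k2 := key _ (g (-1))
  have k3 := key _ (g' 1)
  have k4 := key _ (g' (-1))
  simp only at k1 k2 k3 k4
  obtain ⟨q1, hq1⟩ : ∃ q, q = w1 ^ 2 + M ^ 2 * v1 ^ 2 := ⟨_, rfl⟩
  obtain ⟨q2, hq2⟩ : ∃ q, q = w2 ^ 2 + M ^ 2 * v2 ^ 2 := ⟨_, rfl⟩
  obtain ⟨b, hb⟩ : ∃ q, q = w1 * w2 + M ^ 2 * (v1 * v2) := ⟨_, rfl⟩
  have id : q1 * q2 = b ^ 2 + (M * p) ^ 2 := by
    rw [hq1, hq2, hb, ← h3]; ring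
  have a1 : -(2 * b) ≤ q1 := by rw [hb, hq1]; linarith
  have a2 : 2 * b ≤ q1 := by rw [hb, hq1]; linarith
  have a3 : -(2 * b) ≤ q2 := by rw [hb, hq2]; linarith
  have a4 : 2 * b ≤ q2 := by rw [hb, hq2]; linarith
  have p1 : 0 ≤ q1 := by rw [hq1]; positivity
  have p2 : 0 ≤ q2 := by rw [hq2]; positivity
  have hbb : 4 * b ^ 2 ≤ q1 * q2 := by
    have : |2 * b| * |2 * b| ≤ q1 * q2 :=
      mul_le_mul (abs_le.2 ⟨by linarith, a2⟩) (abs_le.2 ⟨by linarith, a4⟩) (abs_nonneg _) p1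
    rw [abs_mul_abs_self] at this
    linarith
  have fin : 3 * (q1 * q2) ≤ 4 * (M * p) ^ 2 := by linarith
  rcases le_total q1 q2 with h | h
  · refine ⟨w1, v1, w2, v2, h1, h2, h3, ?_, ?_⟩
    · rw [← hq1, ← hq2]; exact h
    · rw [← hq1, ← hq2]; exact fin
  · refine ⟨w2, v2, -w1, -v1, h2, ?_, ?_, ?_, ?_⟩
    · obtain ⟨k1, hk1⟩ := h1
      exact ⟨-k1, by linear_combination -hk1⟩
    · linear_combination h3
    · rw [neg_sq, neg_sq, ← hq1, ← hq2]; exact h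
    · rw [neg_sq, neg_sq, ← hq1, ← hq2, mul_comm q2 q1]; exact fin

lemma dt_root (p : ℕ) (hp : p.Prime) (h5 : 5 ≤ p) (A B : ℤ) (hA : ¬ (p : ℤ) ∣ A)
    (hD : (p : ℤ) ^ 2 ∣ 4 * A ^ 3 + 27 * B ^ 2) :
    ∃ t : ℤ, (p : ℤ) ^ 2 ∣ t ^ 3 + A * t + B ∧ (p : ℤ) ∣ 3 * t ^ 2 + A := by
  have hpi : Prime (p : ℤ) := Nat.prime_iff_prime_int.mp hp
  have h2 : ¬ (p : ℤ) ∣ 2 := by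
    intro h
    have := Int.le_of_dvd (by norm_num) h
    omega
  have hc2 : IsCoprime ((p : ℤ) ^ 2) 2 := ((hpi.coprime_iff_not_dvd).2 h2).pow_left
  have hcA : IsCoprime ((p : ℤ) ^ 2) A := ((hpi.coprime_iff_not_dvd).2 hA).pow_left
  obtain ⟨u, s, hus⟩ := hc2.mul_right hcA
  obtain ⟨k, hk⟩ := hD
  refine ⟨-3 * B * s, ?_, ?_⟩
  · apply hc2.dvd_of_dvd_mul_left
    have he : s * (2 * A) = 1 - u * (p : ℤ) ^ 2 := by linear_combination hus
    refine ⟨-2 * k * B * s ^ 3 + B * (3 * u ^ 2 * p ^ 2 - u ^ 3 * p ^ 4), ?_⟩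
    have e2 : s ^ 3 * (8 * A ^ 3) = (1 - u * (p : ℤ) ^ 2) ^ 3 := by rw [← he]; ring
    linear_combination (-2 * B * s ^ 3) * hk + B * e2 - 3 * B * he
  · refine dvd_trans (dvd_pow_self _ two_ne_zero) (b := (p : ℤ) ^ 2) ?_
    have he : s * (2 * A) = 1 - u * (p : ℤ) ^ 2 := by linear_combination hus
    have e2 : s ^ 2 * (4 * A ^ 2) = (1 - u * (p : ℤ) ^ 2) ^ 2 := by rw [← he]; ring
    refine ⟨k * s ^ 2 + A * (2 * u - u ^ 2 * p ^ 2), ?_⟩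
    linear_combination (s ^ 2) * hk - A * e2

lemma dt_introot (A B w v : ℤ) (hv : v ≠ 0) (h : w ^ 3 + A * w * v ^ 2 + B * v ^ 3 = 0) :
    ∃ r : ℤ, r ^ 3 + A * r + B = 0 := by
  obtain ⟨g, w', v', hg, hc, hw, hv'⟩ := Int.exists_gcd_one' (m := w) (n := v)
    (Int.gcd_pos_of_ne_zero_right _ hv)
  have hg0 : (g : ℤ) ≠ 0 := by positivity
  have h' : w' ^ 3 + A * w' * v' ^ 2 + B * v' ^ 3 = 0 := by
    have : (g : ℤ) ^ 3 * (w' ^ 3 + A * w' * v' ^ 2 + B * v' ^ 3) = 0 := by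
      rw [← h, hw, hv']; ring
    exact (mul_eq_zero.1 this).resolve_left (pow_ne_zero _ hg0)
  have hd : v' ∣ w' ^ 3 := ⟨-(A * w' * v' + B * v' ^ 2), by linear_combination h'⟩
  have hcop : IsCoprime v' (w' ^ 3) := (Int.isCoprime_iff_gcd_eq_one.2 hc).symm.pow_right
  have hu : IsUnit v' := hcop.isUnit_of_dvd' dvd_rfl hd
  rcases Int.isUnit_iff.1 hu with h1 | h1
  · exact ⟨w', by rw [h1] at h'; linear_combination h'⟩
  · exact ⟨-w', by rw [h1] at h'; linear_combination -h'⟩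

def dtH (a b c d x y : ℤ) : ℤ :=
  (b ^ 2 - 3 * a * c) * y ^ 2 - (b * c - 9 * a * d) * x * y + (c ^ 2 - 3 * b * d) * x ^ 2

def dtG (a b c d x y : ℤ) : ℤ :=
  (2 * b ^ 3 + 27 * a ^ 2 * d - 9 * a * b * c) * y ^ 3
  - 3 * (b ^ 2 * c + 9 * a * b * d - 6 * a * c ^ 2) * y ^ 2 * x
  - 3 * (b * c ^ 2 + 9 * a * c * d - 6 * b ^ 2 * d) * y * x ^ 2
  + (2 * c ^ 3 + 27 * a * d ^ 2 - 9 * b * c * d) * x ^ 3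

lemma dt_H_id (A B p w1 v1 w2 v2 a b c d : ℤ) (hp : p ≠ 0) (h : w1 * v2 - w2 * v1 = p)
    (ha : p ^ 2 * a = w1 ^ 3 + A * w1 * v1 ^ 2 + B * v1 ^ 3)
    (hb : p ^ 2 * b = 3 * w1 ^ 2 * w2 + A * (2 * w1 * v1 * v2 + w2 * v1 ^ 2) + 3 * B * v1 ^ 2 * v2)
    (hc : p ^ 2 * c = 3 * w1 * w2 ^ 2 + A * (2 * w2 * v2 * v1 + w1 * v2 ^ 2) + 3 * B * v1 * v2 ^ 2)
    (hd : p ^ 2 * d = w2 ^ 3 + A * w2 * v2 ^ 2 + B * v2 ^ 3) :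
    dtH a b c d v1 v2 = -3 * A := by
  have h0 : p ^ 4 ≠ 0 := pow_ne_zero _ hp
  apply mul_left_cancel₀ h0
  have e : p ^ 4 * dtH a b c d v1 v2 =
      dtH (p ^ 2 * a) (p ^ 2 * b) (p ^ 2 * c) (p ^ 2 * d) v1 v2 := by
    unfold dtH; ring
  rw [e, ha, hb, hc, hd, ← h]
  unfold dtH
  ring

lemma dt_G_id (A B p w1 v1 w2 v2 a b c d : ℤ) (hp : p ≠ 0) (h : w1 * v2 - w2 * v1 = p)
    (ha : p ^ 2 * a = w1 ^ 3 + A * w1 * v1 ^ 2 + B * v1 ^ 3)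
    (hb : p ^ 2 * b = 3 * w1 ^ 2 * w2 + A * (2 * w1 * v1 * v2 + w2 * v1 ^ 2) + 3 * B * v1 ^ 2 * v2)
    (hc : p ^ 2 * c = 3 * w1 * w2 ^ 2 + A * (2 * w2 * v2 * v1 + w1 * v2 ^ 2) + 3 * B * v1 * v2 ^ 2)
    (hd : p ^ 2 * d = w2 ^ 3 + A * w2 * v2 ^ 2 + B * v2 ^ 3) :
    dtG a b c d v1 v2 = 27 * B := by
  have h0 : p ^ 6 ≠ 0 := pow_ne_zero _ hp
  apply mul_left_cancel₀ h0
  have e : p ^ 6 * dtG a b c d v1 v2 =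
      dtG (p ^ 2 * a) (p ^ 2 * b) (p ^ 2 * c) (p ^ 2 * d) v1 v2 := by
    unfold dtG; ring
  rw [e, ha, hb, hc, hd, ← h]
  unfold dtG
  ring

lemma dt_coef (A B p t w1 k1 v1 w2 k2 v2 : ℤ) 
    (hf : p ^ 2 ∣ t ^ 3 + A * t + B) (hf' : p ∣ 3 * t ^ 2 + A)
    (h1 : w1 = t * v1 + p * k1) (h2 : w2 = t * v2 + p * k2) :
    p ^ 2 ∣ 3 * w1 ^ 2 * w2 + A * (2 * w1 * v1 * v2 + w2 * v1 ^ 2) + 3 * B * v1 ^ 2 * v2 := by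
  obtain ⟨k, hk⟩ := hf
  obtain ⟨l, hl⟩ := hf'
  subst h1 h2
  exact ⟨k * 3 * v1 ^ 2 * v2 + l * (2 * v1 * v2 * k1 + v1 ^ 2 * k2) +
    3 * t * (v2 * k1 ^ 2 + 2 * v1 * k1 * k2) + 3 * p * k1 ^ 2 * k2, by
    linear_combination (3 * v1 ^ 2 * v2) * hk + (p * (2 * v1 * v2 * k1 + v1 ^ 2 * k2)) * hl⟩

lemma dt_coef0 (A B p t w1 k1 v1 : ℤ)
    (hf : p ^ 2 ∣ t ^ 3 + A * t + B) (hf' : p ∣ 3 * t ^ 2 + A)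
    (h1 : w1 = t * v1 + p * k1) :
    p ^ 2 ∣ w1 ^ 3 + A * w1 * v1 ^ 2 + B * v1 ^ 3 := by
  obtain ⟨k, hk⟩ := hf
  obtain ⟨l, hl⟩ := hf'
  subst h1
  exact ⟨k * v1 ^ 3 + l * (v1 ^ 2 * k1) + 3 * t * (v1 * k1 ^ 2) + p * k1 ^ 3, by
    linear_combination (v1 ^ 3) * hk + (p * (v1 ^ 2 * k1)) * hl⟩

lemma dt_abs4 (A w v u M l1 l2 l3 : ℝ) (hM : 1 ≤ M) (hA : |A| ≤ M ^ 2) (hw : |w| ≤ l1)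
    (hv : M * |v| ≤ l2) (hu : M * |u| ≤ l3) : |A * w * v * u| ≤ l1 * l2 * l3 := by
  rw [abs_mul, abs_mul, abs_mul]
  calc |A| * |w| * |v| * |u| ≤ M ^ 2 * l1 * |v| * |u| := by gcongr
    _ = l1 * (M * |v|) * (M * |u|) := by ring
    _ ≤ l1 * l2 * l3 := by
      have : 0 ≤ l1 := (abs_nonneg _).trans hw
      have : 0 ≤ l2 := le_trans (by positivity) hv
      gcongr

lemma dt_abs3 (w v u l1 l2 l3 : ℝ) (hw : |w| ≤ l1)
    (hv : |v| ≤ l2) (hu : |u| ≤ l3) : |w * v * u| ≤ l1 * l2 * l3 := by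
  rw [abs_mul, abs_mul]
  have : 0 ≤ l1 := (abs_nonneg _).trans hw
  have : 0 ≤ l2 := (abs_nonneg _).trans hv
  gcongr

/-- polarized bound -/
lemma dt_pol (A B M w1 v1 l1 w2 v2 l2 : ℝ) (hM : 1 ≤ M) (hA : |A| ≤ M ^ 2)
    (hB : |B| ≤ M ^ 2) (hw1 : |w1| ≤ l1) (hv1 : M * |v1| ≤ l1)
    (hw2 : |w2| ≤ l2) (hv2 : M * |v2| ≤ l2) :
    |3 * w1 ^ 2 * w2 + A * (2 * w1 * v1 * v2 + w2 * v1 ^ 2) + 3 * B * v1 ^ 2 * v2|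
      ≤ 9 * (l1 ^ 2 * l2) := by
  have hv1' : |v1| ≤ l1 := le_trans (le_mul_of_one_le_left (abs_nonneg _) hM) hv1
  have a := abs_le.1 (dt_abs3 w1 w1 w2 l1 l1 l2 hw1 hw1 hw2)
  have b := abs_le.1 (dt_abs4 A w1 v1 v2 M l1 l1 l2 hM hA hw1 hv1 hv2)
  have c := abs_le.1 (dt_abs4 A w2 v1 v1 M l2 l1 l1 hM hA hw2 hv1 hv1)
  have d := abs_le.1 (dt_abs4 B v1 v1 v2 M l1 l1 l2 hM hB hv1' hv1 hv2)
  rw [abs_le]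
  constructor <;> nlinarith [a.1, a.2, b.1, b.2, c.1, c.2, d.1, d.2]

lemma dt_pol0 (A B M w1 v1 l1 : ℝ) (hM : 1 ≤ M) (hA : |A| ≤ M ^ 2)
    (hB : |B| ≤ M ^ 2) (hw1 : |w1| ≤ l1) (hv1 : M * |v1| ≤ l1) :
    |w1 ^ 3 + A * w1 * v1 ^ 2 + B * v1 ^ 3| ≤ 3 * l1 ^ 3 := by
  have hv1' : |v1| ≤ l1 := le_trans (le_mul_of_one_le_left (abs_nonneg _) hM) hv1
  have a := abs_le.1 (dt_abs3 w1 w1 w1 l1 l1 l1 hw1 hw1 hw1)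
  have b := abs_le.1 (dt_abs4 A w1 v1 v1 M l1 l1 l1 hM hA hw1 hv1 hv1)
  have d := abs_le.1 (dt_abs4 B v1 v1 v1 M l1 l1 l1 hM hB hv1' hv1 hv1)
  rw [abs_le]
  constructor <;> nlinarith [a.1, a.2, b.1, b.2, d.1, d.2]

def dtData (A B : ℤ) (M p l1 l2 : ℝ) (a b c d v1 v2 : ℤ) : Prop :=
  1 ≤ l1 ∧ l1 ≤ l2 ∧ l1 * l2 ≤ 2 * M * p ∧ p ^ 2 * |(a : ℝ)| ≤ 3 * l1 ^ 3 ∧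
  p ^ 2 * |(b : ℝ)| ≤ 9 * (l1 ^ 2 * l2) ∧ p ^ 2 * |(c : ℝ)| ≤ 9 * (l2 ^ 2 * l1) ∧
  p ^ 2 * |(d : ℝ)| ≤ 3 * l2 ^ 3 ∧ a ≠ 0 ∧ M * |(v1 : ℝ)| ≤ l1 ∧ M * |(v2 : ℝ)| ≤ l2 ∧
  (v1 = 0 → |v2| = 1) ∧ dtH a b c d v1 v2 = -3 * A ∧ dtG a b c d v1 v2 = 27 * B

lemma dt_data (A B : ℤ) (M p : ℕ) (hM : 1 ≤ M) (hA : |A| ≤ (M : ℤ) ^ 2) (hB : |B| ≤ (M : ℤ) ^ 2)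
    (hp : p.Prime) (h5 : 5 ≤ p) (hpA : ¬ (p : ℤ) ∣ A)
    (hD : (p : ℤ) ^ 2 ∣ 4 * A ^ 3 + 27 * B ^ 2)
    (hr : ¬ ∃ r : ℤ, r ^ 3 + A * r + B = 0) :
    ∃ (l1 l2 : ℝ) (a b c d v1 v2 : ℤ), dtData A B M p l1 l2 a b c d v1 v2 := by
  obtain ⟨t, hf, hf'⟩ := dt_root p hp h5 A B hpA hD
  have hp0 : (0 : ℤ) < p := by exact_mod_cast hp.pos
  obtain ⟨w1, v1, w2, v2, ⟨k1, h1⟩, ⟨k2, h2⟩, hdet, hle, hprod⟩ := dt_reduce p t M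
  have h1' : w1 = t * v1 + p * k1 := by linear_combination h1
  have h2' : w2 = t * v2 + p * k2 := by linear_combination h2
  obtain ⟨a, ha⟩ := dt_coef0 A B p t w1 k1 v1 hf hf' h1'
  obtain ⟨b, hb⟩ := dt_coef A B p t w1 k1 v1 w2 k2 v2 hf hf' h1' h2'
  obtain ⟨c, hc⟩ := dt_coef A B p t w2 k2 v2 w1 k1 v1 hf hf' h2' h1'
  obtain ⟨d, hd⟩ := dt_coef0 A B p t w2 k2 v2 hf hf' h2'
  have hc' : (p : ℤ) ^ 2 * c = 3 * w1 * w2 ^ 2 + A * (2 * w2 * v2 * v1 + w1 * v2 ^ 2) +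
      3 * B * v1 * v2 ^ 2 := by rw [← hc]; ring
  obtain ⟨q1, hq1⟩ : ∃ q : ℝ, q = (w1 : ℝ) ^ 2 + (M : ℝ) ^ 2 * (v1 : ℝ) ^ 2 := ⟨_, rfl⟩
  obtain ⟨q2, hq2⟩ : ∃ q : ℝ, q = (w2 : ℝ) ^ 2 + (M : ℝ) ^ 2 * (v2 : ℝ) ^ 2 := ⟨_, rfl⟩
  have hle' : q1 ≤ q2 := by rw [hq1, hq2]; exact_mod_cast hle
  have hprod' : 3 * (q1 * q2) ≤ 4 * ((M : ℝ) * p) ^ 2 := by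
    rw [hq1, hq2]; exact_mod_cast hprod
  have hM' : (1 : ℝ) ≤ M := by exact_mod_cast hM
  have hw1 : |(w1 : ℝ)| ≤ √q1 := Real.abs_le_sqrt (by rw [hq1]; nlinarith [sq_nonneg ((M : ℝ) * v1)])
  have hw2 : |(w2 : ℝ)| ≤ √q2 := Real.abs_le_sqrt (by rw [hq2]; nlinarith [sq_nonneg ((M : ℝ) * v2)])
  have hv1 : (M : ℝ) * |(v1 : ℝ)| ≤ √q1 := by
    have : |(M : ℝ) * v1| ≤ √q1 := Real.abs_le_sqrt (by rw [hq1]; nlinarith [sq_nonneg (w1 : ℝ)])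
    rwa [abs_mul, Nat.abs_cast] at this
  have hv2 : (M : ℝ) * |(v2 : ℝ)| ≤ √q2 := by
    have : |(M : ℝ) * v2| ≤ √q2 := Real.abs_le_sqrt (by rw [hq2]; nlinarith [sq_nonneg (w2 : ℝ)])
    rwa [abs_mul, Nat.abs_cast] at this
  have hA' : |(A : ℝ)| ≤ (M : ℝ) ^ 2 := by exact_mod_cast hA
  have hB' : |(B : ℝ)| ≤ (M : ℝ) ^ 2 := by exact_mod_cast hB
  have hv0 : v1 = 0 → (p : ℤ) = p * k1 * v2 := by
    intro h
    rw [h1', h] at hdet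
    linear_combination -hdet
  have ha0 : w1 ^ 3 + A * w1 * v1 ^ 2 + B * v1 ^ 3 ≠ 0 := by
    intro h0
    by_cases hv : v1 = 0
    · rw [hv] at h0 hdet
      have : w1 = 0 := by
        have : w1 ^ 3 = 0 := by linear_combination h0
        exact pow_eq_zero_iff (three_ne_zero) |>.1 this
      rw [this] at hdet
      simp at hdet
      omega
    · exact hr (dt_introot A B w1 v1 hv h0)
  have q1pos : 1 ≤ q1 := by
    have hz : 0 < w1 ^ 2 + (M : ℤ) ^ 2 * v1 ^ 2 := by
      by_contra hcon
      have hM2 : (0 : ℤ) < (M : ℤ) ^ 2 := by positivity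
      have u1 := sq_nonneg w1
      have u2 := mul_nonneg hM2.le (sq_nonneg v1)
      have e1 : w1 ^ 2 = 0 := by linarith
      have e2 : (M : ℤ) ^ 2 * v1 ^ 2 = 0 := by linarith
      have e3 : v1 = 0 := by
        rcases mul_eq_zero.1 e2 with h | h
        · omega
        · exact pow_eq_zero_iff two_ne_zero |>.1 h
      have e4 : w1 = 0 := pow_eq_zero_iff two_ne_zero |>.1 e1
      apply ha0
      rw [e3, e4]; ring
    rw [hq1]
    exact_mod_cast hz
  have hpr : ∀ x y : ℤ, x = (p : ℤ) ^ 2 * y → (p : ℝ) ^ 2 * |(y : ℝ)| = |(x : ℝ)| := by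
    intro x y h
    rw [h]; push_cast
    rw [abs_mul, abs_of_nonneg (by positivity : (0 : ℝ) ≤ (p : ℝ) ^ 2)]
  refine ⟨√q1, √q2, a, b, c, d, v1, v2, Real.one_le_sqrt.2 q1pos, Real.sqrt_le_sqrt hle', ?_, 
    ?_, ?_, ?_, ?_, ?_, hv1, hv2, ?_,
    dt_H_id A B p w1 v1 w2 v2 a b c d hp0.ne' hdet ha.symm hb.symm hc' hd.symm, 
    dt_G_id A B p w1 v1 w2 v2 a b c d hp0.ne' hdet ha.symm hb.symm hc' hd.symm⟩
  · rw [← Real.sqrt_mul (by linarith)]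
    apply Real.sqrt_le_iff.2
    constructor
    · positivity
    · have e : (2 * (M : ℝ) * p) ^ 2 = 4 * ((M : ℝ) * p) ^ 2 := by ring
      have : 0 ≤ q1 * q2 := mul_nonneg (by linarith) (by linarith)
      rw [e]; linarith
  · rw [hpr _ _ ha]
    have := dt_pol0 A B M w1 v1 _ hM' hA' hB' hw1 hv1
    push_cast
    exact this
  · rw [hpr _ _ hb]
    have := dt_pol A B M w1 v1 _ w2 v2 _ hM' hA' hB' hw1 hv1 hw2 hv2
    push_cast
    exact this
  · rw [hpr _ _ hc]
    have := dt_pol A B M w2 v2 _ w1 v1 _ hM' hA' hB' hw2 hv2 hw1 hv1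
    push_cast
    exact this
  · rw [hpr _ _ hd]
    have := dt_pol0 A B M w2 v2 _ hM' hA' hB' hw2 hv2
    push_cast
    exact this
  · rintro rfl
    apply ha0; rw [ha]; ring
  · intro h
    have := hv0 h
    have h' : k1 * v2 = 1 := by
      apply mul_left_cancel₀ hp0.ne'
      linear_combination -this
    have := Int.isUnit_iff_abs_eq.1 (IsUnit.of_mul_eq_one k1 (by linear_combination h') : IsUnit v2)
    exact this

noncomputable def dtI (x : ℝ) : Finset ℤ := Finset.Icc (-⌊x⌋) ⌊x⌋

lemma dtI_mem (x : ℝ) (n : ℤ) (h : |(n : ℝ)| ≤ x) : n ∈ dtI x := by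
  have h := abs_le.1 h
  have h1 : n ≤ ⌊x⌋ := Int.le_floor.2 h.2
  have h2 : -n ≤ ⌊x⌋ := Int.le_floor.2 (by push_cast; linarith)
  exact Finset.mem_Icc.2 ⟨by omega, h1⟩

lemma dtI_card (x : ℝ) (h : 0 ≤ x) : ((dtI x).card : ℝ) ≤ 2 * x + 1 := by
  have h0 : 0 ≤ ⌊x⌋ := Int.floor_nonneg.2 h
  have : ((dtI x).card : ℤ) = 2 * ⌊x⌋ + 1 := by
    rw [dtI, Int.card_Icc, Int.toNat_of_nonneg (by omega)]; ring
  have h2 : ((dtI x).card : ℝ) = 2 * (⌊x⌋ : ℝ) + 1 := by exact_mod_cast this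
  rw [h2]
  linarith [Int.floor_le x]

lemma dtI_card3 (x : ℝ) (h : 1 ≤ x) : ((dtI x).card : ℝ) ≤ 3 * x := by
  linarith [dtI_card x (by linarith)]

/-- dyadic cell -/
lemma dt_cell (Z : Finset (ℤ × ℤ)) (M P L : ℝ) (hM : 1 ≤ M) (hP : 0 < P) (hL : 0 < L)
    (hZ : ∀ z ∈ Z, ∃ (p l1 l2 : ℝ) (a b c d v1 v2 : ℤ), P ≤ p ∧ p ≤ 2 * P ∧ L ≤ l1 ∧ l1 ≤ 2 * L ∧
      dtData z.1 z.2 M p l1 l2 a b c d v1 v2) :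
    (Z.card : ℝ) ≤ 10 ^ 15 * (M ^ 6 / P ^ 2 + M ^ 5 / P) * 10 ^ 5 := by
  classical
  have hM0 : 0 < M := by linarith
  rcases Z.eq_empty_or_nonempty with rfl | ⟨z0, hz0⟩
  · simp; positivity
  obtain ⟨S, hS⟩ : ∃ S : ℝ, S = 4 * P * M / L := ⟨_, rfl⟩
  have hS0 : 0 < S := by rw [hS]; positivity
  have hLS' : L * S = 4 * P * M := by rw [hS]; field_simp
  have conv : ∀ z ∈ Z, ∃ (a b c d v1 v2 : ℤ), L ≤ S ∧ |(a : ℝ)| ≤ 24 * L ^ 3 / P ^ 2 ∧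
      |(b : ℝ)| ≤ 36 * L ^ 2 * S / P ^ 2 ∧ |(c : ℝ)| ≤ 18 * L * S ^ 2 / P ^ 2 ∧
      |(d : ℝ)| ≤ 3 * S ^ 3 / P ^ 2 ∧ a ≠ 0 ∧ |(v1 : ℝ)| ≤ 2 * L / M ∧ |(v2 : ℝ)| ≤ S / M ∧ 
      (v1 = 0 → |v2| = 1) ∧ dtH a b c d v1 v2 = -3 * z.1 ∧ dtG a b c d v1 v2 = 27 * z.2 := by
    intro z hz
    obtain ⟨p, l1, l2, a, b, c, d, v1, v2, hp1, hp2, hl1, hl2, h1, h2, h3, ha, hb, hc, hd, ha0,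
      hv1, hv2, h10, hH, hG⟩ := hZ z hz
    have l1p : 0 < l1 := by linarith
    have l2p : 0 < l2 := by linarith
    have hlS : l2 ≤ S := by
      rw [hS, le_div_iff₀ hL]
      calc l2 * L ≤ l2 * l1 := by gcongr
        _ = l1 * l2 := by ring
        _ ≤ 2 * M * p := h3
        _ ≤ 2 * M * (2 * P) := by gcongr
        _ = _ := by ring
    have hmono : ∀ x : ℝ, P ^ 2 * |x| ≤ p ^ 2 * |x| := fun x => by gcongr
    refine ⟨a, b, c, d, v1, v2, by linarith, ?_, ?_, ?_, ?_, ha0, ?_, ?_, h10, hH, hG⟩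
    · rw [le_div_iff₀ (by positivity), mul_comm]
      refine (hmono _).trans (ha.trans ?_)
      calc 3 * l1 ^ 3 ≤ 3 * (2 * L) ^ 3 := by gcongr
        _ = _ := by ring
    · rw [le_div_iff₀ (by positivity), mul_comm]
      refine (hmono _).trans (hb.trans ?_)
      calc 9 * (l1 ^ 2 * l2) ≤ 9 * ((2 * L) ^ 2 * S) := by gcongr
        _ = _ := by ring
    · rw [le_div_iff₀ (by positivity), mul_comm]
      refine (hmono _).trans (hc.trans ?_)
      calc 9 * (l2 ^ 2 * l1) ≤ 9 * (S ^ 2 * (2 * L)) := by gcongr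
        _ = _ := by ring
    · rw [le_div_iff₀ (by positivity), mul_comm]
      refine (hmono _).trans (hd.trans ?_)
      gcongr
    · rw [le_div_iff₀ (by positivity), mul_comm]
      exact hv1.trans hl2
    · rw [le_div_iff₀ (by positivity), mul_comm]
      exact hv2.trans hlS
  obtain ⟨hLS, hβa⟩ : L ≤ S ∧ 1 ≤ 24 * L ^ 3 / P ^ 2 := by
    obtain ⟨a, b, c, d, v1, v2, h, ha, -, -, -, ha0, -⟩ := conv z0 hz0
    refine ⟨h, le_trans ?_ ha⟩
    exact_mod_cast Int.one_le_abs ha0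
  have hL3 : P ^ 2 ≤ 24 * L ^ 3 := by
    rwa [le_div_iff₀ (by positivity), one_mul] at hβa
  have hβb : 1 ≤ 36 * L ^ 2 * S / P ^ 2 := by
    rw [le_div_iff₀ (by positivity), one_mul]
    calc P ^ 2 ≤ 24 * L ^ 3 := hL3
      _ ≤ 36 * L ^ 3 := by gcongr; norm_num
      _ = 36 * L ^ 2 * L := by ring
      _ ≤ _ := by gcongr
  have hβc : 1 ≤ 36 * L * S ^ 2 / P ^ 2 := by
    rw [le_div_iff₀ (by positivity), one_mul]
    calc P ^ 2 ≤ 24 * L ^ 3 := hL3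
      _ ≤ 36 * L ^ 3 := by gcongr; norm_num
      _ = 36 * L * L ^ 2 := by ring
      _ ≤ _ := by gcongr
  have hβd : 1 ≤ 36 * S ^ 3 / P ^ 2 := by
    rw [le_div_iff₀ (by positivity), one_mul]
    calc P ^ 2 ≤ 24 * L ^ 3 := hL3
      _ ≤ 36 * L ^ 3 := by gcongr; norm_num
      _ ≤ _ := by gcongr
  obtain ⟨V, hV, hVc⟩ : ∃ V : Finset (ℤ × ℤ), (∀ v1 v2 : ℤ, |(v1 : ℝ)| ≤ 2 * L / M →
      |(v2 : ℝ)| ≤ S / M → (v1 = 0 → |v2| = 1) → (v1, v2) ∈ V) ∧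
      (V.card : ℝ) ≤ 3 + 144 * (P / M) := by
    rcases le_or_gt 1 (2 * L / M) with h | h
    · refine ⟨dtI (2 * L / M) ×ˢ dtI (2 * S / M), ?_, ?_⟩
      · intro v1 v2 h1 h2 _
        refine Finset.mem_product.2 ⟨dtI_mem _ _ h1, dtI_mem _ _ (h2.trans ?_)⟩
        gcongr; linarith
      · rw [Finset.card_product]
        push_cast
        have h' : 1 ≤ 2 * S / M := h.trans (by gcongr)
        calc ((dtI (2 * L / M)).card : ℝ) * (dtI (2 * S / M)).card 
            ≤ (3 * (2 * L / M)) * (3 * (2 * S / M)) := by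
              gcongr
              · exact dtI_card3 _ h
              · exact dtI_card3 _ h'
          _ = 36 * (L * S) / M ^ 2 := by field_simp; ring
          _ = 144 * (P / M) := by rw [hLS']; field_simp; ring
          _ ≤ _ := by linarith
    · refine ⟨{0} ×ˢ {1, -1}, ?_, ?_⟩
      · intro v1 v2 h1 _ h3
        have h4 : v1 = 0 := by
          have : |(v1 : ℝ)| < 1 := lt_of_le_of_lt h1 h
          have : |v1| < 1 := by exact_mod_cast this
          exact Int.abs_lt_one_iff.1 this
        have h5 := h3 h4
        rw [Finset.mem_product]
        refine ⟨by simp [h4], ?_⟩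
        rcases (abs_eq (zero_le_one)).1 h5 with h | h <;> simp [h]
      · have : ((({0} ×ˢ {1, -1} : Finset (ℤ × ℤ)).card : ℕ) : ℝ) = 2 := by
          norm_num [Finset.card_product]
        rw [this]
        have : 0 ≤ P / M := by positivity
        linarith
  let T : Finset (ℤ × ℤ × ℤ × ℤ × (ℤ × ℤ)) := dtI (24 * L ^ 3 / P ^ 2) ×ˢ
    dtI (36 * L ^ 2 * S / P ^ 2) ×ˢ dtI (36 * L * S ^ 2 / P ^ 2) ×ˢ dtI (36 * S ^ 3 / P ^ 2) ×ˢ V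
  let Φ : ℤ × ℤ × ℤ × ℤ × (ℤ × ℤ) → ℤ × ℤ := fun x =>
    (dtH x.1 x.2.1 x.2.2.1 x.2.2.2.1 x.2.2.2.2.1 x.2.2.2.2.2 / (-3),
      dtG x.1 x.2.1 x.2.2.1 x.2.2.2.1 x.2.2.2.2.1 x.2.2.2.2.2 / 27)
  have hsub : Z ⊆ T.image Φ := by
    intro z hz
    obtain ⟨a, b, c, d, v1, v2, _, ha, hb, hc, hd, ha0, hv1, hv2, h10, hH, hG⟩ := conv z hz
    refine Finset.mem_image.2 ⟨(a, b, c, d, (v1, v2)), ?_, ?_⟩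
    · simp only [T, Finset.mem_product]
      refine ⟨dtI_mem _ _ ha, dtI_mem _ _ hb, dtI_mem _ _ (hc.trans ?_),
        dtI_mem _ _ (hd.trans ?_), hV _ _ hv1 hv2 h10⟩
      · gcongr; norm_num
      · gcongr; norm_num
    · simp only [Φ, hH, hG]
      ext
      · simp only; omega
      · simp only; omega
  have hcard : (Z.card : ℝ) ≤ T.card := by
    exact_mod_cast (Finset.card_le_card hsub).trans Finset.card_image_le
  refine hcard.trans ?_
  simp only [T, Finset.card_product]
  push_cast
  calc ((dtI (24 * L ^ 3 / P ^ 2)).card : ℝ) * ((dtI (36 * L ^ 2 * S / P ^ 2)).card *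
        ((dtI (36 * L * S ^ 2 / P ^ 2)).card * ((dtI (36 * S ^ 3 / P ^ 2)).card * V.card)))
      ≤ (3 * (24 * L ^ 3 / P ^ 2)) * ((3 * (36 * L ^ 2 * S / P ^ 2)) * 
        ((3 * (36 * L * S ^ 2 / P ^ 2)) * ((3 * (36 * S ^ 3 / P ^ 2)) * (3 + 144 * (P / M))))) := by
        gcongr
        · exact dtI_card3 _ hβa
        · exact dtI_card3 _ hβb
        · exact dtI_card3 _ hβc
        · exact dtI_card3 _ hβd
    _ = 90699264 * ((L * S) ^ 6 / P ^ 8) * (3 + 144 * (P / M)) := by field_simp; ring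
    _ = 90699264 * 4096 * (3 * (M ^ 6 / P ^ 2) + 144 * (M ^ 5 / P)) := by
        rw [hLS']; field_simp; ring
    _ ≤ 90699264 * 4096 * (144 * (M ^ 6 / P ^ 2) + 144 * (M ^ 5 / P)) := by gcongr; norm_num
    _ = 90699264 * 4096 * 144 * (M ^ 6 / P ^ 2 + M ^ 5 / P) := by ring
    _ ≤ 10 ^ 15 * 10 ^ 5 * (M ^ 6 / P ^ 2 + M ^ 5 / P) := by gcongr <;> norm_num
    _ = _ := by ring

open Classical in
lemma dt_large (N M J : ℕ) (Y : ℝ) (hN : 1 ≤ N) (hM : 1 ≤ M) (hNM : N ≤ M ^ 2) (hY : 0 < Y)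
    (hJ : 62 * M * N ^ 3 < 2 ^ J) :
    (((Finset.Icc (-(N : ℤ)) N ×ˢ Finset.Icc (-(N : ℤ)) N).filter (fun z : ℤ × ℤ =>
      4 * z.1 ^ 3 + 27 * z.2 ^ 2 ≠ 0 ∧ (¬ ∃ r : ℤ, r ^ 3 + z.1 * r + z.2 = 0) ∧
      ∃ p : ℕ, p.Prime ∧ 5 ≤ p ∧ Y < p ∧ ¬ (p : ℤ) ∣ z.1 ∧
        (p : ℤ) ^ 2 ∣ 4 * z.1 ^ 3 + 27 * z.2 ^ 2)).card : ℝ) ≤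
    (J : ℝ) ^ 2 * (10 ^ 20 * (4 * ((M : ℝ) ^ 6 / Y ^ 2) + 2 * ((M : ℝ) ^ 5 / Y))) := by
  set Z := (Finset.Icc (-(N : ℤ)) N ×ˢ Finset.Icc (-(N : ℤ)) N).filter (fun z : ℤ × ℤ =>
      4 * z.1 ^ 3 + 27 * z.2 ^ 2 ≠ 0 ∧ (¬ ∃ r : ℤ, r ^ 3 + z.1 * r + z.2 = 0) ∧
      ∃ p : ℕ, p.Prime ∧ 5 ≤ p ∧ Y < p ∧ ¬ (p : ℤ) ∣ z.1 ∧
        (p : ℤ) ^ 2 ∣ 4 * z.1 ^ 3 + 27 * z.2 ^ 2) with hZ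
  have hM' : (1 : ℝ) ≤ M := by exact_mod_cast hM
  let W : ℕ × ℕ → Finset (ℤ × ℤ) := fun ij => Z.filter (fun z =>
    ∃ (p l1 l2 : ℝ) (a b c d v1 v2 : ℤ), Y < p ∧ (2 : ℝ) ^ ij.1 ≤ p ∧ p ≤ 2 * 2 ^ ij.1 ∧
      (2 : ℝ) ^ ij.2 ≤ l1 ∧ l1 ≤ 2 * 2 ^ ij.2 ∧ dtData z.1 z.2 M p l1 l2 a b c d v1 v2)
  have hW : ∀ ij, ((W ij).card : ℝ) ≤
      10 ^ 20 * (4 * ((M : ℝ) ^ 6 / Y ^ 2) + 2 * ((M : ℝ) ^ 5 / Y)) := by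
    intro ij
    rcases (W ij).eq_empty_or_nonempty with h | ⟨z0, hz0⟩
    · rw [h]; simp; positivity
    have hPY : Y / 2 ≤ (2 : ℝ) ^ ij.1 := by
      obtain ⟨p, l1, l2, a, b, c, d, v1, v2, h1, h2, h3, -⟩ := (Finset.mem_filter.1 hz0).2
      linarith
    have := dt_cell (W ij) M (2 ^ ij.1) (2 ^ ij.2) hM' (by positivity) (by positivity) (by
      intro z hz
      obtain ⟨p, l1, l2, a, b, c, d, v1, v2, h1, h2, h3, h4⟩ := (Finset.mem_filter.1 hz).2
      exact ⟨p, l1, l2, a, b, c, d, v1, v2, h2, h3, h4⟩)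
    refine this.trans ?_
    calc _ = 10 ^ 20 * ((M : ℝ) ^ 6 / (2 ^ ij.1) ^ 2 + (M : ℝ) ^ 5 / 2 ^ ij.1) := by ring
      _ ≤ 10 ^ 20 * ((M : ℝ) ^ 6 / (Y / 2) ^ 2 + (M : ℝ) ^ 5 / (Y / 2)) := by gcongr
      _ = _ := by field_simp; ring
  have hsub : Z ⊆ (Finset.range J ×ˢ Finset.range J).biUnion W := by
    intro z hz
    have hz' := hz
    rw [hZ, Finset.mem_filter, Finset.mem_product, Finset.mem_Icc, Finset.mem_Icc] at hz'
    obtain ⟨⟨hA, hB⟩, hD0, hr, p, hp, h5, hYp, hpA, hD⟩ := hz'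
    have hA' : |z.1| ≤ N := abs_le.2 hA
    have hB' : |z.2| ≤ N := abs_le.2 hB
    have hNM' : (N : ℤ) ≤ (M : ℤ) ^ 2 := by exact_mod_cast hNM
    obtain ⟨l1, l2, a, b, c, d, v1, v2, hdat⟩ := dt_data z.1 z.2 M p hM (hA'.trans hNM')
      (hB'.trans hNM') hp h5 hpA hD hr
    have hpb : (p : ℤ) ≤ 31 * N ^ 3 := by
      have h1 : (p : ℤ) ^ 2 ≤ |4 * z.1 ^ 3 + 27 * z.2 ^ 2| :=
        Int.le_of_dvd (abs_pos.2 hD0) ((dvd_abs _ _).2 hD)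
      have h2 : |4 * z.1 ^ 3 + 27 * z.2 ^ 2| ≤ 31 * (N : ℤ) ^ 3 := by
        calc |4 * z.1 ^ 3 + 27 * z.2 ^ 2| ≤ |4 * z.1 ^ 3| + |27 * z.2 ^ 2| := abs_add_le _ _
          _ = 4 * |z.1| ^ 3 + 27 * |z.2| ^ 2 := by
            rw [abs_mul, abs_mul, abs_pow, abs_pow]; norm_num
          _ ≤ 4 * (N : ℤ) ^ 3 + 27 * (N : ℤ) ^ 2 := by gcongr
          _ ≤ 4 * (N : ℤ) ^ 3 + 27 * (N : ℤ) ^ 3 := by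
            gcongr
            · exact_mod_cast hN
            · norm_num
          _ = _ := by ring
      have : (p : ℤ) ≤ (p : ℤ) ^ 2 := by
        have : (1 : ℤ) ≤ p := by exact_mod_cast hp.one_lt.le
        nlinarith
      linarith
    have hpb' : (p : ℝ) ≤ 31 * N ^ 3 := by exact_mod_cast hpb
    have hJ' : 62 * (M : ℝ) * N ^ 3 < 2 ^ J := by exact_mod_cast hJ
    have hl1 : l1 < 2 ^ J := by
      have h1 := hdat.1
      have h2 := hdat.2.1
      have h3 := hdat.2.2.1
      calc l1 ≤ l1 * l2 := le_mul_of_one_le_right (by linarith) (by linarith)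
        _ ≤ 2 * M * p := h3
        _ ≤ 2 * M * (31 * N ^ 3) := by gcongr
        _ = 62 * (M : ℝ) * N ^ 3 := by ring
        _ < _ := hJ'
    have hpJ : (p : ℝ) < 2 ^ J := by
      refine lt_of_le_of_lt ?_ hJ'
      have h3 : (0 : ℝ) ≤ (N : ℝ) ^ 3 := by positivity
      nlinarith
    have hp1 : (1 : ℝ) ≤ p := by exact_mod_cast hp.one_lt.le
    obtain ⟨i, hi1, hi2⟩ := exists_nat_pow_near hp1 (by norm_num : (1 : ℝ) < 2)
    obtain ⟨j, hj1, hj2⟩ := exists_nat_pow_near hdat.1 (by norm_num : (1 : ℝ) < 2)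
    refine Finset.mem_biUnion.2 ⟨(i, j), ?_, ?_⟩
    · rw [Finset.mem_product, Finset.mem_range, Finset.mem_range]
      constructor
      · exact (pow_lt_pow_iff_right₀ (by norm_num : (1 : ℝ) < 2)).1 (lt_of_le_of_lt hi1 hpJ)
      · exact (pow_lt_pow_iff_right₀ (by norm_num : (1 : ℝ) < 2)).1 (lt_of_le_of_lt hj1 hl1)
    · refine Finset.mem_filter.2 ⟨hz, p, l1, l2, a, b, c, d, v1, v2, hYp, hi1, ?_, hj1, ?_, hdat⟩
      · simp only; rw [pow_succ] at hi2; linarith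
      · simp only; rw [pow_succ] at hj2; linarith
  calc (Z.card : ℝ) ≤ (((Finset.range J ×ˢ Finset.range J).biUnion W).card : ℝ) := by
        exact_mod_cast Finset.card_le_card hsub
    _ ≤ ∑ ij ∈ Finset.range J ×ˢ Finset.range J, ((W ij).card : ℝ) := by
        exact_mod_cast Finset.card_biUnion_le
    _ ≤ ∑ ij ∈ Finset.range J ×ˢ Finset.range J,
        (10 ^ 20 * (4 * ((M : ℝ) ^ 6 / Y ^ 2) + 2 * ((M : ℝ) ^ 5 / Y))) :=
        Finset.sum_le_sum fun ij _ => hW ij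
    _ = _ := by
        rw [Finset.sum_const, Finset.card_product, Finset.card_range, nsmul_eq_mul]
        push_cast; ring

lemma dt_mod (N r : ℕ) (hr : 0 < r) (v : ℤ) :
    (((Finset.Icc (-(N : ℤ)) N).filter (fun x => x ≡ v [ZMOD r])).card : ℝ) ≤
      (2 * N + 1) / r + 1 := by
  have e : Finset.Icc (-(N : ℤ)) N = Finset.Ico (-(N : ℤ)) (N + 1) := by
    ext x; simp only [Finset.mem_Icc, Finset.mem_Ico]; omega
  have h := Int.Ico_filter_modEq_card (-(N : ℤ)) (N + 1) (r := r) (by exact_mod_cast hr) v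
  rw [← e] at h
  have hr' : (0 : ℚ) < r := by exact_mod_cast hr
  have key : (((Finset.Icc (-(N : ℤ)) N).filter (fun x => x ≡ v [ZMOD r])).card : ℚ) ≤
      (2 * N + 1) / r + 1 := by
    have h' : (((Finset.Icc (-(N : ℤ)) N).filter (fun x => x ≡ v [ZMOD r])).card : ℚ) = 
      ((((Finset.Icc (-(N : ℤ)) N).filter (fun x => x ≡ v [ZMOD r])).card : ℤ) : ℚ) := by norm_cast
    rw [h', h]
    push_cast
    apply max_le
    · have a1 := Int.ceil_lt_add_one (((N : ℚ) + 1 - v) / r)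
      have a2 := Int.le_ceil ((-(N : ℚ) - v) / r)
      have : (2 * (N : ℚ) + 1) / r = ((N : ℚ) + 1 - v) / r - (-(N : ℚ) - v) / r := by
        field_simp; ring
      rw [this]
      push_cast at *
      linarith
    · positivity
  have := (Rat.cast_le (K := ℝ)).2 key
  push_cast at this
  exact this

lemma dt_sumsq (Q : ℝ) (hQ : 5 ≤ Q) (m : ℕ) :
    ∑ i ∈ Finset.Ioo ⌊Q⌋₊ m, ((i : ℝ) ^ 2)⁻¹ ≤ 2 / Q := by
  refine (sum_Ioo_inv_sq_le (α := ℝ) ⌊Q⌋₊ m).trans ?_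
  have := Nat.lt_floor_add_one Q
  gcongr

lemma dt_small1 (N p : ℕ) (hp : p.Prime) (h5 : 5 ≤ p) (A : ℤ) (hA : ¬ (p : ℤ) ∣ A) :
    (((Finset.Icc (-(N : ℤ)) N).filter
      (fun B => (p : ℤ) ^ 2 ∣ 4 * A ^ 3 + 27 * B ^ 2)).card : ℝ) ≤
      2 * ((2 * N + 1) * ((p : ℝ) ^ 2)⁻¹ + 1) := by
  classical
  have hpi : Prime (p : ℤ) := Nat.prime_iff_prime_int.mp hp
  have h2 : ¬ (p : ℤ) ∣ 2 := by
    intro h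
    have := Int.le_of_dvd (by norm_num) h
    omega
  have h3 : ¬ (p : ℤ) ∣ 3 := by
    intro h
    have := Int.le_of_dvd (by norm_num) h
    omega
  have h27 : ¬ (p : ℤ) ∣ 27 := by
    intro h
    exact h3 (hpi.dvd_of_dvd_pow (by norm_num; exact h : (p : ℤ) ∣ 3 ^ 3))
  have h4 : ¬ (p : ℤ) ∣ 4 := by
    intro h
    exact h2 (hpi.dvd_of_dvd_pow (by norm_num; exact h : (p : ℤ) ∣ 2 ^ 2))
  set Z := (Finset.Icc (-(N : ℤ)) N).filter
      (fun B => (p : ℤ) ^ 2 ∣ 4 * A ^ 3 + 27 * B ^ 2) with hZ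
  rcases Z.eq_empty_or_nonempty with h | ⟨B0, hB0⟩
  · rw [h]; simp; positivity
  have hD0 := (Finset.mem_filter.1 hB0).2
  have hpB : ¬ (p : ℤ) ∣ B0 := by
    intro h
    have h1 : (p : ℤ) ∣ 4 * A ^ 3 + 27 * B0 ^ 2 := (dvd_pow_self _ two_ne_zero).trans hD0
    have h6 : (p : ℤ) ∣ 27 * B0 ^ 2 := Dvd.dvd.mul_left (dvd_pow h two_ne_zero) _
    have h7 : (p : ℤ) ∣ 4 * A ^ 3 := (dvd_add_left h6).1 h1
    rcases hpi.dvd_or_dvd h7 with h8 | h8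
    · exact h4 h8
    · exact hA (hpi.dvd_of_dvd_pow h8)
  have hsub : Z ⊆ (Finset.Icc (-(N : ℤ)) N).filter (fun x => x ≡ B0 [ZMOD (p ^ 2 : ℕ)]) ∪
      (Finset.Icc (-(N : ℤ)) N).filter (fun x => x ≡ -B0 [ZMOD (p ^ 2 : ℕ)]) := by
    intro B hB
    obtain ⟨hB1, hB2⟩ := Finset.mem_filter.1 hB
    have h1 : (p : ℤ) ^ 2 ∣ 27 * ((B - B0) * (B + B0)) := by
      have := dvd_sub hB2 hD0
      have e : 4 * A ^ 3 + 27 * B ^ 2 - (4 * A ^ 3 + 27 * B0 ^ 2) =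
        27 * ((B - B0) * (B + B0)) := by ring
      rwa [e] at this
    have c27 : IsCoprime ((p : ℤ) ^ 2) 27 := ((hpi.coprime_iff_not_dvd).2 h27).pow_left
    have h6 : (p : ℤ) ^ 2 ∣ (B - B0) * (B + B0) := c27.dvd_of_dvd_mul_left h1
    rw [Finset.mem_union, Finset.mem_filter, Finset.mem_filter]
    by_cases h7 : (p : ℤ) ∣ B - B0
    · have h8 : ¬ (p : ℤ) ∣ B + B0 := by
        intro h8
        have h9 : (p : ℤ) ∣ 2 * B0 := by
          have := dvd_sub h8 h7
          have e : B + B0 - (B - B0) = 2 * B0 := by ring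
          rwa [e] at this
        rcases hpi.dvd_or_dvd h9 with h | h
        · exact h2 h
        · exact hpB h
      have c : IsCoprime ((p : ℤ) ^ 2) (B + B0) := ((hpi.coprime_iff_not_dvd).2 h8).pow_left
      left
      refine ⟨hB1, (Int.modEq_iff_dvd.2 ?_).symm⟩
      push_cast
      exact c.dvd_of_dvd_mul_right h6
    · have c : IsCoprime ((p : ℤ) ^ 2) (B - B0) := ((hpi.coprime_iff_not_dvd).2 h7).pow_left
      right
      refine ⟨hB1, (Int.modEq_iff_dvd.2 ?_).symm⟩
      push_cast
      rw [sub_neg_eq_add]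
      exact c.dvd_of_dvd_mul_left h6
  have hp2 : 0 < p ^ 2 := pow_pos hp.pos 2
  have k1 := dt_mod N (p ^ 2) hp2 B0
  have k2 := dt_mod N (p ^ 2) hp2 (-B0)
  have k3 : (Z.card : ℝ) ≤
      ((Finset.Icc (-(N : ℤ)) N).filter (fun x => x ≡ B0 [ZMOD (p ^ 2 : ℕ)])).card +
      ((Finset.Icc (-(N : ℤ)) N).filter (fun x => x ≡ -B0 [ZMOD (p ^ 2 : ℕ)])).card := by
    exact_mod_cast (Finset.card_le_card hsub).trans (Finset.card_union_le _ _)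
  push_cast at k1 k2 k3
  rw [div_eq_mul_inv] at k1 k2
  linarith

open Classical in
lemma dt_small (N : ℕ) (Q Y : ℝ) (hQ : 5 ≤ Q) (hY : 0 ≤ Y) :
    (((Finset.Icc (-(N : ℤ)) N ×ˢ Finset.Icc (-(N : ℤ)) N).filter (fun z : ℤ × ℤ =>
      ∃ p : ℕ, p.Prime ∧ 5 ≤ p ∧ Q < p ∧ (p : ℝ) ≤ Y ∧ ¬ (p : ℤ) ∣ z.1 ∧
        (p : ℤ) ^ 2 ∣ 4 * z.1 ^ 3 + 27 * z.2 ^ 2)).card : ℝ) ≤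
    (2 * N + 1) * (2 * ((2 * N + 1) * (2 / Q) + Y)) := by
  let I := Finset.Icc (-(N : ℤ)) N
  let W : ℤ × ℕ → Finset (ℤ × ℤ) := fun x => if (x.2.Prime ∧ 5 ≤ x.2 ∧ ¬ (x.2 : ℤ) ∣ x.1) then
    (I.filter (fun B => (x.2 : ℤ) ^ 2 ∣ 4 * x.1 ^ 3 + 27 * B ^ 2)).image (fun B => (x.1, B)) else ∅
  let U := Finset.Ioo ⌊Q⌋₊ (⌊Y⌋₊ + 1)
  have hsub : ((Finset.Icc (-(N : ℤ)) N ×ˢ Finset.Icc (-(N : ℤ)) N).filter (fun z : ℤ × ℤ =>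
      ∃ p : ℕ, p.Prime ∧ 5 ≤ p ∧ Q < p ∧ (p : ℝ) ≤ Y ∧ ¬ (p : ℤ) ∣ z.1 ∧
        (p : ℤ) ^ 2 ∣ 4 * z.1 ^ 3 + 27 * z.2 ^ 2)) ⊆ (I ×ˢ U).biUnion W := by
    intro z hz
    rw [Finset.mem_filter, Finset.mem_product] at hz
    obtain ⟨⟨hA, hB⟩, p, hp, h5, hQp, hpY, hpA, hD⟩ := hz
    refine Finset.mem_biUnion.2 ⟨(z.1, p), Finset.mem_product.2 ⟨hA, ?_⟩, ?_⟩
    · refine Finset.mem_Ioo.2 ⟨(Nat.floor_lt (by linarith)).2 hQp, ?_⟩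
      exact Nat.lt_succ_of_le (Nat.le_floor hpY)
    · simp only [W]
      rw [if_pos ⟨hp, h5, hpA⟩]
      exact Finset.mem_image.2 ⟨z.2, Finset.mem_filter.2 ⟨hB, hD⟩, rfl⟩
  have hW : ∀ x, ((W x).card : ℝ) ≤ 2 * ((2 * N + 1) * ((x.2 : ℝ) ^ 2)⁻¹ + 1) := by
    intro x
    simp only [W]
    split_ifs with h
    · refine le_trans ?_ (dt_small1 N x.2 h.1 h.2.1 x.1 h.2.2)
      exact_mod_cast Finset.card_image_le
    · simp; positivity
  have hI : (I.card : ℝ) = 2 * N + 1 := by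
    have : (I.card : ℤ) = 2 * N + 1 := by
      simp only [I]
      rw [Int.card_Icc, Int.toNat_of_nonneg (by omega)]; ring
    exact_mod_cast this
  have hU : (U.card : ℝ) ≤ Y := by
    refine le_trans ?_ (Nat.floor_le hY)
    simp only [U]
    rw [Nat.card_Ioo]
    exact_mod_cast (by omega)
  calc _ ≤ (((I ×ˢ U).biUnion W).card : ℝ) := by exact_mod_cast Finset.card_le_card hsub
    _ ≤ ∑ x ∈ I ×ˢ U, ((W x).card : ℝ) := by exact_mod_cast Finset.card_biUnion_le
    _ ≤ ∑ x ∈ I ×ˢ U, 2 * ((2 * N + 1) * ((x.2 : ℝ) ^ 2)⁻¹ + 1) :=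
      Finset.sum_le_sum fun x _ => hW x
    _ = I.card * (2 * ((2 * N + 1) * ∑ n ∈ U, ((n : ℝ) ^ 2)⁻¹ + U.card)) := by
      rw [Finset.sum_product]
      simp only [Finset.sum_const, nsmul_eq_mul]
      rw [← Finset.mul_sum, Finset.sum_add_distrib, ← Finset.mul_sum]
      simp
    _ ≤ _ := by
      rw [hI]
      have := dt_sumsq Q hQ (⌊Y⌋₊ + 1)
      gcongr

open Classical in
lemma dt_div (N : ℕ) (Q : ℝ) (hN : 1 ≤ N) (hQ : 5 ≤ Q) :
    (((Finset.Icc (-(N : ℤ)) N ×ˢ Finset.Icc (-(N : ℤ)) N).filter (fun z : ℤ × ℤ =>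
      4 * z.1 ^ 3 + 27 * z.2 ^ 2 ≠ 0 ∧
      ∃ p : ℕ, Q < p ∧ (p : ℤ) ∣ z.1 ∧ (p : ℤ) ∣ z.2)).card : ℝ) ≤
    16 * N ^ 2 * (2 / Q) := by
  let I := Finset.Icc (-(N : ℤ)) N
  let W : ℕ → Finset (ℤ × ℤ) := fun n => (I.filter (fun x => x ≡ 0 [ZMOD n])) ×ˢ
    (I.filter (fun x => x ≡ 0 [ZMOD n]))
  let U := Finset.Ioo ⌊Q⌋₊ (N + 1)
  have hsub : ((Finset.Icc (-(N : ℤ)) N ×ˢ Finset.Icc (-(N : ℤ)) N).filter (fun z : ℤ × ℤ =>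
      4 * z.1 ^ 3 + 27 * z.2 ^ 2 ≠ 0 ∧
      ∃ p : ℕ, Q < p ∧ (p : ℤ) ∣ z.1 ∧ (p : ℤ) ∣ z.2)) ⊆ U.biUnion W := by
    intro z hz
    rw [Finset.mem_filter, Finset.mem_product] at hz
    obtain ⟨⟨hA, hB⟩, hD, p, hQp, hpA, hpB⟩ := hz
    refine Finset.mem_biUnion.2 ⟨p, ?_, ?_⟩
    · refine Finset.mem_Ioo.2 ⟨(Nat.floor_lt (by linarith)).2 hQp, ?_⟩
      apply Nat.lt_succ_of_le
      have aux : ∀ x : ℤ, x ∈ Finset.Icc (-(N : ℤ)) N → x ≠ 0 → (p : ℤ) ∣ x → p ≤ N := by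
        intro x hx h0 hd
        have h1 := Int.le_of_dvd (abs_pos.2 h0) ((dvd_abs _ _).2 hd)
        have h2 : |x| ≤ N := abs_le.2 (Finset.mem_Icc.1 hx)
        exact_mod_cast h1.trans h2
      by_cases h1 : z.1 = 0
      · by_cases h2 : z.2 = 0
        · exact absurd (by rw [h1, h2]; norm_num) hD
        · exact aux _ hB h2 hpB
      · exact aux _ hA h1 hpA
    · simp only [W]
      rw [Finset.mem_product, Finset.mem_filter, Finset.mem_filter]
      exact ⟨⟨hA, Int.modEq_zero_iff_dvd.2 hpA⟩, ⟨hB, Int.modEq_zero_iff_dvd.2 hpB⟩⟩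
  have hW : ∀ n ∈ U, ((W n).card : ℝ) ≤ 16 * N ^ 2 * ((n : ℝ) ^ 2)⁻¹ := by
    intro n hn
    obtain ⟨hn1, hn2⟩ := Finset.mem_Ioo.1 hn
    have hn0 : 0 < n := by omega
    have hn0' : (0 : ℝ) < n := by exact_mod_cast hn0
    have k := dt_mod N n hn0 0
    have hnN : (n : ℝ) ≤ N := by exact_mod_cast Nat.lt_succ_iff.1 hn2
    have hN' : (1 : ℝ) ≤ N := by exact_mod_cast hN
    have k' : (2 * (N : ℝ) + 1) / n + 1 ≤ 4 * N / n := by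
      rw [div_add_one hn0'.ne']
      gcongr
      linarith
    simp only [W]
    rw [Finset.card_product]
    push_cast
    have k2 := k.trans k'
    calc _ ≤ (4 * (N : ℝ) / n) * (4 * (N : ℝ) / n) := by gcongr
      _ = _ := by field_simp; ring
  calc _ ≤ ((U.biUnion W).card : ℝ) := by exact_mod_cast Finset.card_le_card hsub
    _ ≤ ∑ x ∈ U, ((W x).card : ℝ) := by exact_mod_cast Finset.card_biUnion_le
    _ ≤ ∑ n ∈ U, 16 * (N : ℝ) ^ 2 * ((n : ℝ) ^ 2)⁻¹ := Finset.sum_le_sum hW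
    _ = 16 * (N : ℝ) ^ 2 * ∑ n ∈ U, ((n : ℝ) ^ 2)⁻¹ := by rw [Finset.mul_sum]
    _ ≤ _ := by
      have := dt_sumsq Q hQ (N + 1)
      gcongr

open Classical in
lemma dt_red (N R : ℕ) (hR : 2 * N ≤ R ^ 2) :
    (((Finset.Icc (-(N : ℤ)) N ×ˢ Finset.Icc (-(N : ℤ)) N).filter (fun z : ℤ × ℤ =>
      ∃ r : ℤ, r ^ 3 + z.1 * r + z.2 = 0)).card : ℝ) ≤ (2 * N + 1) * (2 * R + 1) := by
  have hI : ∀ N : ℕ, ((Finset.Icc (-(N : ℤ)) N).card : ℝ) = 2 * N + 1 := by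
    intro N
    have : ((Finset.Icc (-(N : ℤ)) N).card : ℤ) = 2 * N + 1 := by
      rw [Int.card_Icc, Int.toNat_of_nonneg (by omega)]; ring
    exact_mod_cast this
  have hsub : ((Finset.Icc (-(N : ℤ)) N ×ˢ Finset.Icc (-(N : ℤ)) N).filter (fun z : ℤ × ℤ =>
      ∃ r : ℤ, r ^ 3 + z.1 * r + z.2 = 0)) ⊆
      (Finset.Icc (-(N : ℤ)) N ×ˢ Finset.Icc (-(R : ℤ)) R).image
        (fun x => (x.1, -(x.2 ^ 3 + x.1 * x.2))) := by
    intro z hz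
    rw [Finset.mem_filter, Finset.mem_product] at hz
    obtain ⟨⟨hA, hB⟩, r, hr⟩ := hz
    refine Finset.mem_image.2 ⟨(z.1, r), Finset.mem_product.2 ⟨hA, ?_⟩, ?_⟩
    · rw [Finset.mem_Icc, ← abs_le]
      have hA' : |z.1| ≤ N := abs_le.2 (Finset.mem_Icc.1 hA)
      have hB' : |z.2| ≤ N := abs_le.2 (Finset.mem_Icc.1 hB)
      have hR' : 2 * (N : ℤ) ≤ (R : ℤ) ^ 2 := by exact_mod_cast hR
      by_contra hcon
      push Not at hcon
      change (R : ℤ) < |r| at hcon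
      have e : r ^ 3 = -(z.1 * r + z.2) := by linear_combination hr
      have h1 : |r| ^ 3 ≤ N * |r| + N := by
        rw [← abs_pow, e, abs_neg]
        refine (abs_add_le _ _).trans ?_
        rw [abs_mul]
        gcongr
      have hr1 : 1 ≤ |r| := by omega
      have h2 : (R : ℤ) ^ 2 < |r| ^ 2 := by gcongr
      have h3 : |r| ^ 3 = |r| ^ 2 * |r| := by ring
      nlinarith
    · ext
      · rfl
      · simp only; linear_combination -hr
  calc _ ≤ ((((Finset.Icc (-(N : ℤ)) N ×ˢ Finset.Icc (-(R : ℤ)) R).image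
        (fun x => (x.1, -(x.2 ^ 3 + x.1 * x.2)))).card : ℕ) : ℝ) := by
        exact_mod_cast Finset.card_le_card hsub
    _ ≤ ((Finset.Icc (-(N : ℤ)) N ×ˢ Finset.Icc (-(R : ℤ)) R).card : ℝ) := by
        exact_mod_cast Finset.card_image_le
    _ = _ := by
        rw [Finset.card_product]; push_cast; rw [hI, hI]

lemma dt_name {α : Type} (Z : Finset α) (c : ℝ) (h : (Z.card : ℝ) ≤ c) :
    ∃ W : Finset α, W = Z ∧ (W.card : ℝ) ≤ c := ⟨Z, rfl, h⟩

lemma dt_J (ε X : ℝ) (hε : 0 < ε) (hX : 2 ≤ X) (n : ℕ) (hn : n ≠ 0) (h : (n : ℝ) ≤ X ^ 11) :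
    ((Nat.log 2 n + 1 : ℕ) : ℝ) ≤ (1 + 44 / ε) * X ^ (ε / 2) := by
  have h1 : (2 : ℝ) ^ (Nat.log 2 n) ≤ X ^ 11 := by
    refine le_trans ?_ h
    exact_mod_cast Nat.pow_log_le_self 2 hn
  have h2 := Real.log_le_log (by positivity) h1
  rw [Real.log_pow, Real.log_pow] at h2
  have h3 : Real.log X ≤ X ^ (ε / 2) / (ε / 2) := Real.log_le_rpow_div (by linarith) (by positivity)
  have h4 := Real.log_two_gt_d9
  have h5 : (1 : ℝ) ≤ X ^ (ε / 2) := Real.one_le_rpow (by linarith) (by positivity)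
  have h6 : X ^ (ε / 2) / (ε / 2) = 2 / ε * X ^ (ε / 2) := by field_simp
  have h7 : (Nat.log 2 n : ℝ) * (1 / 2) ≤ (Nat.log 2 n : ℝ) * Real.log 2 := by
    gcongr; linarith
  have h8 : (1 + 44 / ε) * X ^ (ε / 2) = X ^ (ε / 2) + 22 * (2 / ε * X ^ (ε / 2)) := by ring
  push_cast at *
  rw [h8, ← h6]
  linarith

/-- Uniformity estimate: for any `ε > 0` there is a constant `K_ε` such that for all
`X ≥ 2` and `Q ≥ 5`, the number of elliptic curves `E_{A,B} : y² = x³ + Ax + B`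
(in minimal form: `p⁴ ∣ A → p⁶ ∤ B`) with nonzero discriminant `-16(4A³ + 27B²)`,
coefficient height `max(|A|,|B|) < X`, and discriminant divisible by `p²` for some
prime `p > Q`, is at most `K_ε (X^{2+ε}/Q + X^{7/4+ε})`. -/
theorem discriminant_tail_estimate (ε : ℝ) (hε : 0 < ε) :
    ∃ K : ℝ, ∀ X Q : ℝ, 2 ≤ X → 5 ≤ Q →
      ({p : ℤ × ℤ |
          4 * p.1 ^ 3 + 27 * p.2 ^ 2 ≠ 0 ∧
          (∀ q : ℕ, q.Prime → (q : ℤ) ^ 4 ∣ p.1 → ¬((q : ℤ) ^ 6 ∣ p.2)) ∧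
          ((max |p.1| |p.2| : ℤ) : ℝ) < X ∧
          (∃ q : ℕ, q.Prime ∧ Q < (q : ℝ) ∧
            (q : ℤ) ^ 2 ∣ -16 * (4 * p.1 ^ 3 + 27 * p.2 ^ 2))}.ncard : ℝ) ≤
        K * (X ^ (2 + ε) / Q + X ^ (7 / 4 + ε)) := by

  classical
  refine ⟨100 + 320 * 10 ^ 20 * (1 + 44 / ε) ^ 2, ?_⟩
  intro X Q hX hQ
  have hX0 : 0 < X := by linarith
  have hQ0 : 0 < Q := by linarith
  obtain ⟨s, hs⟩ : ∃ s : ℝ, s = X ^ (1 / 4 : ℝ) := ⟨_, rfl⟩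
  have hs1 : 1 ≤ s := by rw [hs]; exact Real.one_le_rpow (by linarith) (by norm_num)
  have hs0 : 0 < s := by linarith
  have hs4 : X = s ^ 4 := by
    rw [hs, ← Real.rpow_natCast, ← Real.rpow_mul hX0.le]; norm_num
  have hs7 : X ^ (7 / 4 + ε) = s ^ 7 * X ^ ε := by
    rw [Real.rpow_add hX0, hs, ← Real.rpow_natCast, ← Real.rpow_mul hX0.le]; norm_num
  have hX2 : X ^ (2 + ε) = X ^ 2 * X ^ ε := by
    rw [Real.rpow_add hX0]; norm_num
  have hXe : 1 ≤ X ^ ε := Real.one_le_rpow (by linarith) hε.le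
  obtain ⟨N, hN⟩ : ∃ N, N = ⌊X⌋₊ := ⟨_, rfl⟩
  have hNX : (N : ℝ) ≤ X := by rw [hN]; exact Nat.floor_le hX0.le
  have hN1 : 1 ≤ N := by rw [hN]; exact Nat.le_floor (by push_cast; linarith)
  obtain ⟨M, hM⟩ : ∃ M, M = ⌈s ^ 2⌉₊ := ⟨_, rfl⟩
  have hMs : s ^ 2 ≤ M := by rw [hM]; exact Nat.le_ceil _
  have hs2 : 1 ≤ s ^ 2 := one_le_pow₀ hs1
  have hMs2 : (M : ℝ) ≤ 2 * s ^ 2 := by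
    have := Nat.ceil_lt_add_one (by positivity : 0 ≤ s ^ 2)
    rw [← hM] at this
    linarith
  have hM1 : 1 ≤ M := by
    have : (1 : ℝ) ≤ M := by linarith
    exact_mod_cast this
  have hNM : N ≤ M ^ 2 := by
    have : (N : ℝ) ≤ (M : ℝ) ^ 2 := by
      calc (N : ℝ) ≤ X := hNX
        _ = (s ^ 2) ^ 2 := by rw [hs4]; ring
        _ ≤ _ := by gcongr
    exact_mod_cast this
  have hn0 : 62 * M * N ^ 3 ≠ 0 := by positivity
  have hnX : ((62 * M * N ^ 3 : ℕ) : ℝ) ≤ X ^ 11 := by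
    push_cast
    have e2 : s ^ 2 ≤ X := by
      rw [hs4]; exact pow_le_pow_right₀ hs1 (by norm_num)
    calc 62 * (M : ℝ) * N ^ 3 ≤ 62 * (2 * X) * X ^ 3 := by
          gcongr
          linarith
      _ = 124 * X ^ 4 := by ring
      _ ≤ 2 ^ 7 * X ^ 4 := by gcongr; norm_num
      _ ≤ X ^ 7 * X ^ 4 := by gcongr
      _ = _ := by ring
  obtain ⟨J, hJ⟩ : ∃ J, J = Nat.log 2 (62 * M * N ^ 3) + 1 := ⟨_, rfl⟩
  have hJ1 : 62 * M * N ^ 3 < 2 ^ J := by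
    rw [hJ]; exact Nat.lt_pow_succ_log_self (by norm_num) _
  have hJ2 : (J : ℝ) ≤ (1 + 44 / ε) * X ^ (ε / 2) := by
    rw [hJ]; exact dt_J ε X hε hX _ hn0 hnX
  have hJ3 : (J : ℝ) ^ 2 ≤ (1 + 44 / ε) ^ 2 * X ^ ε := by
    calc (J : ℝ) ^ 2 ≤ ((1 + 44 / ε) * X ^ (ε / 2)) ^ 2 := by gcongr
      _ = (1 + 44 / ε) ^ 2 * (X ^ (ε / 2)) ^ 2 := by ring
      _ = _ := by
        congr 1
        rw [← Real.rpow_natCast, ← Real.rpow_mul hX0.le]; norm_num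
  have b1 := dt_large N M J (s ^ 3) hN1 hM1 hNM (by positivity) hJ1
  have b2 := dt_small N Q (s ^ 3) hQ (by positivity)
  have b3 := dt_div N Q hN1 hQ
  have b4 := dt_red N (2 * M) (by nlinarith)
  obtain ⟨Z1, hZ1, b1⟩ := dt_name _ _ b1
  obtain ⟨Z2, hZ2, b2⟩ := dt_name _ _ b2
  obtain ⟨Z3, hZ3, b3⟩ := dt_name _ _ b3
  obtain ⟨Z4, hZ4, b4⟩ := dt_name _ _ b4
  have hsub : {p : ℤ × ℤ |
          4 * p.1 ^ 3 + 27 * p.2 ^ 2 ≠ 0 ∧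
          (∀ q : ℕ, q.Prime → (q : ℤ) ^ 4 ∣ p.1 → ¬((q : ℤ) ^ 6 ∣ p.2)) ∧
          ((max |p.1| |p.2| : ℤ) : ℝ) < X ∧
          (∃ q : ℕ, q.Prime ∧ Q < (q : ℝ) ∧
            (q : ℤ) ^ 2 ∣ -16 * (4 * p.1 ^ 3 + 27 * p.2 ^ 2))} ⊆
      ((Z1 ∪ Z2 ∪ Z3 ∪ Z4 : Finset (ℤ × ℤ)) : Set (ℤ × ℤ)) := by
    rintro z ⟨hD0, -, hmax, p, hp, hQp, hD⟩
    have hbox : z ∈ Finset.Icc (-(N : ℤ)) N ×ˢ Finset.Icc (-(N : ℤ)) N := by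
      have aux : ∀ x : ℤ, |x| ≤ max |z.1| |z.2| → x ∈ Finset.Icc (-(N : ℤ)) N := by
        intro x hx
        rw [Finset.mem_Icc, ← abs_le, Int.abs_eq_natAbs]
        have h1 : ((|x| : ℤ) : ℝ) < X := lt_of_le_of_lt (by exact_mod_cast hx) hmax
        rw [Int.abs_eq_natAbs, Int.cast_natCast] at h1
        have : x.natAbs ≤ N := by rw [hN]; exact Nat.le_floor h1.le
        exact_mod_cast this
      exact Finset.mem_product.2 ⟨aux _ (le_max_left _ _), aux _ (le_max_right _ _)⟩
    have h5 : 5 ≤ p := by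
      have : (5 : ℝ) ≤ p := by linarith
      exact_mod_cast this
    have hpi : Prime (p : ℤ) := Nat.prime_iff_prime_int.mp hp
    have h2 : ¬ (p : ℤ) ∣ 2 := by
      intro h
      have := Int.le_of_dvd (by norm_num) h
      omega
    have h3 : ¬ (p : ℤ) ∣ 3 := by
      intro h
      have := Int.le_of_dvd (by norm_num) h
      omega
    have h27 : ¬ (p : ℤ) ∣ 27 := by
      intro h
      exact h3 (hpi.dvd_of_dvd_pow (by norm_num; exact h : (p : ℤ) ∣ 3 ^ 3))
    have c16 : IsCoprime ((p : ℤ) ^ 2) (-16) := by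
      have : IsCoprime ((p : ℤ) ^ 2) (2 ^ 4) := ((hpi.coprime_iff_not_dvd).2 h2).pow
      norm_num at this
      exact this.neg_right
    have hD' : (p : ℤ) ^ 2 ∣ 4 * z.1 ^ 3 + 27 * z.2 ^ 2 := c16.dvd_of_dvd_mul_left hD
    rw [Finset.mem_coe, Finset.mem_union, Finset.mem_union, Finset.mem_union]
    by_cases hr : ∃ r : ℤ, r ^ 3 + z.1 * r + z.2 = 0
    · right
      rw [hZ4]
      exact Finset.mem_filter.2 ⟨hbox, hr⟩
    left
    by_cases hA : (p : ℤ) ∣ z.1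
    · right
      rw [hZ3]
      refine Finset.mem_filter.2 ⟨hbox, hD0, p, hQp, hA, ?_⟩
      have k1 : (p : ℤ) ∣ 4 * z.1 ^ 3 + 27 * z.2 ^ 2 := (dvd_pow_self _ two_ne_zero).trans hD'
      have k2 : (p : ℤ) ∣ 4 * z.1 ^ 3 := Dvd.dvd.mul_left (dvd_pow hA three_ne_zero) _
      have k3 := (dvd_add_right k2).1 k1
      exact hpi.dvd_of_dvd_pow ((hpi.dvd_or_dvd k3).resolve_left h27)
    left
    rcases le_or_gt (p : ℝ) (s ^ 3) with h | h
    · right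
      rw [hZ2]
      exact Finset.mem_filter.2 ⟨hbox, p, hp, h5, hQp, h, hA, hD'⟩
    · left
      rw [hZ1]
      exact Finset.mem_filter.2 ⟨hbox, hD0, hr, p, hp, h5, h, hA, hD'⟩
  have hcard : (Set.ncard {p : ℤ × ℤ |
          4 * p.1 ^ 3 + 27 * p.2 ^ 2 ≠ 0 ∧
          (∀ q : ℕ, q.Prime → (q : ℤ) ^ 4 ∣ p.1 → ¬((q : ℤ) ^ 6 ∣ p.2)) ∧
          ((max |p.1| |p.2| : ℤ) : ℝ) < X ∧
          (∃ q : ℕ, q.Prime ∧ Q < (q : ℝ) ∧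
            (q : ℤ) ^ 2 ∣ -16 * (4 * p.1 ^ 3 + 27 * p.2 ^ 2))} : ℝ) ≤
      Z1.card + Z2.card + Z3.card + Z4.card := by
    have k := Set.ncard_le_ncard hsub (Finset.finite_toSet _)
    rw [Set.ncard_coe_finset] at k
    have k1 := Finset.card_union_le (Z1 ∪ Z2 ∪ Z3) Z4
    have k2 := Finset.card_union_le (Z1 ∪ Z2) Z3
    have k3 := Finset.card_union_le Z1 Z2
    have k4 := k.trans (show (Z1 ∪ Z2 ∪ Z3 ∪ Z4).card ≤ Z1.card + Z2.card + Z3.card + Z4.card by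
      omega)
    have k5 := (Nat.cast_le (α := ℝ)).2 k4
    rw [Nat.cast_add, Nat.cast_add, Nat.cast_add] at k5
    exact k5
  refine hcard.trans ?_
  have hN3 : 2 * (N : ℝ) + 1 ≤ 3 * X := by linarith
  have c1 : (Z1.card : ℝ) ≤ 320 * 10 ^ 20 * (1 + 44 / ε) ^ 2 * (s ^ 7 * X ^ ε) := by
    refine b1.trans ?_
    have d1 : (M : ℝ) ^ 6 / (s ^ 3) ^ 2 ≤ 64 * s ^ 7 := by
      calc (M : ℝ) ^ 6 / (s ^ 3) ^ 2 ≤ (2 * s ^ 2) ^ 6 / (s ^ 3) ^ 2 := by gcongr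
        _ = 64 * s ^ 6 := by field_simp; ring
        _ ≤ 64 * s ^ 7 := by
          gcongr
          norm_num
    have d2 : (M : ℝ) ^ 5 / s ^ 3 ≤ 32 * s ^ 7 := by
      calc (M : ℝ) ^ 5 / s ^ 3 ≤ (2 * s ^ 2) ^ 5 / s ^ 3 := by gcongr
        _ = 32 * s ^ 7 := by field_simp; ring
    calc _ ≤ ((1 + 44 / ε) ^ 2 * X ^ ε) * (10 ^ 20 * (4 * (64 * s ^ 7) + 2 * (32 * s ^ 7))) := by
          gcongr
      _ = _ := by ring
  have c2 : (Z2.card : ℝ) ≤ 36 * (X ^ 2 / Q) + 6 * s ^ 7 := by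
    refine b2.trans ?_
    calc _ ≤ (3 * X) * (2 * ((3 * X) * (2 / Q) + s ^ 3)) := by gcongr
      _ = 36 * (X ^ 2 / Q) + 6 * X * s ^ 3 := by ring
      _ = _ := by rw [hs4]; ring
  have c3 : (Z3.card : ℝ) ≤ 32 * (X ^ 2 / Q) := by
    refine b3.trans ?_
    calc _ ≤ 16 * X ^ 2 * (2 / Q) := by gcongr
      _ = _ := by ring
  have c4 : (Z4.card : ℝ) ≤ 27 * s ^ 7 := by
    refine b4.trans ?_
    calc _ ≤ (3 * X) * (9 * s ^ 2) := by
          gcongr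
          push_cast
          linarith
      _ = 27 * s ^ 6 := by rw [hs4]; ring
      _ ≤ 27 * s ^ 7 := by
          gcongr
          norm_num
  have f1 : X ^ 2 / Q ≤ X ^ 2 * X ^ ε / Q := by
    gcongr
    exact le_mul_of_one_le_right (by positivity) hXe
  have f2 : s ^ 7 ≤ s ^ 7 * X ^ ε := le_mul_of_one_le_right (by positivity) hXe
  rw [hs7, hX2]
  have f3 : 0 ≤ X ^ 2 * X ^ ε / Q := by positivity
  have f4 : 0 ≤ s ^ 7 * X ^ ε := by positivity
  have f5 : 0 ≤ 320 * 10 ^ 20 * (1 + 44 / ε) ^ 2 * (X ^ 2 * X ^ ε / Q) := by positivity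
  rw [add_mul, mul_add, mul_add]
  linarith
end

section
/- For every ε > 0 there exists a constant K_ε such that for all real X ≥ 2 and all pairs (I,J) ∈ ℤ^2 with |I| ≤ X, |J| ≤ X, 4I^3 − J^2 ≠ 0, and such that the cubic polynomial x^3 − 3Ix + J is reducible over ℚ, the number of GL_2(ℤ)-equivalence classes of integral binary quartic forms f with I(f) = I and J(f) = J is at most K_ε · X^{1/2+ε}. -/
open Filter

/-- An integral binary quartic form `a x⁴ + b x³y + c x²y² + d xy³ + e y⁴`. -/
structure BQF where
  a : ℤ
  b : ℤ
  c : ℤ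
  d : ℤ
  e : ℤ

namespace BQF

/-- The invariant `I` of a binary quartic form. -/
def I (f : BQF) : ℤ := 12 * f.a * f.e - 3 * f.b * f.d + f.c ^ 2

/-- The invariant `J` of a binary quartic form. -/
def J (f : BQF) : ℤ :=
  72 * f.a * f.c * f.e + 9 * f.b * f.c * f.d - 27 * f.a * f.d ^ 2 -
    27 * f.e * f.b ^ 2 - 2 * f.c ^ 3

/-- Evaluation of the form at a pair of integers. -/
def evalZ (f : BQF) (x y : ℤ) : ℤ :=
  f.a * x ^ 4 + f.b * x ^ 3 * y + f.c * x ^ 2 * y ^ 2 + f.d * x * y ^ 3 + f.e * y ^ 4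

/-- Evaluation of the form at a pair of reals. -/
noncomputable def evalR (f : BQF) (x y : ℝ) : ℝ :=
  (f.a : ℝ) * x ^ 4 + (f.b : ℝ) * x ^ 3 * y + (f.c : ℝ) * x ^ 2 * y ^ 2 +
    (f.d : ℝ) * x * y ^ 3 + (f.e : ℝ) * y ^ 4

/-- `GL₂(ℤ)`-equivalence: `g = γ · f` where `(γ · f)(x,y) = f((x,y)γ)` for some
integer matrix `γ` with unit (i.e. `±1`) determinant. -/
def Equivalent (f g : BQF) : Prop :=
  ∃ γ : Matrix (Fin 2) (Fin 2) ℤ, IsUnit γ.det ∧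
    ∀ x y : ℤ, g.evalZ x y = f.evalZ (x * γ 0 0 + y * γ 1 0) (x * γ 0 1 + y * γ 1 1)

/-- Irreducibility of the form over `ℚ`: it has no factor of positive degree with
rational coefficients.  Equivalently, `a ≠ 0` (no root at infinity, i.e. no factor `y`)
and the dehomogenized quartic polynomial is irreducible over `ℚ`. -/
def Irred (f : BQF) : Prop :=
  f.a ≠ 0 ∧
    Irreducible (Polynomial.C (f.a : ℚ) * Polynomial.X ^ 4 +
      Polynomial.C (f.b : ℚ) * Polynomial.X ^ 3 +
      Polynomial.C (f.c : ℚ) * Polynomial.X ^ 2 +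
      Polynomial.C (f.d : ℚ) * Polynomial.X + Polynomial.C (f.e : ℚ))

/-- The set of real roots of `f`; for a form with `a ≠ 0` all roots of `f` in `ℙ¹(ℝ)`
have the shape `(z : 1)` with `z` real. -/
def realRoots (f : BQF) : Set ℝ := {z : ℝ | f.evalR z 1 = 0}

end BQF

/-- The number of `GL₂(ℤ)`-equivalence classes of integral binary quartic forms
satisfying the predicate `P`. -/
noncomputable def classCount (P : BQF → Prop) : ℕ :=
  Nat.card (Quot fun f g : {h : BQF // P h} => BQF.Equivalent f.1 g.1)


section field
variable {K : Type*} [Field K] [CharZero K] {a b c d e A B C f : K}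

theorem solve_cde (hA : A ≠ 0)
    (h1 : 12*a*C-3*B*b+2*A*c+2*f*A = 0) (h2 : 3*b*C-2*B*c+3*A*d+f*B = 0)
    (h3 : 2*c*C-3*B*d+12*A*e+2*f*C = 0) :
    c = (3*B*b-12*a*C-2*f*A)/(2*A) ∧ d = (2*B*c-3*b*C-f*B)/(3*A) ∧
      e = (3*B*d-2*c*C-2*f*C)/(12*A) := by
  refine ⟨?_, ?_, ?_⟩
  · field_simp; linear_combination h1
  · field_simp; linear_combination h2
  · field_simp; linear_combination h3

theorem norm_field (hA : A ≠ 0)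
    (h1 : 12*a*C-3*B*b+2*A*c+2*f*A = 0) (h2 : 3*b*C-2*B*c+3*A*d+f*B = 0)
    (h3 : 2*c*C-3*B*d+12*A*e+2*f*C = 0) :
    3*((2*(B^2-4*A*C)*a-f*A^2)^2 - (B^2-4*A*C)*(2*B*a-A*b)^2) =
      A^4*(4*(12*a*e-3*b*d+c^2)-f^2) := by
  obtain ⟨hc, hd, he⟩ := solve_cde hA h1 h2 h3
  rw [he, hd, hc]; field_simp; ring

theorem ZA_field (hA : A ≠ 0)
    (h1 : 12*a*C-3*B*b+2*A*c+2*f*A = 0) (h2 : 3*b*C-2*B*c+3*A*d+f*B = 0)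
    (h3 : 2*c*C-3*B*d+12*A*e+2*f*C = 0) :
    A^2*(12*(f^2-(12*a*e-3*b*d+c^2))) = (B^2-4*A*C)*(9*b^2-24*a*c+12*a*f) := by
  obtain ⟨hc, hd, he⟩ := solve_cde hA h1 h2 h3
  rw [he, hd, hc]; field_simp; ring

theorem ZB_field (hA : A ≠ 0)
    (h1 : 12*a*C-3*B*b+2*A*c+2*f*A = 0) (h2 : 3*b*C-2*B*c+3*A*d+f*B = 0)
    (h3 : 2*c*C-3*B*d+12*A*e+2*f*C = 0) :
    B^2*(12*(f^2-(12*a*e-3*b*d+c^2))) = (B^2-4*A*C)*((2*c+2*f)^2-144*a*e) := by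
  obtain ⟨hc, hd, he⟩ := solve_cde hA h1 h2 h3
  rw [he, hd, hc]; field_simp; ring

theorem ZC_field (hA : A ≠ 0)
    (h1 : 12*a*C-3*B*b+2*A*c+2*f*A = 0) (h2 : 3*b*C-2*B*c+3*A*d+f*B = 0)
    (h3 : 2*c*C-3*B*d+12*A*e+2*f*C = 0) :
    C^2*(12*(f^2-(12*a*e-3*b*d+c^2))) = (B^2-4*A*C)*(9*d^2-24*e*c+12*e*f) := by
  obtain ⟨hc, hd, he⟩ := solve_cde hA h1 h2 h3
  rw [he, hd, hc]; field_simp; ring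

/-- the quartic covariant `U + s V` is a perfect fourth power, up to a constant -/
theorem fourth_field {s x y : K} (hA : A ≠ 0) (hs : s^2 = B^2-4*A*C)
    (h1 : 12*a*C-3*B*b+2*A*c+2*f*A = 0) (h2 : 3*b*C-2*B*c+3*A*d+f*B = 0)
    (h3 : 2*c*C-3*B*d+12*A*e+2*f*C = 0) :
    ∃ V : K, 
    16*A^4*((2*s^2*(a*x^4+b*x^3*y+c*x^2*y^2+d*x*y^3+e*y^4)-f*(A*x^2+B*x*y+C*y^2)^2) + s * V) =
      ((2*s^2*a-f*A^2) + s*(2*B*a-A*b)) * (2*A*x+(B-s)*y)^4 ∧ 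
    16*A^4*((2*s^2*(a*x^4+b*x^3*y+c*x^2*y^2+d*x*y^3+e*y^4)-f*(A*x^2+B*x*y+C*y^2)^2) - s * V) =
      ((2*s^2*a-f*A^2) - s*(2*B*a-A*b)) * (2*A*x+(B+s)*y)^4 := by
  obtain ⟨hc, hd, he⟩ := solve_cde hA h1 h2 h3
  have hC : C = (B^2-s^2)/(4*A) := by field_simp; linear_combination hs
  refine ⟨((B*x+2*C*y)*(4*a*x^3+3*b*x^2*y+2*c*x*y^2+d*y^3) - (2*A*x+B*y)*(b*x^3+2*c*x^2*y+3*d*x*y^2+4*e*y^3))/2, ?_, ?_⟩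
  · rw [he, hd, hc, hC]; field_simp; ring
  · rw [he, hd, hc, hC]; field_simp; ring
end field

namespace BQF

/-- substitution -/
def sub (f : BQF) (p q r s : ℤ) : BQF where
  a := f.a*p^4+f.b*p^3*r+f.c*p^2*r^2+f.d*p*r^3+f.e*r^4
  b := 4*f.a*p^3*q + f.b*(p^3*s+3*p^2*q*r) + f.c*(2*p^2*r*s+2*p*q*r^2)
    + f.d*(3*p*r^2*s+q*r^3) + 4*f.e*r^3*s
  c := 6*f.a*p^2*q^2 + f.b*(3*p^2*q*s+3*p*q^2*r) + f.c*(p^2*s^2+4*p*q*r*s+q^2*r^2)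
    + f.d*(3*p*r*s^2+3*q*r^2*s) + 6*f.e*r^2*s^2
  d := 4*f.a*p*q^3 + f.b*(3*p*q^2*s+q^3*r) + f.c*(2*p*q*s^2+2*q^2*r*s)
    + f.d*(p*s^3+3*q*r*s^2) + 4*f.e*r*s^3
  e := f.a*q^4+f.b*q^3*s+f.c*q^2*s^2+f.d*q*s^3+f.e*s^4

theorem sub_eval (f : BQF) (p q r s x y : ℤ) :
    (f.sub p q r s).evalZ x y = f.evalZ (p*x+q*y) (r*x+s*y) := by
  simp only [sub, evalZ]; ring

theorem sub_I (f : BQF) (p q r s : ℤ) : (f.sub p q r s).I = (p*s-q*r)^4 * f.I := by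
  simp only [sub, I]; ring

theorem sub_J (f : BQF) (p q r s : ℤ) : (f.sub p q r s).J = (p*s-q*r)^6 * f.J := by
  simp only [sub, J]; ring

theorem sub_equiv (f : BQF) (p q r s : ℤ) (h : p*s-q*r = 1) : f.Equivalent (f.sub p q r s) := by
  refine ⟨!![p, r; q, s], ?_, ?_⟩
  · rw [Matrix.det_fin_two]; simp
    rw [show p*s-r*q = 1 by linarith]; exact isUnit_one
  · intro x y; rw [sub_eval]; simp; congr 1 <;> ring

/-- `Q = (A,B,C)` is attached to `f` and the root `φ`. -/
def Rel (f : BQF) (φ A B C : ℤ) : Prop :=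
  12*f.a*C-3*B*f.b+2*A*f.c+2*φ*A = 0 ∧ 3*f.b*C-2*B*f.c+3*A*f.d+φ*B = 0 ∧
    2*f.c*C-3*B*f.d+12*A*f.e+2*φ*C = 0

theorem Rel.sub {f : BQF} {φ A B C : ℤ} (h : f.Rel φ A B C) (p q r s : ℤ) (hd : p*s-q*r = 1) :
    (f.sub p q r s).Rel φ (A*p^2+B*p*r+C*r^2) (2*A*p*q+B*(p*s+q*r)+2*C*r*s)
      (A*q^2+B*q*s+C*s^2) := by
  obtain ⟨h1, h2, h3⟩ := h
  have hd2 : (p*s-q*r)^2 = 1 := by rw [hd]; rfl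
  simp only [Rel, BQF.sub]
  refine ⟨?_, ?_, ?_⟩
  · linear_combination p^2*h1+2*p*r*h2+r^2*h3 + hd2 * ((12*f.a*C-3*B*f.b+2*A*f.c)*p^2+2*p*r*(3*f.b*C-2*B*f.c+3*A*f.d)+r^2*(2*f.c*C-3*B*f.d+12*A*f.e))
  · linear_combination p*q*h1+(p*s+q*r)*h2+r*s*h3 + hd2 * ((12*f.a*C-3*B*f.b+2*A*f.c)*p*q+(p*s+q*r)*(3*f.b*C-2*B*f.c+3*A*f.d)+r*s*(2*f.c*C-3*B*f.d+12*A*f.e))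
  · linear_combination q^2*h1+2*q*s*h2+s^2*h3 + hd2 * ((12*f.a*C-3*B*f.b+2*A*f.c)*q^2+2*q*s*(3*f.b*C-2*B*f.c+3*A*f.d)+s^2*(2*f.c*C-3*B*f.d+12*A*f.e))

theorem disc_sub (A B C p q r s : ℤ) (hd : p*s-q*r = 1) :
    (2*A*p*q+B*(p*s+q*r)+2*C*r*s)^2 - 4*(A*p^2+B*p*r+C*r^2)*(A*q^2+B*q*s+C*s^2) = B^2-4*A*C := by
  have hd2 : (p*s-q*r)^2 = 1 := by rw [hd]; rfl
  linear_combination hd2 * (B^2-4*A*C)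

theorem exists_rel (f : BQF) (φ : ℤ) (h : φ^3-3*f.I*φ+f.J = 0) :
    ∃ A B C : ℤ, f.Rel φ A B C ∧ (∀ n : ℤ, n ∣ A → n ∣ B → n ∣ C → IsUnit n) := by
  have hdet : Matrix.det !![2*f.c+2*φ, -3*f.b, 12*f.a; 3*f.d, φ-2*f.c, 3*f.b; 12*f.e, -3*f.d, 2*f.c+2*φ] = 0 := by
    have : Matrix.det !![2*f.c+2*φ, -3*f.b, 12*f.a; 3*f.d, φ-2*f.c, 3*f.b; 12*f.e, -3*f.d, 2*f.c+2*φ] = 4*(φ^3-3*f.I*φ+f.J) := by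
      rw [Matrix.det_fin_three]; simp [I, J]; ring
    rw [this, h]; rfl
  obtain ⟨v, hv, hv0⟩ := Matrix.exists_mulVec_eq_zero_iff.mpr hdet
  have e0 := congrFun hv0 0
  have e1 := congrFun hv0 1
  have e2 := congrFun hv0 2
  simp [Matrix.mulVec, dotProduct, Fin.sum_univ_three] at e0 e1 e2
  set g : ℤ := gcd (gcd (v 0) (v 1)) (v 2) with hg
  have g0 : g ∣ v 0 := (gcd_dvd_left _ _).trans (gcd_dvd_left _ _)
  have g1 : g ∣ v 1 := (gcd_dvd_left _ _).trans (gcd_dvd_right _ _)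
  have g2 : g ∣ v 2 := gcd_dvd_right _ _
  have gne : g ≠ 0 := by
    intro h0
    apply hv
    rw [h0] at g0 g1 g2
    ext i; fin_cases i
    · simpa using g0
    · simpa using g1
    · simpa using g2
  have hgmax : ∀ n, n ∣ v 0 → n ∣ v 1 → n ∣ v 2 → n ∣ g := fun n a b c => dvd_gcd (dvd_gcd a b) c
  clear_value g
  obtain ⟨A, hA⟩ := g0
  obtain ⟨B, hB⟩ := g1
  obtain ⟨C, hC⟩ := g2
  rw [hA, hB, hC] at e0 e1 e2
  refine ⟨A, B, C, ⟨?_, ?_, ?_⟩, ?_⟩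
  · apply mul_left_cancel₀ gne; linear_combination e0
  · apply mul_left_cancel₀ gne; linear_combination e1
  · apply mul_left_cancel₀ gne; linear_combination e2
  · intro n h0 h1 h2
    have := hgmax (g*n) (hA ▸ mul_dvd_mul_left g h0) (hB ▸ mul_dvd_mul_left g h1) (hC ▸ mul_dvd_mul_left g h2)
    have h3 : g * n ∣ g * 1 := by simpa using this
    exact isUnit_of_dvd_one ((mul_dvd_mul_iff_left gne).mp h3)

theorem Rel.norm {f : BQF} {φ A B C : ℤ} (h : f.Rel φ A B C) (hA : A ≠ 0) :
    3*((2*(B^2-4*A*C)*f.a-φ*A^2)^2 - (B^2-4*A*C)*(2*B*f.a-A*f.b)^2) = A^4*(4*f.I-φ^2) := by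
  obtain ⟨h1, h2, h3⟩ := h
  have := norm_field (K := ℚ) (a := f.a) (b := f.b) (c := f.c) (d := f.d) (e := f.e) (A := A)
    (B := B) (C := C) (f := φ) (by exact_mod_cast hA) (by exact_mod_cast h1)
    (by exact_mod_cast h2) (by exact_mod_cast h3)
  simp only [I]
  exact_mod_cast this

theorem Rel.ZA {f : BQF} {φ A B C : ℤ} (h : f.Rel φ A B C) (hA : A ≠ 0) :
    A^2*(12*(φ^2-f.I)) = (B^2-4*A*C)*(9*f.b^2-24*f.a*f.c+12*f.a*φ) := by
  obtain ⟨h1, h2, h3⟩ := h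
  have := ZA_field (K := ℚ) (a := f.a) (b := f.b) (c := f.c) (d := f.d) (e := f.e) (A := A)
    (B := B) (C := C) (f := φ) (by exact_mod_cast hA) (by exact_mod_cast h1)
    (by exact_mod_cast h2) (by exact_mod_cast h3)
  simp only [I]
  exact_mod_cast this

theorem Rel.ZB {f : BQF} {φ A B C : ℤ} (h : f.Rel φ A B C) (hA : A ≠ 0) :
    B^2*(12*(φ^2-f.I)) = (B^2-4*A*C)*((2*f.c+2*φ)^2-144*f.a*f.e) := by
  obtain ⟨h1, h2, h3⟩ := h
  have := ZB_field (K := ℚ) (a := f.a) (b := f.b) (c := f.c) (d := f.d) (e := f.e) (A := A)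
    (B := B) (C := C) (f := φ) (by exact_mod_cast hA) (by exact_mod_cast h1)
    (by exact_mod_cast h2) (by exact_mod_cast h3)
  simp only [I]
  exact_mod_cast this

theorem Rel.ZC {f : BQF} {φ A B C : ℤ} (h : f.Rel φ A B C) (hA : A ≠ 0) :
    C^2*(12*(φ^2-f.I)) = (B^2-4*A*C)*(9*f.d^2-24*f.e*f.c+12*f.e*φ) := by
  obtain ⟨h1, h2, h3⟩ := h
  have := ZC_field (K := ℚ) (a := f.a) (b := f.b) (c := f.c) (d := f.d) (e := f.e) (A := A)
    (B := B) (C := C) (f := φ) (by exact_mod_cast hA) (by exact_mod_cast h1)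
    (by exact_mod_cast h2) (by exact_mod_cast h3)
  simp only [I]
  exact_mod_cast this

theorem Rel.determined {f g : BQF} {φ A B C : ℤ} (hA : A ≠ 0) (hf : f.Rel φ A B C)
    (hg : g.Rel φ A B C) (ha : f.a = g.a) (hb : f.b = g.b) : f = g := by
  obtain ⟨f1, f2, f3⟩ := hf
  obtain ⟨g1, g2, g3⟩ := hg
  have hc : f.c = g.c := by
    apply mul_left_cancel₀ (mul_ne_zero two_ne_zero hA)
    rw [ha, hb] at f1; linear_combination f1 - g1
  have hd : f.d = g.d := by
    apply mul_left_cancel₀ (mul_ne_zero three_ne_zero hA)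
    rw [hc, hb] at f2; linear_combination f2 - g2
  have he : f.e = g.e := by
    apply mul_left_cancel₀ (mul_ne_zero (by norm_num : (12:ℤ) ≠ 0) hA)
    rw [hc, hd] at f3; linear_combination f3 - g3
  cases f; cases g; simp_all

theorem int_dvd_of_sq {D Z A B C : ℤ} (hp : ∀ n : ℤ, n ∣ A → n ∣ B → n ∣ C → IsUnit n)
    (hA : D ∣ A^2*Z) (hB : D ∣ B^2*Z) (hC : D ∣ C^2*Z) : D ∣ Z := by
  have h1 : IsCoprime (gcd (A^2) (B^2)) (C^2) := by
    rw [← gcd_isUnit_iff]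
    by_contra hu
    by_cases h0 : gcd (gcd (A^2) (B^2)) (C^2) = 0
    · rw [gcd_eq_zero_iff, gcd_eq_zero_iff] at h0
      obtain ⟨⟨h1, h2⟩, h3⟩ := h0
      have := hp 2 (by simp [pow_eq_zero_iff (two_ne_zero)|>.mp h1]) (by simp [pow_eq_zero_iff (two_ne_zero)|>.mp h2]) (by simp [pow_eq_zero_iff (two_ne_zero)|>.mp h3])
      rw [Int.isUnit_iff] at this; omega
    obtain ⟨q, hq, hqd⟩ := WfDvdMonoid.exists_irreducible_factor hu h0
    have hqp := hq.prime
    exact hq.not_isUnit (hp q (hqp.dvd_of_dvd_pow (hqd.trans ((gcd_dvd_left _ _).trans (gcd_dvd_left _ _))))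
      (hqp.dvd_of_dvd_pow (hqd.trans ((gcd_dvd_left _ _).trans (gcd_dvd_right _ _))))
      (hqp.dvd_of_dvd_pow (hqd.trans (gcd_dvd_right _ _))))
  have h2 : D ∣ gcd (A^2) (B^2) * Z := by
    have : D ∣ gcd (A^2*Z) (B^2*Z) := dvd_gcd hA hB
    rw [gcd_mul_right] at this
    exact this.trans (mul_dvd_mul_left _ (by simp))
  obtain ⟨x, y, hxy⟩ := h1
  have : Z = x * (gcd (A^2) (B^2) * Z) + y * (C^2*Z) := by linear_combination -Z*hxy
  rw [this]
  exact dvd_add (h2.mul_left _) (hC.mul_left _)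

end BQF

theorem exists_small_rep (x m : ℤ) (hm : m ≠ 0) : ∃ n : ℤ, |x + 2*n*m| ≤ |m| := by
  have h1 := Int.emod_add_mul_ediv x (2*m)
  have h2 := Int.emod_nonneg x (mul_ne_zero two_ne_zero hm)
  have h3 := Int.emod_lt_abs x (mul_ne_zero two_ne_zero hm)
  rw [abs_mul, abs_two] at h3
  set k := x / (2*m)
  set r := x % (2*m)
  by_cases hr : r ≤ |m|
  · refine ⟨-k, ?_⟩
    have : x + 2*(-k)*m = r := by linear_combination -h1
    rw [this, abs_of_nonneg h2]; exact hr
  · push Not at hr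
    rcases lt_or_gt_of_ne hm with h | h
    · refine ⟨-k+1, ?_⟩
      have : x + 2*(-k+1)*m = r + 2*m := by linear_combination -h1
      rw [this, abs_of_neg h] at *
      rw [abs_le]; constructor <;> linarith
    · refine ⟨-k-1, ?_⟩
      have : x + 2*(-k-1)*m = r - 2*m := by linear_combination -h1
      rw [this, abs_of_pos h] at *
      rw [abs_le]; constructor <;> linarith

theorem complete_vec (A B C p r : ℤ) (hc : IsCoprime p r) (hA : A*p^2+B*p*r+C*r^2 ≠ 0) :
    ∃ q s : ℤ, p*s-q*r = 1 ∧
      |2*A*p*q+B*(p*s+q*r)+2*C*r*s| ≤ |A*p^2+B*p*r+C*r^2| := by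
  obtain ⟨a, b, hab⟩ := hc
  obtain ⟨n, hn⟩ := exists_small_rep (2*A*p*(-b)+B*(p*a+(-b)*r)+2*C*r*a) _ hA
  refine ⟨-b+n*p, a+n*r, by linear_combination hab, ?_⟩
  convert hn using 2
  ring

theorem dirichlet_forms_aux (p1 q1 p2 q2 : ℝ) (hδ : 0 < |p1*q2-p2*q1|) (h12 : |p2| ≤ |p1|) :
    ∃ x y : ℤ, (x ≠ 0 ∨ y ≠ 0) ∧ |p1*x+q1*y| ≤ 2*√|p1*q2-p2*q1| ∧
      |p2*x+q2*y| ≤ 2*√|p1*q2-p2*q1| := by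
  set δ := |p1*q2-p2*q1| with hδd
  have hs : 0 < √δ := Real.sqrt_pos.mpr hδ
  have hss : √δ*√δ = δ := Real.mul_self_sqrt hδ.le
  by_cases hp : |p1| ≤ √δ
  · exact ⟨1, 0, by simp, by simp; linarith, by simp; linarith⟩
  push Not at hp
  have hp1 : p1 ≠ 0 := by rintro rfl; simp at hp; linarith
  have hp1' : 0 < |p1| := abs_pos.mpr hp1
  set n := ⌊|p1|/√δ⌋₊ with hn
  have hn0 : 0 < n := by
    rw [hn, Nat.floor_pos, le_div_iff₀ hs]; linarith
  have hn1 : (n:ℝ) ≤ |p1|/√δ := Nat.floor_le (by positivity)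
  have hn2 : |p1|/√δ < n + 1 := Nat.lt_floor_add_one _
  obtain ⟨j, k, hk0, hkn, hjk⟩ := Real.exists_int_int_abs_mul_sub_le (q1/p1) hn0
  have b1 : |p1*(-j:ℤ)+q1*k| ≤ √δ := by
    have : p1*(-j:ℤ)+q1*k = p1*(k*(q1/p1)-j) := by push_cast; field_simp; ring
    rw [this, abs_mul]
    calc |p1| * |k*(q1/p1)-j| ≤ |p1| * (1/(n+1)) := by gcongr
      _ = |p1|/(n+1) := by ring
      _ ≤ √δ := by
        rw [div_le_iff₀ (by positivity)]
        rw [div_lt_iff₀ hs] at hn2; linarith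
  refine ⟨-j, k, Or.inr hk0.ne', by linarith, ?_⟩
  have e : p2*(-j:ℤ)+q2*k = (p2/p1)*(p1*(-j:ℤ)+q1*k) + k*((p1*q2-p2*q1)/p1) := by field_simp; ring
  rw [e]
  refine (abs_add_le _ _).trans ?_
  have b2 : |(p2/p1)*(p1*(-j:ℤ)+q1*k)| ≤ 1 * √δ := by
    rw [abs_mul, abs_div]
    gcongr
    rw [div_le_one hp1']; exact h12
  have b3 : |k*((p1*q2-p2*q1)/p1)| ≤ √δ := by
    rw [abs_mul, abs_div, ← hδd]
    have hk : |(k:ℝ)| ≤ |p1|/√δ := by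
      rw [abs_of_pos (by exact_mod_cast hk0)]
      refine le_trans ?_ hn1
      exact_mod_cast hkn
    calc |(k:ℝ)| * (δ/|p1|) ≤ (|p1|/√δ) * (δ/|p1|) := by gcongr
      _ = √δ := by field_simp; linarith [hss, sq (√δ)]
  linarith

theorem dirichlet_forms (p1 q1 p2 q2 : ℝ) (hδ : 0 < |p1*q2-p2*q1|) :
    ∃ x y : ℤ, IsCoprime x y ∧ |p1*x+q1*y| ≤ 2*√|p1*q2-p2*q1| ∧
      |p2*x+q2*y| ≤ 2*√|p1*q2-p2*q1| := by
  have main : ∃ x y : ℤ, (x ≠ 0 ∨ y ≠ 0) ∧ |p1*x+q1*y| ≤ 2*√|p1*q2-p2*q1| ∧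
      |p2*x+q2*y| ≤ 2*√|p1*q2-p2*q1| := by
    rcases le_total |p2| |p1| with h | h
    · exact dirichlet_forms_aux _ _ _ _ hδ h
    · have e : |p2*q1-p1*q2| = |p1*q2-p2*q1| := abs_sub_comm _ _
      obtain ⟨x, y, h0, h1, h2⟩ := dirichlet_forms_aux p2 q2 p1 q1 (by rw [e]; exact hδ) h
      rw [e] at h1 h2
      exact ⟨x, y, h0, h2, h1⟩
  obtain ⟨x, y, h0, h1, h2⟩ := main
  have hg : 0 < Int.gcd x y := by
    rw [Nat.pos_iff_ne_zero]; intro h; rw [Int.gcd_eq_zero_iff] at h; tauto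
  obtain ⟨x', y', hc, hx, hy⟩ := Int.exists_gcd_one hg
  have hg1 : (1:ℝ) ≤ |(Int.gcd x y : ℝ)| := by
    rw [abs_of_nonneg (by positivity)]; exact_mod_cast hg
  have red : ∀ p q R : ℝ, |p*x+q*y| ≤ R → |p*x'+q*y'| ≤ R := by
    intro p q R h
    have : p*x+q*y = (Int.gcd x y : ℝ)*(p*x'+q*y') := by
      have hx' : (x:ℝ) = x' * (Int.gcd x y : ℝ) := by exact_mod_cast hx
      have hy' : (y:ℝ) = y' * (Int.gcd x y : ℝ) := by exact_mod_cast hy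
      calc p*x+q*y = p*(x' * (Int.gcd x y : ℝ)) + q*(y' * (Int.gcd x y : ℝ)) := by rw [← hx', ← hy']
        _ = _ := by ring
    rw [this, abs_mul] at h
    nlinarith [abs_nonneg (p*x'+q*y')]
  exact ⟨x', y', Int.isCoprime_iff_gcd_eq_one.mpr hc, red _ _ _ h1, red _ _ _ h2⟩

namespace BQF

theorem aux_t1 (A W M : ℝ) (h : W^4*(768*A^4) = M) (hM : 1 ≤ M) : 16*A^2*W^2 ≤ M := by
  apply le_of_sq_le_sq _ (by linarith)
  have e : (16*A^2*W^2)^2 = 256*(W^4*A^4) := by ring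
  have e2 : 3*(256*(W^4*A^4)) = M := by rw [← h]; ring
  have e3 : M ≤ M^2 := by rw [sq]; exact le_mul_of_one_le_left (by linarith) hM
  rw [e]; linarith

theorem aux_t2 (U a b : ℤ) (h1 : 1 ≤ a) (h2 : 1 ≤ b) (h3 : 2*U ≤ a+b) : U ≤ a*b := by
  nlinarith [mul_nonneg (sub_nonneg.2 h1) (sub_nonneg.2 h2)]

set_option maxHeartbeats 1000000 in
theorem reduce_nonsq {f : BQF} {φ A B C D : ℤ} (h : f.Rel φ A B C) (hA : A ≠ 0)
    (hD : D = B^2-4*A*C) (hD0 : 0 < D) (hns : ¬ IsSquare D) (hM : 4*f.I-φ^2 ≠ 0) :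
    ∃ p r : ℤ, IsCoprime p r ∧ A*p^2+B*p*r+C*r^2 ≠ 0 ∧ (A*p^2+B*p*r+C*r^2)^2 ≤ 16*D ∧
      |2*D*(f.evalZ p r) - φ*(A*p^2+B*p*r+C*r^2)^2| ≤ 256*D^2*|4*f.I-φ^2| := by
  have hnorm := h.norm hA
  rw [← hD] at hnorm
  obtain ⟨h1, h2, h3⟩ := h
  set s : ℝ := √(D:ℝ) with hs
  have hDr : (0:ℝ) < D := by exact_mod_cast hD0
  have hs0 : 0 < s := Real.sqrt_pos.mpr hDr
  have hs2 : s^2 = D := Real.sq_sqrt hDr.le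
  have hAr : (A:ℝ) ≠ 0 := by exact_mod_cast hA
  have hDR : (D:ℝ) = B^2-4*A*C := by exact_mod_cast hD
  obtain ⟨u, hu⟩ : ∃ u : ℝ, u = 2*s^2*f.a-φ*A^2 := ⟨_, rfl⟩
  obtain ⟨v, hv⟩ : ∃ v : ℝ, v = 2*B*f.a-A*f.b := ⟨_, rfl⟩
  obtain ⟨M, hMd⟩ : ∃ M : ℝ, M = |((4*f.I-φ^2 : ℤ) : ℝ)| := ⟨_, rfl⟩
  have hM1 : 1 ≤ M := by rw [hMd]; exact_mod_cast Int.one_le_abs hM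
  have hnr : 3*((u+s*v)*(u-s*v)) = A^4*((4*f.I-φ^2 : ℤ) : ℝ) := by
    have : (u+s*v)*(u-s*v) = u^2 - s^2*v^2 := by ring
    rw [this, hu, hv, hs2]
    exact_mod_cast hnorm
  have hnr' : 3*(|u+s*v| * |u-s*v|) = A^4*M := by
    have := congrArg abs hnr
    rw [abs_mul, abs_mul, abs_mul, ← hMd] at this
    rw [abs_of_pos (by norm_num : (0:ℝ) < 3), abs_of_nonneg (by positivity : (0:ℝ) ≤ (A:ℝ)^4)] at this
    exact this
  have hA4 : 0 < (A:ℝ)^4 := by positivity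
  have hne : |u+s*v| * |u-s*v| ≠ 0 := by
    intro h0; rw [h0] at hnr'
    have : 0 < (A:ℝ)^4*M := by positivity
    linarith
  have hp1 : 0 < |u+s*v| := lt_of_le_of_ne (abs_nonneg _) (Ne.symm (left_ne_zero_of_mul hne))
  have hp2 : 0 < |u-s*v| := lt_of_le_of_ne (abs_nonneg _) (Ne.symm (right_ne_zero_of_mul hne))
  have root : ∀ t : ℝ, 0 < t → ∃ w : ℝ, 0 < w ∧ w^4 = t := by
    intro t ht
    refine ⟨√√t, by positivity, ?_⟩
    rw [show (4:ℕ) = 2*2 by norm_num, pow_mul, Real.sq_sqrt (by positivity), Real.sq_sqrt ht.le]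
  obtain ⟨w1, hw1, hw1'⟩ := root (|u+s*v|/(16*A^4)) (by positivity)
  obtain ⟨w2, hw2, hw2'⟩ := root (|u-s*v|/(16*A^4)) (by positivity)
  have hww : (w1*w2)^4*(768*A^4) = M := by
    rw [mul_pow, hw1', hw2']
    field_simp
    linarith
  have hdet : |(w1*(2*A))*(w2*(B+s)) - (w2*(2*A))*(w1*(B-s))| = 4*|(A:ℝ)| *s*(w1*w2) := by
    have : (w1*(2*A))*(w2*(B+s)) - (w2*(2*A))*(w1*(B-s)) = (4*s*(w1*w2))*A := by ring
    rw [this, abs_mul, abs_of_pos (by positivity : 0 < 4*s*(w1*w2))]; ring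
  have hAabs : 0 < |(A:ℝ)| := abs_pos.mpr hAr
  obtain ⟨x, y, hc, b1, b2⟩ := dirichlet_forms (w1*(2*A)) (w1*(B-s)) (w2*(2*A)) (w2*(B+s)) (by
    rw [hdet]; positivity)
  rw [hdet] at b1 b2
  obtain ⟨δ, hδ⟩ : ∃ δ : ℝ, δ = 4*|(A:ℝ)| *s*(w1*w2) := ⟨_, rfl⟩
  have hδ0 : 0 < δ := by rw [hδ]; positivity
  rw [← hδ] at b1 b2
  have hsδ : √δ^2 = δ := Real.sq_sqrt hδ0.le
  have e1 : w1*(2*A)*x+w1*(B-s)*y = w1*(2*A*x+(B-s)*y) := by ring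
  have e2 : w2*(2*A)*x+w2*(B+s)*y = w2*(2*A*x+(B+s)*y) := by ring
  rw [e1] at b1; rw [e2] at b2
  obtain ⟨V, hV1, hV2⟩ := fourth_field (K := ℝ) (a := f.a) (b := f.b) (c := f.c) (d := f.d) (e := f.e) (A := A)
    (B := B) (C := C) (f := φ) (s := s) (x := x) (y := y) hAr (by rw [hs2, hDR]) (by exact_mod_cast h1)
    (by exact_mod_cast h2) (by exact_mod_cast h3)
  rw [← hu, ← hv] at hV1 hV2
  obtain ⟨U, hU⟩ : ∃ U : ℝ, U = 2*s^2*(f.a*x^4+f.b*x^3*y+f.c*x^2*y^2+f.d*x*y^3+f.e*y^4)-φ*(A*x^2+B*x*y+C*y^2)^2 := ⟨_, rfl⟩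
  rw [← hU] at hV1 hV2
  have c1 : |U+s*V| ≤ 16*δ^2 := by
    have : |U+s*V| = (|w1*(2*A*x+(B-s)*y)|)^4 := by
      rw [abs_mul, mul_pow, abs_of_pos hw1, hw1', div_mul_eq_mul_div, eq_div_iff (by positivity)]
      have := congrArg abs hV1
      rw [abs_mul, abs_mul (u+s*v), abs_pow, abs_of_pos (by positivity : 0 < 16*(A:ℝ)^4)] at this
      rw [← this]; ring
    rw [this]
    calc _ ≤ (2*√δ)^4 := by gcongr
      _ = 16*(√δ^2)^2 := by ring
      _ = _ := by rw [hsδ]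
  have c2 : |U-s*V| ≤ 16*δ^2 := by
    have : |U-s*V| = (|w2*(2*A*x+(B+s)*y)|)^4 := by
      rw [abs_mul, mul_pow, abs_of_pos hw2, hw2', div_mul_eq_mul_div, eq_div_iff (by positivity)]
      have := congrArg abs hV2
      rw [abs_mul, abs_mul (u-s*v), abs_pow, abs_of_pos (by positivity : 0 < 16*(A:ℝ)^4)] at this
      rw [← this]; ring
    rw [this]
    calc _ ≤ (2*√δ)^4 := by gcongr
      _ = 16*(√δ^2)^2 := by ring
      _ = _ := by rw [hsδ]
  have c3 : |U| ≤ 16*δ^2 := by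
    rw [abs_le] at c1 c2 ⊢
    constructor <;> linarith [c1.1, c1.2, c2.1, c2.2]
  have hδ2 : δ^2 ≤ D*M := by
    have t1 : 16*A^2*(w1*w2)^2 ≤ M := by
      exact aux_t1 _ _ _ hww hM1
    have : δ^2 = D*(16*A^2*(w1*w2)^2) := by
      rw [hδ, ← hs2]
      have := sq_abs (A:ℝ)
      linear_combination 16*s^2*(w1*w2)^2*this
    rw [this]; gcongr
  have hQ : |(A*x^2+B*x*y+C*y^2 : ℝ)| ≤ 4*s := by
    have e3 : w1*(2*A*x+(B-s)*y) * (w2*(2*A*x+(B+s)*y)) = (4*(w1*w2))*(A*(A*x^2+B*x*y+C*y^2)) := by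
      linear_combination -w1*w2*y^2*(hs2.trans hDR)
    have e4 : |w1*(2*A*x+(B-s)*y) * (w2*(2*A*x+(B+s)*y))| ≤ (2*√δ)*(2*√δ) := by
      rw [abs_mul]; gcongr
    rw [e3, abs_mul, abs_mul (A:ℝ), abs_of_pos (by positivity : 0 < 4*(w1*w2))] at e4
    have e5 : (2*√δ)*(2*√δ) = (4*(w1*w2))*(|(A:ℝ)| * (4*s)) := by
      have : (2*√δ)*(2*√δ) = 4*√δ^2 := by ring
      rw [this, hsδ, hδ]; ring
    rw [e5] at e4
    exact le_of_mul_le_mul_left (le_of_mul_le_mul_left e4 (by positivity)) hAabs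
  refine ⟨x, y, hc, ?_, ?_, ?_⟩
  · intro h0
    have e : (2*A*x+B*y)^2 = D*y^2 := by rw [hD]; linear_combination 4*A*h0
    have hy : y ≠ 0 := by
      rintro rfl
      simp at e
      rcases e with e | e
      · exact hA e
      · rw [e, isCoprime_zero_left] at hc; exact not_isUnit_zero hc
    apply hns
    obtain ⟨k, hk⟩ : y ∣ 2*A*x+B*y := by
      rw [← Int.pow_dvd_pow_iff (n := 2) two_ne_zero]
      exact ⟨D, by rw [e]; ring⟩
    rw [hk] at e
    refine ⟨k, ?_⟩
    apply mul_left_cancel₀ (pow_ne_zero 2 hy)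
    linear_combination -e
  · have : (A*x^2+B*x*y+C*y^2 : ℝ)^2 ≤ 16*D := by
      rw [← sq_abs, ← hs2]
      calc _ ≤ (4*s)^2 := by gcongr
        _ = _ := by ring
    exact_mod_cast this
  · have : |U| ≤ 256*D^2*M := by
      have d1 : (1:ℝ) ≤ D := by exact_mod_cast hD0
      have d2 : (D:ℝ)*M ≤ D*(D*M) := le_mul_of_one_le_left (by positivity) d1
      have d3 : (256:ℝ)*D^2*M = 256*(D*(D*M)) := by ring
      have d4 : 0 ≤ (D:ℝ)*M := by positivity
      rw [d3]; linarith
    rw [hU, hMd, hs2] at this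
    simp only [evalZ]
    exact_mod_cast this

set_option maxHeartbeats 1000000 in
theorem reduce_other {f : BQF} {φ A B C D : ℤ} (h : f.Rel φ A B C) (hA : A ≠ 0)
    (hD : D = B^2-4*A*C) (hD0 : D ≠ 0) (hns : D < 0 ∨ IsSquare D) (hM : 4*f.I-φ^2 ≠ 0) :
    ∃ p r : ℤ, IsCoprime p r ∧ A*p^2+B*p*r+C*r^2 ≠ 0 ∧ (A*p^2+B*p*r+C*r^2)^2 ≤ 16*|D| ∧
      |2*D*(f.evalZ p r) - φ*(A*p^2+B*p*r+C*r^2)^2| ≤ 256*D^2*|4*f.I-φ^2| := by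
  classical
  have hex : ∃ n : ℕ, ∃ p r : ℤ, IsCoprime p r ∧ A*p^2+B*p*r+C*r^2 ≠ 0 ∧
      (A*p^2+B*p*r+C*r^2).natAbs = n := ⟨_, 1, 0, isCoprime_one_left, by simpa using hA, rfl⟩
  obtain ⟨p, r, hc, hne, hn⟩ := Nat.find_spec hex
  have hmin : ∀ p' r' : ℤ, IsCoprime p' r' → A*p'^2+B*p'*r'+C*r'^2 ≠ 0 →
      |A*p^2+B*p*r+C*r^2| ≤ |A*p'^2+B*p'*r'+C*r'^2| := by
    intro p' r' hc' hne'
    have := Nat.find_min' hex ⟨p', r', hc', hne', rfl⟩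
    rw [← hn] at this
    rw [Int.abs_eq_natAbs, Int.abs_eq_natAbs]
    exact_mod_cast this
  obtain ⟨q, s, hdet, hB⟩ := complete_vec A B C p r hc hne
  have hdisc := disc_sub A B C p q r s hdet
  have hrel := h.sub p q r s hdet
  have hnorm := hrel.norm hne
  rw [sub_I, hdet, one_pow, one_mul, hdisc, ← hD] at hnorm
  have ha' : (f.sub p q r s).a = f.evalZ p r := by simp only [sub, evalZ]
  rw [ha'] at hnorm
  have hCq := hmin q s ⟨-r, p, by linear_combination hdet⟩
  have hplus := hmin (p+q) (r+s) ⟨s, -q, by linear_combination hdet⟩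
  have hminus := hmin (p-q) (r-s) ⟨s, -q, by linear_combination hdet⟩
  rw [← hD] at hdisc
  set A' := A*p^2+B*p*r+C*r^2 with hA'
  set B' := 2*A*p*q+B*(p*s+q*r)+2*C*r*s with hB'
  set C' := A*q^2+B*q*s+C*s^2 with hC'
  have ep : A*(p+q)^2+B*(p+q)*(r+s)+C*(r+s)^2 = A'+B'+C' := by rw [hA', hB', hC']; ring
  have em : A*(p-q)^2+B*(p-q)*(r-s)+C*(r-s)^2 = A'-B'+C' := by rw [hA', hB', hC']; ring
  rw [ep] at hplus
  rw [em] at hminus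
  clear_value A' B' C'
  have hA2 : A'^2 ≤ |D| := by
    by_cases hC0 : C' = 0
    · rw [hC0] at hplus hminus hdisc
      have hB0 : B' ≠ 0 := by rintro h0; apply hD0; rw [← hdisc, h0]; ring
      have hab : |A'| ≤ |B'| := by
        by_contra hlt
        push Not at hlt
        have hBp : 0 < |B'| := abs_pos.mpr hB0
        rcases abs_cases A' with ⟨ha, _⟩ | ⟨ha, _⟩ <;> rcases abs_cases B' with ⟨hb, _⟩ | ⟨hb, _⟩
        · have := hminus (by intro h0; omega)
          rcases abs_cases (A'-B'+0) with ⟨hd, _⟩ | ⟨hd, _⟩ <;> omega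
        · have := hplus (by intro h0; omega)
          rcases abs_cases (A'+B'+0) with ⟨hd, _⟩ | ⟨hd, _⟩ <;> omega
        · have := hplus (by intro h0; omega)
          rcases abs_cases (A'+B'+0) with ⟨hd, _⟩ | ⟨hd, _⟩ <;> omega
        · have := hminus (by intro h0; omega)
          rcases abs_cases (A'-B'+0) with ⟨hd, _⟩ | ⟨hd, _⟩ <;> omega
      have : A'^2 ≤ B'^2 := sq_le_sq.mpr hab
      calc A'^2 ≤ B'^2 := this
        _ = D := by rw [← hdisc]; ring
        _ ≤ |D| := le_abs_self _
    · have hAC := hCq hC0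
      have e1 : 4*(|A'| * |C'|) = |B'^2 - D| := by
        rw [← hdisc, ← abs_mul]
        have : B'^2-(B'^2-4*A'*C') = 4*(A'*C') := by ring
        rw [this, abs_mul 4]; rfl
      have e2 : |B'^2-D| ≤ B'^2 + |D| := by
        refine (abs_sub _ _).trans ?_
        rw [abs_of_nonneg (sq_nonneg B')]
      have e3 : B'^2 ≤ A'^2 := sq_le_sq.mpr hB
      have e4 : A'^2 ≤ |A'| * |C'| := by
        rw [← sq_abs, sq]; gcongr
      nlinarith [sq_nonneg A']
  refine ⟨p, r, hc, hA' ▸ hne, ?_, ?_⟩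
  · rw [← hA']; linarith [abs_nonneg D]
  rw [← hA']
  generalize 2*D*(f.evalZ p r) - φ*A'^2 = u at *
  generalize 2*B'*(f.evalZ p r) - A'*(f.sub p q r s).b = v at *
  have hA4 : A'^4 ≤ D^2 := by
    have : (A'^2)^2 ≤ |D|^2 := by gcongr
    rw [sq_abs] at this; linarith [show (A'^2)^2 = A'^4 by ring]
  have hN : |u^2-D*v^2| ≤ 256*D^2*|4*f.I-φ^2| := by
    have := congrArg abs hnorm
    rw [abs_mul, abs_mul, abs_of_nonneg (by positivity : 0 ≤ A'^4)] at this
    have h3 : |(3:ℤ)| = 3 := rfl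
    rw [h3] at this
    have h4 : A'^4*|4*f.I-φ^2| ≤ D^2*|4*f.I-φ^2| := by gcongr
    nlinarith [abs_nonneg (u^2-D*v^2), show 0 ≤ D^2*|4*f.I-φ^2| by positivity]
  have hN0 : u^2-D*v^2 ≠ 0 := by
    intro h0
    rw [h0] at hnorm
    exact mul_ne_zero (pow_ne_zero 4 hne) hM (by linarith)
  refine le_trans ?_ hN
  rcases hns with hneg | ⟨t, ht⟩
  · have : |u| ≤ u^2 := by
      rw [← sq_abs]
      rcases eq_or_ne u 0 with h0 | h0
      · rw [h0]; simp
      · nlinarith [Int.one_le_abs h0]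
    refine le_trans ?_ (le_abs_self _)
    nlinarith [sq_nonneg v]
  · have e : u^2-D*v^2 = (u-t*v)*(u+t*v) := by rw [ht]; ring
    rw [e] at hN0 ⊢
    rw [abs_mul]
    have n1 := Int.one_le_abs (left_ne_zero_of_mul hN0)
    have n2 := Int.one_le_abs (right_ne_zero_of_mul hN0)
    have n3 : 2*|u| ≤ |u-t*v| + |u+t*v| := by
      have := abs_add_le (u-t*v) (u+t*v)
      have h2 : u-t*v+(u+t*v) = 2*u := by ring
      rw [h2, abs_mul] at this
      exact this
    exact aux_t2 _ _ _ n1 n2 n3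

end BQF

theorem linear_le_two_rpow (ε : ℝ) (hε : 0 < ε) : ∃ C : ℝ, 1 ≤ C ∧ ∀ k : ℕ, (k + 1 : ℝ) ≤ C * (2:ℝ) ^ (k * ε) := by
  have hl : 0 < Real.log 2 := Real.log_pos (by norm_num)
  refine ⟨1 + 1 / (ε * Real.log 2), ?_, ?_⟩
  · have : 0 < 1 / (ε * Real.log 2) := by positivity
    linarith
  · intro k
    have h1 : 1 + k * ε * Real.log 2 ≤ (2:ℝ) ^ (k * ε) := by
      rw [Real.rpow_def_of_pos (by norm_num)]
      have := Real.add_one_le_exp (Real.log 2 * (k * ε))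
      linarith
    have h2 : (0:ℝ) < 1 + 1 / (ε * Real.log 2) := by positivity
    calc (k + 1 : ℝ) ≤ (1 + 1 / (ε * Real.log 2)) * (1 + k * ε * Real.log 2) := by
          have : (1 + 1 / (ε * Real.log 2)) * (1 + k * ε * Real.log 2)
            = 1 + k + 1 / (ε * Real.log 2) + k * ε * Real.log 2 := by field_simp; ring
          rw [this]
          have : 0 < 1 / (ε * Real.log 2) := by positivity
          have : 0 ≤ k * ε * Real.log 2 := by positivity
          linarith
      _ ≤ _ := by gcongr

theorem divisor_bound (ε : ℝ) (hε : 0 < ε) : ∃ K : ℝ, 1 ≤ K ∧ ∀ n : ℕ, n ≠ 0 →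
    (n.divisors.card : ℝ) ≤ K * (n : ℝ) ^ ε := by
  obtain ⟨C, hC1, hC⟩ := linear_le_two_rpow ε hε
  obtain ⟨P, hP⟩ := exists_nat_gt ((2:ℝ) ^ (1/ε))
  refine ⟨C ^ P, one_le_pow₀ hC1, ?_⟩
  intro n hn
  rw [Nat.card_divisors hn]
  have hfac : (n : ℝ) ^ ε = ∏ p ∈ n.primeFactors, ((p : ℝ) ^ (n.factorization p * ε)) := by
    conv_lhs => rw [← Nat.prod_factorization_pow_eq_self hn]
    rw [Finsupp.prod, Nat.support_factorization]
    push_cast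
    rw [← Real.finsetProd_rpow _ _ (fun i _ => by positivity)]
    refine Finset.prod_congr rfl fun p _ => ?_
    rw [Real.rpow_mul (by positivity), Real.rpow_natCast]
  rw [hfac]
  push_cast
  have key : ∀ p ∈ n.primeFactors, ((n.factorization p : ℝ) + 1) ≤
      (if p < P then C else 1) * (p : ℝ) ^ (n.factorization p * ε) := by
    intro p hp
    have hp2 : 2 ≤ p := (Nat.prime_of_mem_primeFactors hp).two_le
    have hp2' : (2:ℝ) ≤ p := by exact_mod_cast hp2
    split_ifs with h
    · refine (hC _).trans ?_
      gcongr
    · push Not at h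
      have h' : (2:ℝ) ^ (1/ε) ≤ p := hP.le.trans (by exact_mod_cast h)
      have h2 : (2:ℝ) ≤ (p:ℝ) ^ ε := by
        calc (2:ℝ) = ((2:ℝ) ^ (1/ε)) ^ ε := by
              rw [← Real.rpow_mul (by norm_num)]; field_simp; simp
          _ ≤ _ := by gcongr
      rw [mul_comm _ ε, Real.rpow_mul (by positivity), Real.rpow_natCast, one_mul]
      calc ((n.factorization p : ℝ) + 1) ≤ (2:ℝ)^(n.factorization p) := by
            exact_mod_cast Nat.lt_two_pow_self
        _ ≤ _ := by gcongr
  refine (Finset.prod_le_prod (fun _ _ => by positivity) key).trans ?_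
  rw [Finset.prod_mul_distrib]
  refine mul_le_mul_of_nonneg_right ?_ (by positivity)
  rw [Finset.prod_ite]
  simp only [Finset.prod_const, one_pow, mul_one]
  refine pow_le_pow_right₀ hC1 ?_
  calc _ ≤ (Finset.range P).card := Finset.card_le_card (by
        intro p hp; simp at hp ⊢; exact hp.2)
    _ = P := by simp

/-- spacing of Pell solutions -/
theorem pell_spacing {D x y x' y' : ℤ} (hD : 1 ≤ D) (hx : 0 < x) (hx' : 0 < x') (hy : 0 < y)
    (h : x^2-D*y^2 = 4) (h' : x'^2-D*y'^2=4) (hlt : y < y') : 2*y^4 ≤ y'^4 := by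
  have h0 : 0 < y' := hy.trans hlt
  have e1 : (x*y')^2 - (x'*y)^2 = 4*(y'^2-y^2) := by linear_combination y'^2*h - y^2*h'
  have e2 : x'*y < x*y' := by
    apply lt_of_pow_lt_pow_left₀ 2 (by positivity)
    nlinarith
  have e3 : (x'*y+1)^2 ≤ (x*y')^2 := by
    apply pow_le_pow_left₀ (by positivity); omega
  have e4 : y' ≤ x' := by
    apply le_of_sq_le_sq _ hx'.le
    nlinarith [sq_nonneg y']
  have e5 : y'*y ≤ x'*y := by nlinarith
  have e6 : y*y ≤ y'*y := by nlinarith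
  have e7 : 3*y^2 ≤ 2*y'^2 := by nlinarith
  have : (3*y^2)*(3*y^2) ≤ (2*y'^2)*(2*y'^2) := by
    apply mul_le_mul e7 e7 <;> positivity
  nlinarith [sq_nonneg (y^2)]

theorem pell_pos_count {D : ℤ} (hD : 1 ≤ D) (Y : ℕ) (S : Finset (ℤ × ℤ))
    (hS : ∀ z ∈ S, z.1^2-D*z.2^2 = 4 ∧ 0 < z.1 ∧ 0 < z.2 ∧ z.2 ≤ Y) :
    S.card ≤ Nat.log 2 (Y^4) + 1 := by
  have : S.card ≤ (Finset.range (Nat.log 2 (Y^4) + 1)).card := by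
    apply Finset.card_le_card_of_injOn (fun z => Nat.log 2 (z.2.natAbs^4))
    · intro z hz
      obtain ⟨_, _, h3, h4⟩ := hS z hz
      simp only [Finset.coe_range, Set.mem_Iio]
      apply Nat.lt_succ_of_le
      apply Nat.log_mono_right
      apply Nat.pow_le_pow_left; omega
    · have key : ∀ z ∈ S, ∀ w ∈ S, z.2 < w.2 → Nat.log 2 (z.2.natAbs^4) < Nat.log 2 (w.2.natAbs^4) := by
        intro z hz w hw hlt
        obtain ⟨a1, a2, a3, a4⟩ := hS z hz
        obtain ⟨b1, b2, b3, b4⟩ := hS w hw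
        have h := pell_spacing hD a2 b2 a3 a1 b1 hlt
        have h' : 2 * z.2.natAbs^4 ≤ w.2.natAbs^4 := by
          zify; simpa [abs_of_pos a3, abs_of_pos b3] using h
        have hz0 : z.2.natAbs^4 ≠ 0 := by positivity
        have : Nat.log 2 (z.2.natAbs^4 * 2) = Nat.log 2 (z.2.natAbs^4) + 1 :=
          Nat.log_mul_base (by norm_num) hz0
        have h3 := Nat.log_mono_right (b := 2) h'
        rw [mul_comm] at h3
        omega
      intro z hz w hw heq
      simp only at heq
      have hy : z.2 = w.2 := by
        rcases lt_trichotomy z.2 w.2 with h | h | h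
        · have := key z hz w hw h; omega
        · exact h
        · have := key w hw z hz h; omega
      obtain ⟨a1, a2, a3, a4⟩ := hS z hz
      obtain ⟨b1, b2, b3, b4⟩ := hS w hw
      have hx : z.1 = w.1 := by
        rw [hy] at a1
        have : z.1^2 = w.1^2 := by linarith
        exact (pow_left_inj₀ a2.le b2.le two_ne_zero).mp this
      exact Prod.ext hx hy
  simpa using this

theorem pell_count {D : ℤ} (hD : D ≠ 0) (Y : ℕ) (S : Finset (ℤ × ℤ))
    (hS : ∀ z ∈ S, z.1^2-D*z.2^2 = 4 ∧ |z.2| ≤ Y) :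
    S.card ≤ 25 * (Nat.log 2 (Y^4) + 1) := by
  rcases lt_or_gt_of_ne hD with h | h
  · have : S ⊆ (Finset.Icc (-2) 2) ×ˢ (Finset.Icc (-2) 2) := by
      intro z hz
      obtain ⟨h1, _⟩ := hS z hz
      have a1 : z.1^2 ≤ 2^2 := by nlinarith [sq_nonneg z.2]
      have a2 : z.2^2 ≤ 2^2 := by nlinarith [sq_nonneg z.2, sq_nonneg z.1]
      have b1 := abs_le_of_sq_le_sq' a1 (by norm_num)
      have b2 := abs_le_of_sq_le_sq' a2 (by norm_num)
      simp [Finset.mem_product]; exact ⟨b1, b2⟩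
    have := Finset.card_le_card this
    have h25 : ((Finset.Icc (-2:ℤ) 2) ×ˢ (Finset.Icc (-2:ℤ) 2)).card = 25 := by decide
    rw [h25] at this
    nlinarith [Nat.zero_le (Nat.log 2 (Y^4))]
  · -- split by signs
    have hD1 : 1 ≤ D := h
    have sgn0 : ∀ t : ℤ, ((SignType.sign t : SignType) : ℤ) = 0 → t = 0 := by
      intro t ht
      rcases lt_trichotomy t 0 with h | h | h
      · rw [sign_neg h] at ht; simp at ht
      · exact h
      · rw [sign_pos h] at ht; simp at ht
    let g : ℤ × ℤ → ℤ × ℤ := fun z => (SignType.sign z.1, SignType.sign z.2)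
    have hx0 : ∀ z ∈ S, z.1 ≠ 0 := by
      intro z hz h0
      obtain ⟨h1, _⟩ := hS z hz
      rw [h0] at h1; nlinarith [sq_nonneg z.2]
    have hmap : ∀ z ∈ S, g z ∈ (Finset.Icc (-1:ℤ) 1) ×ˢ (Finset.Icc (-1:ℤ) 1) := by
      intro z hz
      simp only [g, Finset.mem_product, Finset.mem_Icc]
      rcases SignType.sign z.1 with _ | _ | _ <;> rcases SignType.sign z.2 with _ | _ | _ <;> decide
    have hfib : ∀ c ∈ (Finset.Icc (-1:ℤ) 1) ×ˢ (Finset.Icc (-1:ℤ) 1),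
        (S.filter (fun z => g z = c)).card ≤ Nat.log 2 (Y^4) + 1 := by
      intro c hc
      by_cases hc0 : c.2 = 0
      · -- y = 0
        refine le_trans (Finset.card_le_one.mpr ?_) (by omega)
        intro z hz w hw
        rw [Finset.mem_filter] at hz hw
        have hz2 : z.2 = 0 := by
          have := congrArg Prod.snd hz.2
          exact sgn0 _ (by simpa [g, hc0] using this)
        have hw2 : w.2 = 0 := by
          have := congrArg Prod.snd hw.2
          exact sgn0 _ (by simpa [g, hc0] using this)
        have e1 := (hS z hz.1).1
        have e2 := (hS w hw.1).1
        rw [hz2] at e1; rw [hw2] at e2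
        have hs : z.1 = w.1 ∨ z.1 = -w.1 := sq_eq_sq_iff_eq_or_eq_neg.mp (by linarith)
        rcases hs with hs | hs
        · exact Prod.ext hs (by rw [hz2, hw2])
        · exfalso
          have hh := congrArg Prod.fst (hz.2.trans hw.2.symm)
          simp only [g, hs] at hh
          rcases lt_or_gt_of_ne (hx0 w hw.1) with hlt | hlt
          · rw [sign_pos (by omega : 0 < -w.1), sign_neg hlt] at hh; simp at hh
          · rw [sign_neg (by omega : -w.1 < 0), sign_pos hlt] at hh; simp at hh
      · have : (S.filter (fun z => g z = c)).card =
            ((S.filter (fun z => g z = c)).image (fun z => (|z.1|, |z.2|))).card := by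
          symm
          apply Finset.card_image_of_injOn
          intro z hz w hw heq
          simp only [Finset.coe_filter, Set.mem_ofPred_eq] at hz hw
          have hh := hz.2.trans hw.2.symm
          simp only [Prod.mk.injEq, g] at heq hh
          have s1 : SignType.sign z.1 = SignType.sign w.1 := by
            have := hh.1; revert this
            rcases SignType.sign z.1 with _ | _ | _ <;> rcases SignType.sign w.1 with _ | _ | _ <;> decide
          have s2 : SignType.sign z.2 = SignType.sign w.2 := by
            have := hh.2; revert this
            rcases SignType.sign z.2 with _ | _ | _ <;> rcases SignType.sign w.2 with _ | _ | _ <;> decide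
          refine Prod.ext ?_ ?_
          · rw [← sign_mul_abs z.1, ← sign_mul_abs w.1, s1, heq.1]
          · rw [← sign_mul_abs z.2, ← sign_mul_abs w.2, s2, heq.2]
        rw [this]
        apply pell_pos_count hD1
        intro z' hz'
        rw [Finset.mem_image] at hz'
        obtain ⟨z, hz, rfl⟩ := hz'
        rw [Finset.mem_filter] at hz
        obtain ⟨h1, h2⟩ := hS z hz.1
        refine ⟨by simpa using h1, abs_pos.mpr (hx0 z hz.1), abs_pos.mpr ?_, h2⟩
        intro h0
        apply hc0
        rw [← hz.2]; simp [g, h0]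
    have := Finset.card_le_mul_card_image_of_maps_to hmap _ hfib
    have h9 : ((Finset.Icc (-1:ℤ) 1) ×ˢ (Finset.Icc (-1:ℤ) 1)).card = 9 := by decide
    rw [h9] at this
    nlinarith [Nat.zero_le (Nat.log 2 (Y^4))]

theorem dvd_two_of_sq_dvd {G D : ℤ} (hD : Squarefree D) (h : G^2 ∣ 4*D) : G ∣ 2 := by
  rcases Int.even_or_odd G with hG | hG
  · obtain ⟨H, rfl⟩ := hG.two_dvd
    have : H*H ∣ D := by
      have h' : 4*(H*H) ∣ 4*D := by convert h using 1; ring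
      exact (mul_dvd_mul_iff_left (by norm_num)).mp h'
    have := hD H this
    exact (mul_dvd_mul_iff_left (by norm_num : (2:ℤ) ≠ 0)).mpr (this.dvd (a := 1)) |>.trans (by simp)
  · have hc : IsCoprime (G^2) 4 := by
      have : IsCoprime G 2 := by
        obtain ⟨k, hk⟩ := hG
        exact ⟨1, -k, by rw [hk]; ring⟩
      have := (this.pow (m := 2) (n := 2))
      simpa using this
    have := hc.dvd_of_dvd_mul_left h
    rw [sq] at this
    exact (hD G this).dvd

theorem prim_key {D m u v u' v' u0 v0 : ℤ} (hD : Squarefree D) (hm : m ≠ 0)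
    (hc : IsCoprime u v) (hc0 : IsCoprime u0 v0)
    (h : u^2-D*v^2 = m) (h' : u'^2-D*v'^2 = m) (h0 : u0^2-D*v0^2 = m)
    (hg : Int.gcd (u*v0-u0*v) m = Int.gcd (u'*v0-u0*v') m) : m ∣ 2*(u'*v-u*v') := by
  have cop : ∀ a b : ℤ, IsCoprime a b → a^2-D*b^2 = m → IsCoprime b m := by
    intro a b hab he
    have h1 : IsCoprime b (a^2) := hab.symm.pow_right
    have : m = a^2 + b * (-D*b) := by rw [← he]; ring
    rw [this]
    exact h1.add_mul_left_right _
  have cv := cop u v hc h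
  have cv0 := cop u0 v0 hc0 h0
  -- the factorisation m = δ e
  have fac : ∀ a b : ℤ, a^2-D*b^2 = m → ∀ e : ℤ, m = (Int.gcd (a*v0-u0*b) m : ℤ) * e →
      e ∣ a*v0+u0*b := by
    intro a b he e hme
    set δ : ℤ := (Int.gcd (a*v0-u0*b) m : ℤ) with hδ
    have hδ0 : δ ≠ 0 := by rintro h00; rw [h00] at hme; simp at hme; exact hm hme
    obtain ⟨w, hw⟩ : δ ∣ a*v0-u0*b := Int.gcd_dvd_left _ _
    have hcop : IsCoprime w e := by
      have hb := Int.gcd_eq_gcd_ab (a*v0-u0*b) m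
      rw [← hδ] at hb
      refine ⟨Int.gcdA (a*v0-u0*b) m, Int.gcdB (a*v0-u0*b) m, ?_⟩
      apply mul_left_cancel₀ hδ0
      calc δ * (Int.gcdA (a*v0-u0*b) m * w + Int.gcdB (a*v0-u0*b) m * e)
          = (δ*w) * Int.gcdA (a*v0-u0*b) m + (δ*e) * Int.gcdB (a*v0-u0*b) m := by ring
        _ = (a*v0-u0*b) * Int.gcdA (a*v0-u0*b) m + m * Int.gcdB (a*v0-u0*b) m := by rw [← hw, ← hme]
        _ = δ * 1 := by rw [← hb]; ring
    have hprod : δ * (w * (a*v0+u0*b)) = δ * (e * (v0^2-b^2)) := by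
      have : (a*v0-u0*b)*(a*v0+u0*b) = m*(v0^2-b^2) := by
        linear_combination v0^2*he - b^2*h0
      rw [hw] at this
      calc δ * (w * (a*v0+u0*b)) = δ * w * (a*v0+u0*b) := by ring
        _ = m*(v0^2-b^2) := this
        _ = (δ * e) * (v0^2-b^2) := by rw [← hme]
        _ = _ := by ring
    have := mul_left_cancel₀ hδ0 hprod
    exact hcop.symm.dvd_of_dvd_mul_left ⟨_, this⟩
  obtain ⟨e, hme⟩ : (Int.gcd (u*v0-u0*v) m : ℤ) ∣ m := Int.gcd_dvd_right _ _
  have hez := fac u v h e hme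
  have hez' := fac u' v' h' e (by rw [← hg]; exact hme)
  have hδw : (Int.gcd (u*v0-u0*v) m : ℤ) ∣ u*v0-u0*v := Int.gcd_dvd_left _ _
  have hδw' : (Int.gcd (u*v0-u0*v) m : ℤ) ∣ u'*v0-u0*v' := by rw [hg]; exact Int.gcd_dvd_left _ _
  generalize (Int.gcd (u*v0-u0*v) m : ℤ) = δ at *
  set y := u'*v-u*v' with hy
  have hδm : δ ∣ m := ⟨e, hme⟩
  have hem : e ∣ m := ⟨δ, by rw [hme]; ring⟩
  have hδy : δ ∣ y := by
    have : δ ∣ v0 * y := by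
      have : v0*y = (u'*v0-u0*v')*v - (u*v0-u0*v)*v' := by rw [hy]; ring
      rw [this]; exact dvd_sub (hδw'.mul_right _) (hδw.mul_right _)
    exact (cv0.of_isCoprime_of_dvd_right hδm).symm.dvd_of_dvd_mul_left this
  have hey : e ∣ y := by
    have : e ∣ v0 * y := by
      have : v0*y = (u'*v0+u0*v')*v - (u*v0+u0*v)*v' := by rw [hy]; ring
      rw [this]; exact dvd_sub (hez'.mul_right _) (hez.mul_right _)
    exact (cv0.of_isCoprime_of_dvd_right hem).symm.dvd_of_dvd_mul_left this
  -- the gcd of δ and e divides 2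
  have hG : gcd δ e ∣ 2 := by
    apply dvd_two_of_sq_dvd hD
    have g1 : gcd δ e ∣ δ := gcd_dvd_left _ _
    have g2 : gcd δ e ∣ e := gcd_dvd_right _ _
    generalize gcd δ e = G at *
    have hGm : G^2 ∣ m := by rw [hme, sq]; exact mul_dvd_mul g1 g2
    have hG2u : G ∣ 2*u := by
      have : G ∣ v0*(2*u) := by
        have h3 : v0*(2*u) = (u*v0-u0*v)+(u*v0+u0*v) := by ring
        rw [h3]; exact dvd_add (g1.trans hδw) (g2.trans hez)
      exact (cv0.of_isCoprime_of_dvd_right (g1.trans hδm)).symm.dvd_of_dvd_mul_left this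
    have h4 : G^2 ∣ v^2*(4*D) := by
      have h5 : v^2*(4*D) = (2*u)^2 - m*4 := by rw [← h]; ring
      rw [h5]; exact dvd_sub (pow_dvd_pow_of_dvd hG2u 2) (hGm.mul_right _)
    exact ((cv.of_isCoprime_of_dvd_right hGm).pow_left (m := 2)).symm.dvd_of_dvd_mul_left h4
  have hl : lcm δ e ∣ y := lcm_dvd hδy hey
  have h6 : m ∣ gcd δ e * lcm δ e := by
    rw [hme]; exact (gcd_mul_lcm δ e).symm.dvd
  exact h6.trans (mul_dvd_mul hG hl)

theorem prim_count {D m : ℤ} (hD : Squarefree D) (hm : m ≠ 0) (W : ℕ) (S : Finset (ℤ × ℤ))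
    (hS : ∀ z ∈ S, IsCoprime z.1 z.2 ∧ z.1^2-D*z.2^2 = m ∧ |z.1| ≤ W ∧ |z.2| ≤ W) :
    S.card ≤ 25 * (Nat.log 2 ((4*W^2)^4) + 1) * m.natAbs.divisors.card := by
  have hD0 : D ≠ 0 := hD.ne_zero
  rcases S.eq_empty_or_nonempty with rfl | ⟨z0, hz0⟩
  · simp
  obtain ⟨c0, e0, _, _⟩ := hS z0 hz0
  refine Finset.card_le_mul_card_image_of_maps_to
    (f := fun z => Int.gcd (z.1*z0.2-z0.1*z.2) m) ?_ _ ?_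
  · intro z hz
    simp only [Nat.mem_divisors]
    exact ⟨Int.natCast_dvd_natCast.mp (by
      rw [Int.dvd_natAbs]; exact Int.gcd_dvd_right _ _), by simpa using hm⟩
  · intro δ _
    set T := S.filter (fun z => Int.gcd (z.1*z0.2-z0.1*z.2) m = δ) with hT
    rcases T.eq_empty_or_nonempty with h | ⟨w, hw⟩
    · rw [h]; simp
    rw [hT, Finset.mem_filter] at hw
    obtain ⟨cw, ew, w1, w2⟩ := hS w hw.1
    have props : ∀ z ∈ T, ∃ x y : ℤ, m*x = 2*(z.1*w.1-D*z.2*w.2) ∧ m*y = 2*(w.1*z.2-z.1*w.2) ∧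
        x^2-D*y^2 = 4 ∧ |y| ≤ 4*W^2 := by
      intro z hz
      rw [hT, Finset.mem_filter] at hz
      obtain ⟨cz, ez, z1, z2⟩ := hS z hz.1
      obtain ⟨y, hy⟩ := prim_key hD hm cz c0 ez ew e0 (hz.2.trans hw.2.symm)
      have hx : m ∣ 2*(z.1*w.1-D*z.2*w.2) := by
        rw [← Int.pow_dvd_pow_iff (n := 2) two_ne_zero]
        refine ⟨4 + D*y^2, ?_⟩
        have : (2*(z.1*w.1-D*z.2*w.2))^2 = D*(2*(w.1*z.2-z.1*w.2))^2 + 4*(z.1^2-D*z.2^2)*(w.1^2-D*w.2^2) := by ring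
        rw [this, hy, ez, ew]; ring
      obtain ⟨x, hx⟩ := hx
      refine ⟨x, y, hx.symm, hy.symm, ?_, ?_⟩
      · apply mul_left_cancel₀ (pow_ne_zero 2 hm)
        have : m^2*(x^2-D*y^2) = (m*x)^2-D*(m*y)^2 := by ring
        rw [this, ← hx, ← hy]
        have : (2*(z.1*w.1-D*z.2*w.2))^2 - D*(2*(w.1*z.2-z.1*w.2))^2 = 4*(z.1^2-D*z.2^2)*(w.1^2-D*w.2^2) := by ring
        rw [this, ez, ew]; ring
      · have h1 : |y| ≤ |m*y| := by
          rw [abs_mul]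
          have : 1 ≤ |m| := Int.one_le_abs hm
          nlinarith [abs_nonneg y]
        rw [← hy] at h1
        refine h1.trans ?_
        rw [abs_mul, abs_two]
        have h2 : |w.1*z.2-z.1*w.2| ≤ |w.1| * |z.2| + |z.1| * |w.2| := by
          rw [← abs_mul, ← abs_mul]; exact abs_sub _ _
        have h3 : |w.1| * |z.2| ≤ W*W := mul_le_mul w1 z2 (abs_nonneg _) (by positivity)
        have h4 : |z.1| * |w.2| ≤ W*W := mul_le_mul z1 w2 (abs_nonneg _) (by positivity)
        nlinarith
    choose! X Y hX hY hP hB using props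
    have hcard : T.card = (T.image (fun z => (X z, Y z))).card := by
      symm
      apply Finset.card_image_of_injOn
      intro z hz z' hz' heq
      simp only [Prod.mk.injEq] at heq
      have a1 := hX z hz
      have a2 := hY z hz
      have b1 := hX z' hz'
      have b2 := hY z' hz'
      rw [← heq.1, a1] at b1
      rw [← heq.2, a2] at b2
      refine Prod.ext ?_ ?_
      · apply mul_left_cancel₀ (mul_ne_zero two_ne_zero hm)
        rw [← ew]; linear_combination w.1*b1 + D*w.2*b2
      · apply mul_left_cancel₀ (mul_ne_zero two_ne_zero hm)
        rw [← ew]; linear_combination w.2*b1 + w.1*b2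
    rw [hcard]
    apply pell_count hD0
    intro p hp
    rw [Finset.mem_image] at hp
    obtain ⟨z, hz, rfl⟩ := hp
    exact ⟨hP z hz, by push_cast; exact hB z hz⟩

theorem sqfree_count {D N : ℤ} (hD : Squarefree D) (hN : N ≠ 0) (W : ℕ) (S : Finset (ℤ × ℤ))
    (hS : ∀ z ∈ S, z.1^2-D*z.2^2 = N ∧ |z.1| ≤ W ∧ |z.2| ≤ W) :
    S.card ≤ 25 * (Nat.log 2 ((4*W^2)^4) + 1) * N.natAbs.divisors.card * N.natAbs.divisors.card := by
  refine Finset.card_le_mul_card_image_of_maps_to (f := fun z => Int.gcd z.1 z.2) ?_ _ ?_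
  · intro z hz
    obtain ⟨h1, _, _⟩ := hS z hz
    simp only [Nat.mem_divisors]
    refine ⟨Int.natCast_dvd_natCast.mp ?_, by simpa using hN⟩
    rw [Int.dvd_natAbs, ← h1]
    exact dvd_sub (dvd_pow (Int.gcd_dvd_left _ _) two_ne_zero) (dvd_mul_of_dvd_right (dvd_pow (Int.gcd_dvd_right _ _) two_ne_zero) _)
  · intro g _
    set T := S.filter (fun z => Int.gcd z.1 z.2 = g) with hT
    rcases T.eq_empty_or_nonempty with h | ⟨w, hw⟩
    · rw [h]; simp
    have props : ∀ z ∈ T, (g:ℤ) ≠ 0 ∧ ∃ x y : ℤ, z.1 = g*x ∧ z.2 = g*y ∧ IsCoprime x y := by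
      intro z hz
      rw [hT, Finset.mem_filter] at hz
      obtain ⟨e1, _, _⟩ := hS z hz.1
      have hg0 : 0 < Int.gcd z.1 z.2 := by
        rw [Nat.pos_iff_ne_zero]; intro h0
        rw [Int.gcd_eq_zero_iff] at h0
        rw [h0.1, h0.2] at e1; simp at e1; exact hN e1.symm
      obtain ⟨x, y, hc, hx, hy⟩ := Int.exists_gcd_one hg0
      rw [hz.2] at hx hy hg0
      exact ⟨by exact_mod_cast hg0.ne', x, y, by rw [hx]; ring, by rw [hy]; ring, Int.isCoprime_iff_gcd_eq_one.mpr hc⟩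
    have hg0 := (props w hw).1
    have props2 : ∀ z ∈ T, ∃ x y : ℤ, z.1 = g*x ∧ z.2 = g*y ∧ IsCoprime x y := fun z hz => (props z hz).2
    choose! X Y hX hY hc using props2
    have hgX : ∀ z ∈ T, (g:ℤ)^2*((X z)^2-D*(Y z)^2) = N := by
      intro z hz
      have h1 := hX z hz
      have h2 := hY z hz
      rw [hT, Finset.mem_filter] at hz
      obtain ⟨e1, _, _⟩ := hS z hz.1
      rw [h1, h2] at e1; linear_combination e1
    set m := (X w)^2-D*(Y w)^2 with hm
    have hmN : (g:ℤ)^2 * m = N := hgX w hw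
    have hm0 : m ≠ 0 := by rintro h0; rw [h0] at hmN; simp at hmN; exact hN hmN.symm
    have hcard : T.card = (T.image (fun z => (X z, Y z))).card := by
      symm
      apply Finset.card_image_of_injOn
      intro z hz z' hz' heq
      simp only [Prod.mk.injEq] at heq
      exact Prod.ext (by rw [hX z hz, hX z' hz', heq.1]) (by rw [hY z hz, hY z' hz', heq.2])
    rw [hcard]
    refine (prim_count hD hm0 W _ ?_).trans ?_
    · intro p hp
      rw [Finset.mem_image] at hp
      obtain ⟨z, hz, rfl⟩ := hp
      have hg1 : 1 ≤ |(g:ℤ)| := Int.one_le_abs hg0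
      have h1 := hX z hz
      have h2 := hY z hz
      have hz' := hz
      rw [hT, Finset.mem_filter] at hz'
      obtain ⟨_, e2, e3⟩ := hS z hz'.1
      refine ⟨hc z hz, ?_, ?_, ?_⟩
      · apply mul_left_cancel₀ (pow_ne_zero 2 hg0)
        rw [hgX z hz, ← hmN, hm]
      · rw [h1, abs_mul] at e2; nlinarith [abs_nonneg (X z)]
      · rw [h2, abs_mul] at e3; nlinarith [abs_nonneg (Y z)]
    · apply Nat.mul_le_mul_left
      apply Finset.card_le_card
      apply Nat.divisors_subset_of_dvd (by simpa using hN)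
      rw [Int.natAbs_dvd_natAbs, ← hmN]
      exact dvd_mul_left _ _

theorem exists_sqfree (D : ℤ) (hD : D ≠ 0) : ∃ D0 t : ℤ, Squarefree D0 ∧ D = D0 * t^2 ∧ t ≠ 0 := by
  obtain ⟨a, b, h, hsq⟩ := Nat.sq_mul_squarefree D.natAbs
  have hb : b ≠ 0 := by rintro rfl; simp at h; omega
  refine ⟨D.sign * a, b, ?_, ?_, by exact_mod_cast hb⟩
  · rw [← Int.squarefree_natAbs, Int.natAbs_mul, Int.natAbs_sign_of_ne_zero hD]
    simpa using hsq
  · conv_lhs => rw [← Int.sign_mul_natAbs D, ← h]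
    push_cast; ring

theorem rep_count_nat {D N : ℤ} (hD : D ≠ 0) (hN : N ≠ 0) (Y : ℕ) (hNY : |N| ≤ Y)
    (S : Finset (ℤ × ℤ)) (hS : ∀ z ∈ S, z.1^2-D*z.2^2 = N ∧ |z.1| ≤ Y) :
    S.card ≤ 25 * (Nat.log 2 ((4*(2*Y)^2)^4) + 1) * N.natAbs.divisors.card * N.natAbs.divisors.card := by
  obtain ⟨D0, t, hsq, rfl, ht⟩ := exists_sqfree D hD
  have hY1 : (1:ℤ) ≤ Y := (Int.one_le_abs hN).trans hNY
  have hcard : S.card = (S.image (fun z => (z.1, t*z.2))).card := by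
    symm
    apply Finset.card_image_of_injOn
    intro z hz z' hz' heq
    simp only [Prod.mk.injEq] at heq
    exact Prod.ext heq.1 (mul_left_cancel₀ ht heq.2)
  rw [hcard]
  apply sqfree_count hsq hN
  intro p hp
  rw [Finset.mem_image] at hp
  obtain ⟨z, hz, rfl⟩ := hp
  obtain ⟨e1, e2⟩ := hS z hz
  refine ⟨by linear_combination e1, by push_cast; linarith [abs_nonneg z.1], ?_⟩
  push_cast
  have h1 : 1 ≤ |D0| := Int.one_le_abs hsq.ne_zero
  have h2 : |D0| * (t*z.2)^2 ≤ (Y:ℤ)^2 + Y := by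
    have : |D0| * (t*z.2)^2 = |z.1^2 - N| := by
      rw [← abs_of_nonneg (sq_nonneg (t*z.2)), ← abs_mul]; congr 1; linear_combination -e1
    rw [this]
    refine (abs_sub _ _).trans ?_
    rw [abs_pow]
    have := pow_le_pow_left₀ (abs_nonneg _) e2 2
    linarith
  apply abs_le_of_sq_le_sq _ (by positivity)
  nlinarith [sq_nonneg (t*z.2)]

theorem rep_count (ε : ℝ) (hε : 0 < ε) : ∃ K : ℝ, 1 ≤ K ∧ ∀ D N : ℤ, D ≠ 0 → N ≠ 0 → ∀ Y : ℕ,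
    |N| ≤ Y → ∀ S : Finset (ℤ × ℤ), (∀ z ∈ S, z.1^2-D*z.2^2 = N ∧ |z.1| ≤ Y) →
    (S.card : ℝ) ≤ K * (Y:ℝ)^(10*ε) := by
  obtain ⟨C, hC1, hC⟩ := linear_le_two_rpow ε hε
  obtain ⟨K, hK1, hK⟩ := divisor_bound ε hε
  have h65 : (1:ℝ) ≤ (65536:ℝ)^ε := Real.one_le_rpow (by norm_num) hε.le
  refine ⟨25 * (C * (65536:ℝ)^ε) * K * K, ?_, ?_⟩
  · have : 1 ≤ C * (65536:ℝ)^ε := one_le_mul_of_one_le_of_one_le hC1 h65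
    have : 1 ≤ 25 * (C * (65536:ℝ)^ε) := by linarith
    exact one_le_mul_of_one_le_of_one_le (one_le_mul_of_one_le_of_one_le this hK1) hK1
  intro D N hD hN Y hNY S hS
  have h := rep_count_nat hD hN Y hNY S hS
  have hY1 : 1 ≤ Y := by exact_mod_cast (Int.one_le_abs hN).trans hNY
  have hY0 : (0:ℝ) < Y := by exact_mod_cast hY1
  have hd : (N.natAbs.divisors.card : ℝ) ≤ K * (Y:ℝ)^ε := by
    refine (hK _ (by simpa using hN)).trans ?_
    gcongr
    have h3 : ((N.natAbs : ℕ) : ℤ) ≤ Y := by rw [Int.natCast_natAbs]; exact hNY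
    exact_mod_cast h3
  have hl : ((Nat.log 2 ((4*(2*Y)^2)^4) + 1 : ℕ) : ℝ) ≤ C * (65536:ℝ)^ε * (Y:ℝ)^(8*ε) := by
    push_cast
    refine (hC _).trans ?_
    rw [mul_assoc]
    gcongr
    rw [Real.rpow_mul (by norm_num), Real.rpow_natCast, Real.rpow_mul hY0.le, ← Real.mul_rpow (by norm_num) (by positivity)]
    apply Real.rpow_le_rpow (by positivity) _ hε.le
    have h1 := Nat.pow_log_le_self 2 (x := (4*(2*Y)^2)^4) (by positivity)
    have h2 : ((2 ^ Nat.log 2 ((4*(2*Y)^2)^4) : ℕ) : ℝ) ≤ (((4*(2*Y)^2)^4 : ℕ) : ℝ) := by exact_mod_cast h1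
    push_cast at h2
    refine h2.trans (le_of_eq ?_)
    rw [show (8:ℝ) = ((8:ℕ):ℝ) by norm_num, Real.rpow_natCast]; ring
  have h' : (S.card : ℝ) ≤ 25 * ((Nat.log 2 ((4*(2*Y)^2)^4) + 1 : ℕ) : ℝ) * N.natAbs.divisors.card * N.natAbs.divisors.card := by
    exact_mod_cast h
  refine h'.trans ?_
  have e : (Y:ℝ)^(10*ε) = (Y:ℝ)^(8*ε) * (Y:ℝ)^ε * (Y:ℝ)^ε := by
    rw [← Real.rpow_add hY0, ← Real.rpow_add hY0]; congr 1; ring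
  rw [e]
  calc _ ≤ 25 * (C * (65536:ℝ)^ε * (Y:ℝ)^(8*ε)) * (K * (Y:ℝ)^ε) * (K * (Y:ℝ)^ε) := by gcongr
    _ = _ := by ring

namespace BQF

theorem sub_sub (f : BQF) (p q r s p' q' r' s' : ℤ) :
    (f.sub p q r s).sub p' q' r' s' = f.sub (p*p'+q*r') (p*q'+q*s') (r*p'+s*r') (r*q'+s*s') := by
  simp only [sub, BQF.mk.injEq]
  refine ⟨?_, ?_, ?_, ?_, ?_⟩ <;> ring

theorem phi_ne1 {I J φ : ℤ} (h : φ^3-3*I*φ+J = 0) (hd : 4*I^3-J^2 ≠ 0) : φ^2-I ≠ 0 := by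
  intro h0
  apply hd
  have hI : I = φ^2 := by linarith
  have hJ : J = 2*φ^3 := by rw [hI] at h; linear_combination h
  rw [hI, hJ]; ring

theorem phi_ne2 {I J φ : ℤ} (h : φ^3-3*I*φ+J = 0) (hd : 4*I^3-J^2 ≠ 0) : 4*I-φ^2 ≠ 0 := by
  intro h0
  apply hd
  have hJ : J = -I*φ := by linear_combination h + φ*h0
  rw [hJ]; linear_combination I^2*h0

theorem prim_sub {A B C p q r s : ℤ} (hd : p*s-q*r = 1)
    (hp : ∀ n : ℤ, n ∣ A → n ∣ B → n ∣ C → IsUnit n) :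
    ∀ n : ℤ, n ∣ A*p^2+B*p*r+C*r^2 → n ∣ 2*A*p*q+B*(p*s+q*r)+2*C*r*s →
      n ∣ A*q^2+B*q*s+C*s^2 → IsUnit n := by
  have hd2 : (p*s-q*r)^2 = 1 := by rw [hd]; rfl
  rintro n ⟨x, hx⟩ ⟨y, hy⟩ ⟨z, hz⟩
  apply hp n
  · refine ⟨x*s^2-y*s*r+z*r^2, ?_⟩
    linear_combination s^2*hx-s*r*hy+r^2*hz-A*hd2
  · refine ⟨-2*x*q*s+y*(p*s+q*r)-2*z*p*r, ?_⟩
    linear_combination -2*q*s*hx+(p*s+q*r)*hy-2*p*r*hz-B*hd2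
  · refine ⟨x*q^2-y*p*q+z*p^2, ?_⟩
    linear_combination q^2*hx-p*q*hy+p^2*hz-C*hd2

theorem exists_rel' (f : BQF) (φ : ℤ) (h : φ^3-3*f.I*φ+f.J = 0) :
    ∃ p q r s A B C : ℤ, p*s-q*r = 1 ∧ (f.sub p q r s).Rel φ A B C ∧ A ≠ 0 ∧
      (∀ n : ℤ, n ∣ A → n ∣ B → n ∣ C → IsUnit n) := by
  obtain ⟨A, B, C, hr, hp⟩ := exists_rel f φ h
  have key : ∀ p q r s : ℤ, p*s-q*r = 1 → A*p^2+B*p*r+C*r^2 ≠ 0 → ∃ p q r s A B C : ℤ, p*s-q*r = 1 ∧ (f.sub p q r s).Rel φ A B C ∧ A ≠ 0 ∧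
      (∀ n : ℤ, n ∣ A → n ∣ B → n ∣ C → IsUnit n) := fun p q r s hd h0 =>
    ⟨p, q, r, s, _, _, _, hd, hr.sub p q r s hd, h0, prim_sub hd hp⟩
  by_cases hA : A = 0
  · by_cases hC : C = 0
    · apply key 1 0 1 1 (by norm_num)
      intro h0
      have hB : B = 0 := by rw [hA, hC] at h0; linarith
      have := hp 0 (by rw [hA]) (by rw [hB]) (by rw [hC])
      exact not_isUnit_zero this
    · apply key 0 (-1) 1 0 (by norm_num)
      simpa using hC
  · apply key 1 0 0 1 (by norm_num)
    simpa using hA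

theorem normal_form (f : BQF) (φ : ℤ) (h : φ^3-3*f.I*φ+f.J = 0) (hd : 4*f.I^3-f.J^2 ≠ 0) :
    ∃ (g : BQF) (A B C : ℤ), f.Equivalent g ∧ g.I = f.I ∧ g.J = f.J ∧ g.Rel φ A B C ∧ A ≠ 0 ∧
      |B| ≤ |A| ∧ A^2 ≤ 16*|B^2-4*A*C| ∧
      |2*(B^2-4*A*C)*g.a - φ*A^2| ≤ 256*(B^2-4*A*C)^2*|4*f.I-φ^2| ∧
      B^2-4*A*C ≠ 0 ∧ B^2-4*A*C ∣ 12*(φ^2-f.I) := by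
  obtain ⟨p, q, r, s, A, B, C, hdet, hrel, hA, hp⟩ := exists_rel' f φ h
  have hI : (f.sub p q r s).I = f.I := by rw [sub_I, hdet]; ring
  obtain ⟨D, hD⟩ : ∃ D, D = B^2-4*A*C := ⟨_, rfl⟩
  have z1 := phi_ne1 h hd
  have z2 := phi_ne2 h hd
  have zA := hrel.ZA hA
  have zB := hrel.ZB hA
  have zC := hrel.ZC hA
  rw [← hD, hI] at zA zB zC
  have hdvd : D ∣ 12*(φ^2-f.I) := int_dvd_of_sq hp ⟨_, zA⟩ ⟨_, zB⟩ ⟨_, zC⟩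
  have hD0 : D ≠ 0 := by
    rintro rfl
    rw [zero_dvd_iff] at hdvd
    omega
  have red : ∃ p' r' : ℤ, IsCoprime p' r' ∧ A*p'^2+B*p'*r'+C*r'^2 ≠ 0 ∧ (A*p'^2+B*p'*r'+C*r'^2)^2 ≤ 16*|D| ∧
      |2*D*((f.sub p q r s).evalZ p' r') - φ*(A*p'^2+B*p'*r'+C*r'^2)^2| ≤ 256*D^2*|4*(f.sub p q r s).I-φ^2| := by
    by_cases hns : D < 0 ∨ IsSquare D
    · exact reduce_other hrel hA hD hD0 hns (by rw [hI]; exact z2)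
    · push Not at hns
      have hpos : 0 < D := lt_of_le_of_ne hns.1 (Ne.symm hD0)
      rw [abs_of_pos hpos]
      exact reduce_nonsq hrel hA hD hpos hns.2 (by rw [hI]; exact z2)
  obtain ⟨p', r', hc, hne, hb, hu⟩ := red
  obtain ⟨q', s', hdet', hB⟩ := complete_vec A B C p' r' hc hne
  have hdisc := disc_sub A B C p' q' r' s' hdet'
  rw [← hD] at hdisc
  have ha' : ((f.sub p q r s).sub p' q' r' s').a = (f.sub p q r s).evalZ p' r' := by
    simp only [sub, evalZ]
  rw [hI] at hu
  refine ⟨(f.sub p q r s).sub p' q' r' s', _, _, _, ?_, ?_, ?_, hrel.sub p' q' r' s' hdet', hne, hB, ?_, ?_, ?_, ?_⟩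
  · rw [sub_sub]
    apply sub_equiv
    linear_combination hdet*(p'*s'-q'*r') + hdet'
  · rw [sub_I, hdet', hI]; ring
  · rw [sub_J, hdet', sub_J, hdet]; ring
  · rw [hdisc]; exact hb
  · rw [hdisc, ha']; exact hu
  · rw [hdisc]; exact hD0
  · rw [hdisc]; exact hdvd

end BQF

theorem exists_int_root (I J : ℤ) (h : ¬Irreducible ((Polynomial.X ^ 3 - Polynomial.C (3 * (I : ℚ)) * Polynomial.X +
        Polynomial.C (J : ℚ) : Polynomial ℚ))) : ∃ φ : ℤ, φ^3-3*I*φ+J = 0 := by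
  obtain ⟨P, hP⟩ : ∃ P : Polynomial ℤ, P = Polynomial.X ^ 3 - Polynomial.C (3 * I) * Polynomial.X +
        Polynomial.C J := ⟨_, rfl⟩
  have hmap : P.map (algebraMap ℤ ℚ) = Polynomial.X ^ 3 - Polynomial.C (3 * (I : ℚ)) * Polynomial.X +
        Polynomial.C (J : ℚ) := by
    rw [hP]; simp
    left; exact (map_ofNat Polynomial.C 3).symm
  have hdeg : P.natDegree = 3 := by rw [hP]; compute_degree!
  have hm : P.Monic := by rw [hP]; monicity!
  rw [← hmap] at h
  have hm' := hm.map (algebraMap ℤ ℚ)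
  have hd' : (P.map (algebraMap ℤ ℚ)).natDegree = 3 := by rw [hm.natDegree_map, hdeg]
  rw [hm'.irreducible_iff_roots_eq_zero_of_degree_le_three (by rw [hd']; norm_num) (by rw [hd'])] at h
  obtain ⟨x, hx⟩ := Multiset.exists_mem_of_ne_zero h
  rw [Polynomial.mem_roots hm'.ne_zero, Polynomial.IsRoot.def, Polynomial.eval_map_algebraMap] at hx
  obtain ⟨n, hn⟩ := isInteger_of_is_root_of_monic hm hx
  refine ⟨n, ?_⟩
  rw [← hn, hP] at hx
  simp only [map_add, map_sub, map_mul, map_pow, Polynomial.aeval_X, Polynomial.aeval_C] at hx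
  simp at hx
  have h2 : ((n^3-3*I*n+J : ℤ) : ℚ) = 0 := by push_cast; linear_combination hx
  exact_mod_cast h2

theorem root_bound {I J φ : ℤ} {X : ℝ} (h : φ^3-3*I*φ+J = 0) (hX : 2 ≤ X)
    (hI : ((|I| : ℤ) : ℝ) ≤ X) (hJ : ((|J| : ℤ) : ℝ) ≤ X) : (φ:ℝ)^2 ≤ 4*X := by
  by_cases h0 : φ = 0
  · rw [h0]; simp; linarith
  have h1 : (1:ℝ) ≤ |(φ:ℝ)| := by exact_mod_cast Int.one_le_abs h0
  have e : (φ:ℝ)^2*φ = 3*I*φ - J := by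
    have : (φ:ℝ)^3-3*I*φ+J = 0 := by exact_mod_cast h
    linarith
  push_cast at hI hJ
  have e2 : (φ:ℝ)^2*|(φ:ℝ)| ≤ 3*X*|(φ:ℝ)| + X := by
    calc (φ:ℝ)^2*|(φ:ℝ)| = |(φ:ℝ)^2*φ| := by rw [abs_mul, abs_of_nonneg (sq_nonneg (φ:ℝ))]
      _ = |(3*I*φ - J : ℝ)| := by rw [e]
      _ ≤ |(3*I*φ:ℝ)| + |(J:ℝ)| := abs_sub _ _
      _ = 3*|(I:ℝ)| * |(φ:ℝ)| + |(J:ℝ)| := by rw [abs_mul, abs_mul]; norm_num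
      _ ≤ _ := by gcongr
  have : (φ:ℝ)^2*|(φ:ℝ)| ≤ (4*X)*|(φ:ℝ)| := by nlinarith
  exact le_of_mul_le_mul_right this (by linarith)

theorem card_fiber_real {α β : Type*} [DecidableEq β] (s : Finset α) (f : α → β) (n : ℝ)
    (hn : ∀ b ∈ s.image f, ((s.filter (fun a => f a = b)).card : ℝ) ≤ n) :
    (s.card : ℝ) ≤ n * ((s.image f).card : ℝ) := by
  rw [Finset.card_eq_sum_card_image f s]
  push_cast
  refine (Finset.sum_le_sum hn).trans ?_
  rw [Finset.sum_const, nsmul_eq_mul, mul_comm]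

theorem int_divisors_card (n : ℤ) (hn : n ≠ 0) (S : Finset ℤ) (hS : ∀ x ∈ S, x ∣ n) :
    S.card ≤ 2 * n.natAbs.divisors.card := by
  classical
  have : S ⊆ n.natAbs.divisors.image (fun k : ℕ => (k:ℤ)) ∪ n.natAbs.divisors.image (fun k : ℕ => -(k:ℤ)) := by
    intro x hx
    have h1 : x.natAbs ∈ n.natAbs.divisors := by
      rw [Nat.mem_divisors]
      exact ⟨Int.natAbs_dvd_natAbs.mpr (hS x hx), Int.natAbs_ne_zero.mpr hn⟩
    rw [Finset.mem_union, Finset.mem_image, Finset.mem_image]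
    rcases Int.natAbs_eq x with h | h
    · left; exact ⟨_, h1, h.symm⟩
    · right; exact ⟨_, h1, h.symm⟩
  calc S.card ≤ _ := Finset.card_le_card this
    _ ≤ _ := Finset.card_union_le _ _
    _ ≤ n.natAbs.divisors.card + n.natAbs.divisors.card := add_le_add Finset.card_image_le Finset.card_image_le
    _ = _ := by ring

theorem pair_count (D : ℤ) (R : ℕ) (dm : ℝ)
    (hdm : ∀ B : ℤ, |B| ≤ R → B^2-D ≠ 0 → ((B^2-D).natAbs.divisors.card : ℝ) ≤ dm) (hdm1 : 1 ≤ dm)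
    (S : Finset (ℤ × ℤ)) (hS : ∀ z ∈ S, |z.1| ≤ R ∧ |z.2| ≤ R ∧ z.1 ∣ z.2^2-D) :
    (S.card : ℝ) ≤ (2*R+1)*(4*dm) := by
  classical
  have hI : ((Finset.Icc (-(R:ℤ)) R).card : ℝ) = 2*R+1 := by
    rw [Int.card_Icc]
    have : ((R:ℤ)+1-(-R)).toNat = 2*R+1 := by omega
    rw [this]; push_cast; ring
  have hsplit : S.card = (S.filter (fun z => z.2^2-D = 0)).card + (S.filter (fun z => ¬ z.2^2-D = 0)).card :=
    (Finset.card_filter_add_card_filter_not _).symm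
  have h1 : ((S.filter (fun z => z.2^2-D = 0)).card : ℝ) ≤ (2*R+1)*2 := by
    rcases (S.filter (fun z => z.2^2-D = 0)).eq_empty_or_nonempty with he | ⟨z0, hz0⟩
    · rw [he]; simp; positivity
    rw [Finset.mem_filter] at hz0
    have hsub : S.filter (fun z => z.2^2-D = 0) ⊆ (Finset.Icc (-(R:ℤ)) R) ×ˢ {z0.2, -z0.2} := by
      intro z hz
      rw [Finset.mem_filter] at hz
      rw [Finset.mem_product, Finset.mem_Icc, ← abs_le]
      refine ⟨(hS z hz.1).1, ?_⟩
      have : z.2^2 = z0.2^2 := by linarith [hz.2, hz0.2]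
      rcases sq_eq_sq_iff_eq_or_eq_neg.mp this with h | h <;> simp [h]
    have := Finset.card_le_card hsub
    rw [Finset.card_product] at this
    have h2 : ({z0.2, -z0.2} : Finset ℤ).card ≤ 2 := Finset.card_le_two
    rw [← hI]
    exact_mod_cast this.trans (Nat.mul_le_mul_left _ h2)
  have h2 : ((S.filter (fun z => ¬ z.2^2-D = 0)).card : ℝ) ≤ (2*dm)*(2*R+1) := by
    refine (card_fiber_real _ (fun z : ℤ × ℤ => z.2) (2*dm) ?_).trans ?_
    · intro b hb
      rw [Finset.mem_image] at hb
      obtain ⟨z0, hz0, rfl⟩ := hb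
      rw [Finset.mem_filter] at hz0
      have hinj : Set.InjOn (fun z : ℤ × ℤ => z.1) (Finset.filter (fun a : ℤ × ℤ => a.2 = z0.2) (S.filter (fun z => ¬ z.2^2-D = 0)) : Set (ℤ × ℤ)) := by
        intro x hx y hy hxy
        simp at hx hy
        exact Prod.ext hxy (hx.2.trans hy.2.symm)
      rw [← Finset.card_image_of_injOn hinj]
      have := int_divisors_card (z0.2^2-D) hz0.2 (Finset.image (fun z : ℤ × ℤ => z.1) (Finset.filter (fun a : ℤ × ℤ => a.2 = z0.2) (S.filter (fun z => ¬ z.2^2-D = 0)))) (by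
        intro x hx
        simp only [Finset.mem_image, Finset.mem_filter] at hx
        obtain ⟨z, ⟨⟨hz, _⟩, hz2⟩, rfl⟩ := hx
        rw [← hz2]; exact (hS z hz).2.2)
      have h3 := hdm z0.2 (hS z0 hz0.1).2.1 hz0.2
      calc _ ≤ ((2 * (z0.2^2-D).natAbs.divisors.card : ℕ) : ℝ) := by exact_mod_cast this
        _ ≤ _ := by push_cast; linarith
    · rw [← hI]
      have : Finset.image (fun z : ℤ × ℤ => z.2) (S.filter (fun z => ¬ z.2^2-D = 0)) ⊆ Finset.Icc (-(R:ℤ)) R := by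
        intro x hx
        simp only [Finset.mem_image, Finset.mem_filter] at hx
        obtain ⟨z, ⟨hz, _⟩, rfl⟩ := hx
        rw [Finset.mem_Icc, ← abs_le]; exact (hS z hz).2.1
      have h4 := Finset.card_le_card this
      gcongr
  rw [hsplit]; push_cast
  have : (0:ℝ) ≤ 2*R+1 := by positivity
  nlinarith

/-- the admissible tuples -/
def Good (φ Z M : ℤ) (t : (ℤ × ℤ × ℤ) × ℤ × ℤ) : Prop :=
  t.1.1 ≠ 0 ∧ t.1.1 ∣ Z ∧ t.1.2.1 ≠ 0 ∧ |t.1.2.2| ≤ |t.1.2.1| ∧ t.1.2.1^2 ≤ 16*|t.1.1| ∧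
  t.1.2.1 ∣ t.1.2.2^2-t.1.1 ∧ 3*(t.2.1^2-t.1.1*t.2.2^2) = t.1.2.1^4*M ∧
  |t.2.1| ≤ 256*t.1.1^2*|M|

theorem triple_count (ε : ℝ) (hε : 0 < ε) : ∃ K : ℝ, 1 ≤ K ∧ ∀ X : ℝ, 2 ≤ X → ∀ Z : ℤ, Z ≠ 0 →
    ((|Z| : ℤ) : ℝ) ≤ 60*X → ∀ S : Finset (ℤ × ℤ × ℤ), (∀ t ∈ S, t.1 ≠ 0 ∧ t.1 ∣ Z ∧
      |t.2.2| ≤ |t.2.1| ∧ t.2.1^2 ≤ 16*|t.1| ∧ t.2.1 ∣ t.2.2^2-t.1) →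
    (S.card : ℝ) ≤ K * (X^((1:ℝ)/2) * X^ε * X^ε) := by
  classical
  obtain ⟨K, hK1, hK⟩ := divisor_bound ε hε
  have p1 : (1:ℝ) ≤ (1020:ℝ)^ε := Real.one_le_rpow (by norm_num) hε.le
  have p2 : (1:ℝ) ≤ (60:ℝ)^ε := Real.one_le_rpow (by norm_num) hε.le
  refine ⟨(63*(4*(K*(1020:ℝ)^ε)))*(2*(K*(60:ℝ)^ε)), ?_, ?_⟩
  · have a1 : 1 ≤ K*(1020:ℝ)^ε := one_le_mul_of_one_le_of_one_le hK1 p1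
    have a2 : 1 ≤ K*(60:ℝ)^ε := one_le_mul_of_one_le_of_one_le hK1 p2
    apply one_le_mul_of_one_le_of_one_le <;> linarith
  intro X hX Z hZ hZX S hS
  have hX0 : 0 ≤ X := by linarith
  have hXe : 1 ≤ X^ε := Real.one_le_rpow (by linarith) hε.le
  have hfib : ∀ b ∈ S.image (fun t : ℤ × ℤ × ℤ => t.1), ((S.filter (fun a => a.1 = b)).card : ℝ) ≤
      63*X^((1:ℝ)/2)*(4*(K*(1020:ℝ)^ε*X^ε)) := by
    intro b hb
    rw [Finset.mem_image] at hb
    obtain ⟨t0, ht0, rfl⟩ := hb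
    obtain ⟨g1, g2, -⟩ := hS t0 ht0
    generalize t0.1 = D at *
    have hDZ : ((|D| : ℤ):ℝ) ≤ 60*X := by
      refine le_trans ?_ hZX
      have := Int.le_of_dvd (abs_pos.mpr hZ) ((abs_dvd_abs D Z).mpr g2)
      exact_mod_cast this
    have hinj : Set.InjOn (fun z : ℤ × ℤ × ℤ => z.2) ((S.filter (fun a => a.1 = D)) : Set (ℤ × ℤ × ℤ)) := by
      intro x hx y hy hxy
      simp at hx hy
      exact Prod.ext (hx.2.trans hy.2.symm) hxy
    rw [← Finset.card_image_of_injOn hinj]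
    obtain ⟨R, hR⟩ : ∃ R, R = Nat.sqrt (16*D.natAbs) := ⟨_, rfl⟩
    have hR2 : R^2 ≤ 16*D.natAbs := by rw [hR]; exact Nat.sqrt_le' _
    have hnA : (D.natAbs : ℝ) = ((|D| : ℤ):ℝ) := by
      rw [Int.abs_eq_natAbs]; simp
    have hR2' : (R:ℝ)^2 ≤ 960*X := by
      have : (R:ℝ)^2 ≤ 16*D.natAbs := by exact_mod_cast hR2
      rw [hnA] at this; linarith
    have hsq : (X^((1:ℝ)/2))^2 = X := by
      rw [← Real.sqrt_eq_rpow, Real.sq_sqrt hX0]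
    have hs1 : 1 ≤ X^((1:ℝ)/2) := Real.one_le_rpow (by linarith) (by norm_num)
    have hRX : (R:ℝ) ≤ 31*X^((1:ℝ)/2) := by
      apply le_of_sq_le_sq _ (by positivity)
      rw [mul_pow, hsq]; linarith
    have := pair_count D R (K*(1020:ℝ)^ε*X^ε) ?_ ?_ (Finset.image (fun z : ℤ × ℤ × ℤ => z.2) (S.filter (fun a => a.1 = D))) ?_
    · refine this.trans ?_
      gcongr
      linarith
    · intro B hB hne
      refine (hK _ (Int.natAbs_ne_zero.mpr hne)).trans ?_
      rw [mul_assoc, ← Real.mul_rpow (by norm_num) hX0]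
      have hb : ((B^2-D).natAbs : ℝ) ≤ 1020*X := by
        have e : ((B^2-D).natAbs : ℝ) = ((|B^2-D| : ℤ) : ℝ) := by
          rw [Int.abs_eq_natAbs]; simp
        rw [e]
        have e1 : |B^2-D| ≤ |B^2| + |D| := abs_sub _ _
        have e2 : |B^2| = |B|^2 := abs_pow _ _
        have e3 : |B|^2 ≤ (R:ℤ)^2 := by gcongr
        rw [e2] at e1
        have e4 : |B^2-D| ≤ (R:ℤ)^2 + |D| := by linarith
        have e5 : ((|B^2-D| : ℤ) : ℝ) ≤ (R:ℝ)^2 + ((|D| : ℤ) : ℝ) := by exact_mod_cast e4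
        linarith
      gcongr
    · exact one_le_mul_of_one_le_of_one_le (one_le_mul_of_one_le_of_one_le hK1 p1) hXe
    · intro z hz
      simp only [Finset.mem_image, Finset.mem_filter] at hz
      obtain ⟨t, ⟨ht, hD⟩, rfl⟩ := hz
      obtain ⟨-, -, k1, k2, k3⟩ := hS t ht
      rw [hD] at k2 k3
      have hA : |t.2.1| ≤ R := by
        have : t.2.1.natAbs ≤ R := by
          rw [hR, Nat.le_sqrt']
          zify; rw [sq_abs]; exact k2
        rw [Int.abs_eq_natAbs]; exact_mod_cast this
      exact ⟨hA, k1.trans hA, k3⟩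
  refine (card_fiber_real S (fun t : ℤ × ℤ × ℤ => t.1) _ hfib).trans ?_
  have hD := int_divisors_card Z hZ (S.image (fun t : ℤ × ℤ × ℤ => t.1)) (by
    intro x hx
    rw [Finset.mem_image] at hx
    obtain ⟨t, ht, rfl⟩ := hx
    exact (hS t ht).2.1)
  have hD2 : ((S.image (fun t : ℤ × ℤ × ℤ => t.1)).card : ℝ) ≤ 2*(K*((60:ℝ)^ε*X^ε)) := by
    have h3 := hK _ (Int.natAbs_ne_zero.mpr hZ)
    have hnA : (Z.natAbs : ℝ) = ((|Z| : ℤ):ℝ) := by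
      rw [Int.abs_eq_natAbs]; simp
    rw [hnA] at h3
    have h4 : ((|Z| : ℤ):ℝ)^ε ≤ (60*X)^ε := by gcongr
    rw [Real.mul_rpow (by norm_num) hX0] at h4
    calc _ ≤ ((2 * Z.natAbs.divisors.card : ℕ) : ℝ) := by exact_mod_cast hD
      _ = 2 * (Z.natAbs.divisors.card : ℝ) := by push_cast; ring
      _ ≤ 2*(K*((60:ℝ)^ε*X^ε)) := by
        have : K*((|Z| : ℤ):ℝ)^ε ≤ K*((60:ℝ)^ε*X^ε) := by gcongr
        linarith
  calc _ ≤ 63*X^((1:ℝ)/2)*(4*(K*(1020:ℝ)^ε*X^ε)) * (2*(K*((60:ℝ)^ε*X^ε))) := by gcongr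
    _ = _ := by ring

theorem good_count (ε : ℝ) (hε : 0 < ε) : ∃ K : ℝ, 0 ≤ K ∧ ∀ X : ℝ, 2 ≤ X → ∀ φ Z M : ℤ, Z ≠ 0 → M ≠ 0 →
    ((|Z| : ℤ) : ℝ) ≤ 60*X → ((|M| : ℤ) : ℝ) ≤ 8*X → ∀ T : Finset ((ℤ × ℤ × ℤ) × ℤ × ℤ),
    (∀ t ∈ T, Good φ Z M t) → (T.card : ℝ) ≤ K * X^((1:ℝ)/2+ε) := by
  classical
  have hη : 0 < ε/32 := by positivity
  obtain ⟨K1, hK1, H1⟩ := triple_count (ε/32) hη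
  obtain ⟨K2, hK2, H2⟩ := rep_count (ε/32) hη
  refine ⟨K2*(7372800:ℝ)^(10*(ε/32))*K1, by positivity, ?_⟩
  intro X hX φ Z M hZ hM hZX hMX T hT
  have hX0 : 0 < X := by linarith
  have hfib : ∀ b ∈ T.image (fun t => t.1), ((T.filter (fun a => a.1 = b)).card : ℝ) ≤
      K2*((7372800:ℝ)*X^3)^(10*(ε/32)) := by
    intro b hb
    rw [Finset.mem_image] at hb
    obtain ⟨t0, ht0, rfl⟩ := hb
    obtain ⟨g1, g2, g3, g4, g5, g6, g7, g8⟩ := hT t0 ht0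
    have hinj : Set.InjOn (fun z : (ℤ × ℤ × ℤ) × ℤ × ℤ => z.2) ((T.filter (fun a => a.1 = t0.1)) : Set ((ℤ × ℤ × ℤ) × ℤ × ℤ)) := by
      intro x hx y hy hxy
      simp at hx hy
      exact Prod.ext (hx.2.trans hy.2.symm) hxy
    rw [← Finset.card_image_of_injOn hinj]
    have hDZ : ((|t0.1.1| : ℤ):ℝ) ≤ 60*X := by
      refine le_trans ?_ hZX
      have := Int.le_of_dvd (abs_pos.mpr hZ) ((abs_dvd_abs t0.1.1 Z).mpr g2)
      exact_mod_cast this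
    have hN0 : t0.2.1^2-t0.1.1*t0.2.2^2 ≠ 0 := by
      intro h0; rw [h0] at g7
      exact mul_ne_zero (pow_ne_zero 4 g3) hM (by linarith)
    have hYe : ((256*t0.1.1^2*|M|).natAbs : ℤ) = 256*t0.1.1^2*|M| :=
      Int.natAbs_of_nonneg (by positivity)
    have hNY : |t0.2.1^2-t0.1.1*t0.2.2^2| ≤ ((256*t0.1.1^2*|M|).natAbs : ℤ) := by
      rw [hYe]
      have e := congrArg abs g7
      rw [abs_mul, abs_mul, abs_of_nonneg (by positivity : 0 ≤ t0.1.2.1^4)] at e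
      have h3 : |(3:ℤ)| = 3 := rfl
      rw [h3] at e
      have h4 : t0.1.2.1^4 ≤ 256*t0.1.1^2 := by
        have : (t0.1.2.1^2)^2 ≤ (16*|t0.1.1|)^2 := by gcongr
        rw [mul_pow, sq_abs] at this; linarith [show (t0.1.2.1^2)^2 = t0.1.2.1^4 by ring]
      have h5 : t0.1.2.1^4*|M| ≤ 256*t0.1.1^2*|M| := by gcongr
      linarith [abs_nonneg (t0.2.1^2-t0.1.1*t0.2.2^2)]
    have := H2 t0.1.1 _ g1 hN0 (256*t0.1.1^2*|M|).natAbs hNY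
      (Finset.image (fun z : (ℤ × ℤ × ℤ) × ℤ × ℤ => z.2) (T.filter (fun a => a.1 = t0.1))) ?_
    · refine this.trans ?_
      have hY : ((256*t0.1.1^2*|M|).natAbs : ℝ) ≤ 7372800*X^3 := by
        have e1 : ((256*t0.1.1^2*|M|).natAbs : ℝ) = ((256*t0.1.1^2*|M| : ℤ) : ℝ) := by
          rw [← hYe]; simp
        have e2 : ((256*t0.1.1^2*|M| : ℤ) : ℝ) = 256*((|t0.1.1| : ℤ) : ℝ)^2*((|M| : ℤ) : ℝ) := by
          push_cast; rw [sq_abs]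
        rw [e1, e2]
        have e3 : (0:ℝ) ≤ ((|t0.1.1| : ℤ) : ℝ) := by exact_mod_cast abs_nonneg _
        have e4 : (0:ℝ) ≤ ((|M| : ℤ) : ℝ) := by exact_mod_cast abs_nonneg _
        calc _ ≤ 256*(60*X)^2*(8*X) := by gcongr
          _ = _ := by ring
      gcongr
    · intro z hz
      simp only [Finset.mem_image, Finset.mem_filter] at hz
      obtain ⟨t, ⟨ht, hD⟩, rfl⟩ := hz
      obtain ⟨-, -, -, -, -, -, k7, k8⟩ := hT t ht
      rw [hD] at k7 k8
      refine ⟨by linarith, by rw [hYe]; exact k8⟩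
  refine (card_fiber_real T (fun t => t.1) _ hfib).trans ?_
  have h3 := H1 X hX Z hZ hZX (T.image (fun t => t.1)) (by
    intro x hx
    rw [Finset.mem_image] at hx
    obtain ⟨t, ht, rfl⟩ := hx
    obtain ⟨g1, g2, g3, g4, g5, g6, g7, g8⟩ := hT t ht
    exact ⟨g1, g2, g4, g5, g6⟩)
  have e1 : ((7372800:ℝ)*X^3)^(10*(ε/32)) = (7372800:ℝ)^(10*(ε/32)) * X^(3*(10*(ε/32))) := by
    rw [Real.mul_rpow (by norm_num) (by positivity), ← Real.rpow_natCast, ← Real.rpow_mul hX0.le]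
    norm_num
  have e2 : X^((1:ℝ)/2+ε) = X^(3*(10*(ε/32))) * (X^((1:ℝ)/2) * X^(ε/32) * X^(ε/32)) := by
    rw [← Real.rpow_add hX0, ← Real.rpow_add hX0, ← Real.rpow_add hX0]
    congr 1; ring
  rw [e1, e2]
  calc _ ≤ K2*((7372800:ℝ)^(10*(ε/32)) * X^(3*(10*(ε/32)))) * (K1 * (X^((1:ℝ)/2) * X^(ε/32) * X^(ε/32))) := by gcongr
    _ = _ := by ring

/-- If the cubic resolvent `x³ - 3Ix + J` is reducible over `ℚ` and `|I|, |J| ≤ X` with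
`4I³ - J² ≠ 0`, then the number of `GL₂(ℤ)`-classes of integral binary quartic forms
with invariants `I` and `J` is at most `K_ε · X^{1/2+ε}`. -/
theorem classes_with_reducible_resolvent_bound (ε : ℝ) (hε : 0 < ε) :
    ∃ K : ℝ, ∀ X : ℝ, 2 ≤ X → ∀ I₀ J₀ : ℤ,
      ((|I₀| : ℤ) : ℝ) ≤ X → ((|J₀| : ℤ) : ℝ) ≤ X → 4 * I₀ ^ 3 - J₀ ^ 2 ≠ 0 →
      ¬Irreducible ((Polynomial.X ^ 3 - Polynomial.C (3 * (I₀ : ℚ)) * Polynomial.X +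
        Polynomial.C (J₀ : ℚ) : Polynomial ℚ)) →
      ((classCount fun f => f.I = I₀ ∧ f.J = J₀) : ℝ) ≤ K * X ^ (1 / 2 + ε) := by
  classical
  obtain ⟨K, hK0, hK⟩ := good_count ε hε
  refine ⟨K, ?_⟩
  intro X hX I₀ J₀ hI hJ hd hirr
  obtain ⟨φ, hφ⟩ := exists_int_root I₀ J₀ hirr
  have hφb := root_bound hφ hX hI hJ
  have z1 := BQF.phi_ne1 hφ hd
  have z2 := BQF.phi_ne2 hφ hd
  have hZX : ((|12*(φ^2-I₀)| : ℤ) : ℝ) ≤ 60*X := by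
    push_cast at hI ⊢
    rw [abs_le] at hI ⊢
    constructor <;> nlinarith [hI.1, hI.2, sq_nonneg (φ:ℝ)]
  have hMX : ((|4*I₀-φ^2| : ℤ) : ℝ) ≤ 8*X := by
    push_cast at hI ⊢
    rw [abs_le] at hI ⊢
    constructor <;> nlinarith [hI.1, hI.2, sq_nonneg (φ:ℝ)]
  unfold classCount
  set P : BQF → Prop := fun f => f.I = I₀ ∧ f.J = J₀ with hP
  have key : ∀ q : Quot (fun f g : {h : BQF // P h} => BQF.Equivalent f.1 g.1),
      ∃ (t : (ℤ × ℤ × ℤ) × ℤ × ℤ), Good φ (12*(φ^2-I₀)) (4*I₀-φ^2) t ∧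
        ∃ (g : {h : BQF // P h}) (C : ℤ), q = Quot.mk _ g ∧ g.1.Rel φ t.1.2.1 t.1.2.2 C ∧
          t.1.1 = t.1.2.2^2-4*t.1.2.1*C ∧ t.2.1 = 2*t.1.1*g.1.a - φ*t.1.2.1^2 ∧
          t.2.2 = 2*t.1.2.2*g.1.a - t.1.2.1*g.1.b := by
    intro q
    induction q using Quot.ind with
    | mk f =>
      obtain ⟨f, hfI, hfJ⟩ := f
      obtain ⟨g, A, B, C, he, hgI, hgJ, hrel, hA, hB, hA2, hu, hD0, hdvd⟩ :=
        BQF.normal_form f φ (by rw [hfI, hfJ]; exact hφ) (by rw [hfI, hfJ]; exact hd)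
      have hn := hrel.norm hA
      rw [hgI, hfI] at hn
      rw [hfI] at hu hdvd
      refine ⟨((B^2-4*A*C, A, B), 2*(B^2-4*A*C)*g.a - φ*A^2, 2*B*g.a-A*g.b),
        ⟨hD0, hdvd, hA, hB, hA2, ⟨4*C, by ring⟩, hn, hu⟩,
        ⟨g, hgI.trans hfI, hgJ.trans hfJ⟩, C, Quot.sound he, hrel, rfl, rfl, rfl⟩
  choose t ht g C hq hrel h1 h2 h3 using key
  have hinj : Function.Injective t := by
    intro q q' h
    have k1 := hrel q'
    have k2 := h1 q'
    have k3 := h2 q'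
    have k4 := h3 q'
    have l1 := hrel q
    have l2 := h1 q
    have l3 := h2 q
    have l4 := h3 q
    have gd := ht q
    rw [← h] at k1 k2 k3 k4
    obtain ⟨g1, -, g3, -⟩ := gd
    have hC : C q = C q' := by
      apply mul_left_cancel₀ (mul_ne_zero (four_ne_zero) g3)
      linear_combination l2 - k2
    have ha : (g q).1.a = (g q').1.a := by
      apply mul_left_cancel₀ (mul_ne_zero two_ne_zero g1)
      linear_combination k3 - l3
    have hb : (g q).1.b = (g q').1.b := by
      apply mul_left_cancel₀ g3
      rw [ha] at l4
      linear_combination l4 - k4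
    rw [hC] at l1
    have := BQF.Rel.determined g3 l1 k1 ha hb
    rw [hq q, hq q', Subtype.ext this]
  cases finite_or_infinite (Quot (fun f g : {h : BQF // P h} => BQF.Equivalent f.1 g.1)) with
  | inr hinf =>
    rw [Nat.card_eq_zero_of_infinite]
    push_cast
    positivity
  | inl hfin =>
    have := Fintype.ofFinite (Quot (fun f g : {h : BQF // P h} => BQF.Equivalent f.1 g.1))
    rw [Nat.card_eq_fintype_card, ← Finset.card_univ, ← Finset.card_image_of_injective _ hinj]
    apply hK X hX φ _ _ (mul_ne_zero (by norm_num) z1) z2 hZX hMX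
    intro x hx
    rw [Finset.mem_image] at hx
    obtain ⟨q, -, rfl⟩ := hx
    exact ht q
end
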